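/- Let q be a power of two and let f be an o-polynomial of F_q of degree less than (1/2)·q^{1/4}. Then f is equivalent to either x^6 or x^{2^k} for some positive integer k. -/

import Mathlib

open Polynomial

/-- An o-polynomial of a finite field `F`: a polynomial of degree at most `|F| - 1`
inducing a permutation of `F` with `f(0) = 0`, `f(1) = 1`, such that no three points
of the graph of `f` are collinear. -/
def IsOPoly (F : Type*) [Field F] [Finite F] (f : F[X]) : Prop :=
  f.natDegree ≤ Nat.card F - 1 ∧
  Function.Bijective (fun x : F => f.eval x) ∧
  f.eval 0 = 0 ∧ f.eval 1 = 1 ∧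
  ∀ a b c : F, a ≠ b → a ≠ c → b ≠ c →
    Matrix.det !![1, 1, 1; a, b, c; f.eval a, f.eval b, f.eval c] ≠ 0

/-- Two polynomials `f`, `g` are equivalent if
`g(x) = (f(x+a) + f(a)) / (f(1+a) + f(a))` for some `a ∈ F`. -/
def OEquiv (F : Type*) [Field F] (f g : F[X]) : Prop :=
  ∃ a : F, g = Polynomial.C (f.eval (1 + a) + f.eval a)⁻¹ *
    (f.comp (Polynomial.X + Polynomial.C a) + Polynomial.C (f.eval a))

/-- total degree bound for bivariate polynomials -/
def TD {R : Type*} [CommRing R] (D : ℕ) (p : R[X][X]) : Prop :=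
  ∀ i j, (p.coeff j).coeff i ≠ 0 → i + j ≤ D

section TDsec
variable {R : Type*} [CommRing R]

lemma TD_zero (D : ℕ) : TD D (0 : R[X][X]) := by intro i j h; simp at h

lemma TD_mono {D E : ℕ} (h : D ≤ E) {p : R[X][X]} (hp : TD D p) : TD E p :=
  fun i j hij => (hp i j hij).trans h

lemma TD_add {D : ℕ} {p q : R[X][X]} (hp : TD D p) (hq : TD D q) : TD D (p + q) := by
  intro i j h
  by_contra hc
  apply h
  have h1 : (p.coeff j).coeff i = 0 := by
    by_contra h1; exact hc (hp i j h1)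
  have h2 : (q.coeff j).coeff i = 0 := by
    by_contra h1; exact hc (hq i j h1)
  simp [h1, h2]

lemma TD_neg {D : ℕ} {p : R[X][X]} (hp : TD D p) : TD D (-p) := by
  intro i j h
  apply hp i j
  intro h0; apply h; simp [h0]

lemma TD_sub {D : ℕ} {p q : R[X][X]} (hp : TD D p) (hq : TD D q) : TD D (p - q) := by
  rw [sub_eq_add_neg]; exact TD_add hp (TD_neg hq)

lemma TD_sum {ι : Type*} {D : ℕ} (s : Finset ι) (p : ι → R[X][X]) (hp : ∀ i ∈ s, TD D (p i)) :
    TD D (∑ i ∈ s, p i) := by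
  classical
  induction s using Finset.induction_on with
  | empty => simpa using TD_zero D
  | insert a s ha ih =>
    rw [Finset.sum_insert ha]
    exact TD_add (hp a (by simp)) (ih fun i hi => hp i (by simp [hi]))

lemma TD_mul {D E : ℕ} {p q : R[X][X]} (hp : TD D p) (hq : TD E q) : TD (D + E) (p * q) := by
  intro i j h
  rw [coeff_mul, finsetSum_coeff] at h
  obtain ⟨⟨a, b⟩, hab, h1⟩ := Finset.exists_ne_zero_of_sum_ne_zero h
  rw [coeff_mul] at h1
  obtain ⟨⟨c, d⟩, hcd, h2⟩ := Finset.exists_ne_zero_of_sum_ne_zero h1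
  have hab' := Finset.HasAntidiagonal.mem_antidiagonal.mp hab
  have hcd' := Finset.HasAntidiagonal.mem_antidiagonal.mp hcd
  dsimp only at hab' hcd' h2
  have h3 := hp c a (left_ne_zero_of_mul h2)
  have h4 := hq d b (right_ne_zero_of_mul h2)
  omega

lemma TD_CC (c : R) : TD 0 (C (C c) : R[X][X]) := by
  intro i j h
  rcases j with _ | j
  · rcases i with _ | i
    · simp
    · simp at h
  · simp at h

lemma TD_C {D : ℕ} {p : R[X]} (h : p.natDegree ≤ D) : TD D (C p : R[X][X]) := by
  intro i j hij
  rcases j with _ | j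
  · simp only [coeff_C_zero] at hij
    have := le_natDegree_of_ne_zero hij
    omega
  · simp at hij

lemma TD_one : TD 0 (1 : R[X][X]) := by simpa using TD_CC (1 : R)

lemma TD_pow {D : ℕ} {p : R[X][X]} (hp : TD D p) (k : ℕ) : TD (k * D) (p ^ k) := by
  induction k with
  | zero => simpa using TD_one
  | succ k ih => rw [pow_succ]; exact TD_mono (by rw [Nat.succ_mul]) (TD_mul ih hp)

lemma TD_X : TD 1 (X : R[X][X]) := by
  intro i j h
  rw [coeff_X] at h
  split_ifs at h with h1
  · subst h1
    rw [coeff_one] at h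
    split_ifs at h with h2
    · omega
    · simp at h
  · simp at h

lemma TD_CX : TD 1 (C X : R[X][X]) := TD_C natDegree_X_le

lemma TD_coeff {D : ℕ} {p : R[X][X]} (hp : TD D p) (j : ℕ) :
    p.coeff j = 0 ∨ (p.coeff j).natDegree + j ≤ D := by
  by_cases h : p.coeff j = 0
  · exact Or.inl h
  · right
    have := hp _ j (leadingCoeff_ne_zero.mpr h)
    exact this

lemma TD_of_coeff {D : ℕ} {p : R[X][X]} (hp : ∀ j, p.coeff j = 0 ∨ (p.coeff j).natDegree + j ≤ D) :
    TD D p := by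
  intro i j h
  rcases hp j with h1 | h1
  · simp [h1] at h
  · have := le_natDegree_of_ne_zero h
    omega

lemma TD_modByMonic [Nontrivial R] {n D : ℕ} {Φ : R[X][X]} (hm : Φ.Monic) (hn : Φ.natDegree = n) (hΦ : TD n Φ) :
    ∀ (p : R[X][X]), TD D p → TD D (p %ₘ Φ) := by
  suffices h : ∀ (m : ℕ) (p : R[X][X]), p.natDegree ≤ m → TD D p → TD D (p %ₘ Φ) from
    fun p hp => h _ p le_rfl hp
  intro m
  induction m with
  | zero =>
    intro p hp hT
    by_cases hn0 : n = 0
    · have : Φ = 1 := by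
        rw [hn0] at hn
        exact hm.natDegree_eq_zero.mp hn
      subst this
      simpa using TD_zero D
    · rw [(modByMonic_eq_self_iff hm).2]
      · exact hT
      · rw [degree_eq_natDegree hm.ne_zero, hn]
        apply lt_of_le_of_lt degree_le_natDegree
        have : p.natDegree < n := by omega
        exact_mod_cast this
  | succ m ih =>
    intro p hp hT
    by_cases hlt : p.natDegree < n
    · rw [(modByMonic_eq_self_iff hm).2]
      · exact hT
      · rw [degree_eq_natDegree hm.ne_zero, hn]
        apply lt_of_le_of_lt degree_le_natDegree
        exact_mod_cast hlt
    · push Not at hlt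
      by_cases hn0 : n = 0
      · have : Φ = 1 := by
          rw [hn0] at hn
          exact hm.natDegree_eq_zero.mp hn
        subst this
        simpa using TD_zero D
      set t : R[X][X] := C p.leadingCoeff * X ^ (p.natDegree - n) with ht
      have hmod : p %ₘ Φ = (p - t * Φ) %ₘ Φ := by
        rw [sub_modByMonic, (modByMonic_eq_zero_iff_dvd hm).2 (Dvd.intro_left t rfl), sub_zero]
      rw [hmod]
      by_cases hp0 : p.leadingCoeff = 0
      · rw [ht, hp0]
        have : p = 0 := leadingCoeff_eq_zero.mp hp0
        simp [this]
        exact TD_zero D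
      apply ih
      · have hc : (p - t * Φ).natDegree ≤ m + 1 := by
          apply (natDegree_sub_le _ _).trans
          apply max_le hp
          apply (natDegree_mul_le).trans
          have : t.natDegree ≤ p.natDegree - n := natDegree_C_mul_X_pow_le _ _
          omega
        by_contra hcon
        have heq : (p - t * Φ).natDegree = m + 1 := by omega
        have hne : (p - t * Φ).coeff (m+1) ≠ 0 := by
          rw [← heq]
          intro h0
          have : p - t * Φ = 0 := leadingCoeff_eq_zero.mp h0
          rw [this] at heq
          simp at heq
        apply hne
        rcases eq_or_lt_of_le hp with h1 | h1
        · rw [coeff_sub, ht, mul_assoc, coeff_C_mul, ← h1]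
          have : p.natDegree = n + (p.natDegree - n) := by omega
          conv_lhs => rw [this]
          rw [coeff_X_pow_mul' ]
          have h2 : n + (p.natDegree - n) - (n + (p.natDegree - n) - n) = n := by omega
          rw [if_pos (by omega), h2]
          have : Φ.coeff n = 1 := by rw [← hn]; exact hm
          rw [this, mul_one]
          have : n + (p.natDegree - n) = p.natDegree := by omega
          rw [this]
          simp
        · rw [coeff_sub, coeff_eq_zero_of_natDegree_lt (by omega), zero_sub, neg_eq_zero]
          apply coeff_eq_zero_of_natDegree_lt
          apply (natDegree_mul_le).trans_lt
          have : t.natDegree ≤ p.natDegree - n := natDegree_C_mul_X_pow_le _ _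
          omega
      · rcases TD_coeff hT p.natDegree with h1 | h1
        · exact absurd h1 hp0
        · apply TD_sub hT
          have h3 : TD (p.leadingCoeff.natDegree + (p.natDegree - n) * 1) t :=
            TD_mul (TD_C le_rfl) (TD_pow TD_X _)
          refine TD_mono ?_ (TD_mul h3 hΦ)
          have : p.coeff p.natDegree = p.leadingCoeff := rfl
          rw [this] at h1
          omega

end TDsec

lemma det_natDegree_bound {R : Type*} [CommRing R] {n : ℕ} (B : ℕ)
    (M : Matrix (Fin n) (Fin n) R[X])
    (hM : ∀ i j, M i j = 0 ∨ (M i j).natDegree + i ≤ B + j) : M.det.natDegree ≤ n * B := by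
  rw [Matrix.det_apply]
  apply natDegree_sum_le_of_forall_le
  intro σ _
  have key : (∏ i, M (σ i) i).natDegree ≤ n * B := by
    by_cases h : ∃ i, M (σ i) i = 0
    · obtain ⟨i, hi⟩ := h
      rw [Finset.prod_eq_zero (f := fun i => M (σ i) i) (Finset.mem_univ i) hi]; simp
    · push Not at h
      have h1 : ∑ i, ((M (σ i) i).natDegree + (σ i : ℕ)) ≤ ∑ i : Fin n, (B + (i : ℕ)) := by
        apply Finset.sum_le_sum
        intro i _
        rcases hM (σ i) i with h2 | h2
        · exact absurd h2 (h i)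
        · exact h2
      rw [Finset.sum_add_distrib, Finset.sum_add_distrib,
        Equiv.sum_comp σ (fun i : Fin n => (i : ℕ))] at h1
      have h2 := natDegree_prod_le Finset.univ (fun i => M (σ i) i)
      simp at h1
      omega
  rcases Int.units_eq_one_or (Equiv.Perm.sign σ) with h | h <;> simp [h, key]

section
variable {R : Type*} [CommRing R]

noncomputable def mulMat {Φ : R[X][X]} (hm : Φ.Monic) (a : R[X][X]) :
    Matrix (Fin Φ.natDegree) (Fin Φ.natDegree) R[X] :=
  Algebra.leftMulMatrix (AdjoinRoot.powerBasisAux' hm) (AdjoinRoot.mk Φ a)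

lemma mulMat_apply [IsDomain R] {Φ : R[X][X]} (hm : Φ.Monic) (a : R[X][X]) (i j : Fin Φ.natDegree) :
    mulMat hm a i j = ((a * X ^ (j : ℕ)) %ₘ Φ).coeff i := by
  have hb : (AdjoinRoot.powerBasisAux' hm) j = AdjoinRoot.mk Φ (X ^ (j : ℕ)) := by
    have := (AdjoinRoot.powerBasis' hm).basis_eq_pow j
    rw [map_pow, AdjoinRoot.mk_X]
    exact this
  rw [mulMat, Algebra.leftMulMatrix_eq_repr_mul, hb, ← map_mul,
    AdjoinRoot.powerBasisAux'_repr_apply_to_fun, AdjoinRoot.modByMonicHom_mk]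

lemma mulMat_add {Φ : R[X][X]} (hm : Φ.Monic) (a b : R[X][X]) :
    mulMat hm (a + b) = mulMat hm a + mulMat hm b := by simp [mulMat]

lemma mulMat_mul {Φ : R[X][X]} (hm : Φ.Monic) (a b : R[X][X]) :
    mulMat hm (a * b) = mulMat hm a * mulMat hm b := by simp [mulMat]

lemma mulMat_pow {Φ : R[X][X]} (hm : Φ.Monic) (a : R[X][X]) (r : ℕ) :
    mulMat hm (a ^ r) = mulMat hm a ^ r := by simp [mulMat]

lemma mulMat_C {Φ : R[X][X]} (hm : Φ.Monic) (c : R[X]) (a : R[X][X]) :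
    mulMat hm (C c * a) = c • mulMat hm a := by
  rw [mulMat, mulMat, ← map_smul]
  congr 1
  rw [map_mul, Algebra.smul_def]
  rfl

lemma mulMat_self {Φ : R[X][X]} (hm : Φ.Monic) (a : R[X][X]) : mulMat hm (Φ * a) = 0 := by
  simp [mulMat]

lemma mulMat_det_bound [IsDomain R] {Φ : R[X][X]} (hm : Φ.Monic) (hΦ : TD Φ.natDegree Φ)
    {B : ℕ} {a : R[X][X]} (ha : TD B a) : (mulMat hm a).det.natDegree ≤ Φ.natDegree * B := by
  apply det_natDegree_bound
  intro i j
  rw [mulMat_apply]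
  have h : TD (B + j) ((a * X ^ (j : ℕ)) %ₘ Φ) := by
    apply TD_modByMonic hm rfl hΦ
    exact TD_mono (by simp) (TD_mul ha (TD_pow TD_X _))
  exact TD_coeff h i

lemma mulMat_det_ne_zero [IsDomain R] {Φ : R[X][X]} (hm : Φ.Monic) (hp : Prime Φ)
    {a : R[X][X]} (ha : a ≠ 0) (hd : a.natDegree < Φ.natDegree) : (mulMat hm a).det ≠ 0 := by
  have : IsDomain (AdjoinRoot Φ) := AdjoinRoot.isDomain_of_prime hp
  have : Module.Free R[X] (AdjoinRoot Φ) := Module.Free.of_basis (AdjoinRoot.powerBasisAux' hm)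
  have : Module.Finite R[X] (AdjoinRoot Φ) := Module.Finite.of_basis (AdjoinRoot.powerBasisAux' hm)
  rw [mulMat, ← Algebra.norm_eq_matrix_det]
  apply Algebra.norm_ne_zero_iff.mpr
  rw [Ne, AdjoinRoot.mk_eq_zero]
  intro hdvd
  exact ha (by
    by_contra h0
    exact absurd (natDegree_le_of_dvd hdvd h0) (by omega))

/-- if the point `(x0, y0)` lies on `Φ` and on `b` then the norm of `b` vanishes at `x0` -/
lemma mulMat_det_eval {S : Type*} [Field S] [IsDomain R] {Φ : R[X][X]} (hm : Φ.Monic)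
    (hn : 0 < Φ.natDegree) (ev : R[X][X] →+* S) (hev : ev Φ = 0) (b : R[X][X]) (hb : ev b = 0) :
    ev (C (mulMat hm b).det) = 0 := by
  set N : Matrix (Fin Φ.natDegree) (Fin Φ.natDegree) S := (mulMat hm b).map (ev.comp C) with hN
  have h1 : ev (C (mulMat hm b).det) = N.det := by
    rw [hN]
    exact RingHom.map_det (ev.comp C) _
  rw [h1]
  apply Matrix.exists_vecMul_eq_zero_iff.mp
  refine ⟨fun i => ev X ^ (i : ℕ), ?_, ?_⟩
  · intro h
    have := congrFun h ⟨0, hn⟩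
    simp at this
  · ext j
    simp only [Matrix.vecMul, dotProduct, hN, Matrix.map_apply, mulMat_apply, RingHom.comp_apply,
      Pi.zero_apply]
    set p := (b * X ^ (j : ℕ)) %ₘ Φ with hp
    have hp0 : ev p = 0 := by
      have := modByMonic_add_div (b * X ^ (j : ℕ)) Φ
      have h2 := congrArg ev this
      rw [map_add, map_mul, hev, zero_mul, add_zero, map_mul, hb, zero_mul] at h2
      exact h2
    have hdeg : p.natDegree < Φ.natDegree := by
      apply natDegree_modByMonic_lt _ hm
      intro h; rw [h] at hn; simp at hn
    have hsum : p = ∑ i : Fin Φ.natDegree, C (p.coeff i) * X ^ (i : ℕ) := by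
      conv_lhs => rw [p.as_sum_range_C_mul_X_pow' hdeg]
      rw [Finset.sum_range]
    rw [← hp0]
    conv_rhs => rw [hsum]
    rw [map_sum]
    apply Finset.sum_congr rfl
    intro i _
    rw [map_mul, map_pow, mul_comm]
end

lemma prime_of_irred_bi {K : Type*} [Field K] {Φ : K[X][X]} (h : Irreducible Φ) : Prime Φ :=
  UniqueFactorizationMonoid.irreducible_iff_prime.mp h

/-- evaluation at a point -/
noncomputable def evP {K : Type*} [CommRing K] (x y : K) : K[X][X] →+* K :=
  (evalRingHom y).comp (mapRingHom (evalRingHom x))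

lemma evP_apply {K : Type*} [CommRing K] (x y : K) (p : K[X][X]) :
    evP x y p = (p.map (evalRingHom x)).eval y := rfl

@[simp] lemma evP_C {K : Type*} [CommRing K] (x y : K) (p : K[X]) :
    evP x y (C p) = p.eval x := by simp [evP]

@[simp] lemma evP_X {K : Type*} [CommRing K] (x y : K) :
    evP x y X = y := by simp [evP]

lemma point_contra {K : Type*} [Field K] {Φ : K[X][X]} (hm : Φ.Monic) (hirr : Irreducible Φ)
    (hn : 0 < Φ.natDegree) (hΦ : TD Φ.natDegree Φ) {B r : ℕ} (hB : Φ.natDegree * B < r)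
    (x0 y0 : K) (hP : evP x0 y0 Φ = 0) (a α β γ : K[X][X]) (ha : TD B a)
    (had : a.natDegree < Φ.natDegree)
    (h : a = C ((X - C x0) ^ r) * α + (X - C (C y0)) ^ r * β + Φ * γ) : a = 0 := by
  by_contra ha0
  have hdet := mulMat_det_ne_zero hm (prime_of_irred_bi hirr) ha0 had
  have hbd := mulMat_det_bound hm hΦ ha
  have hdvd : (X - C x0) ^ r ∣ (mulMat hm a).det := by
    set I := Ideal.span {(X - C x0) ^ r} with hI
    rw [← Ideal.mem_span_singleton, ← Ideal.Quotient.eq_zero_iff_mem]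
    rw [RingHom.map_det]
    have h1 : (Ideal.Quotient.mk I).mapMatrix (mulMat hm a) =
        (Ideal.Quotient.mk I).mapMatrix (mulMat hm (X - C (C y0)) ^ r * mulMat hm β) := by
      conv_lhs => rw [h]
      rw [mulMat_add, mulMat_add, mulMat_self, add_zero, map_add, mulMat_C, mulMat_mul, mulMat_pow]
      have : (Ideal.Quotient.mk I).mapMatrix ((X - C x0) ^ r • mulMat hm α) = 0 := by
        ext i j
        simp only [RingHom.mapMatrix_apply, Matrix.map_apply, Matrix.smul_apply, smul_eq_mul,
          map_mul, Matrix.zero_apply]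
        rw [Ideal.Quotient.eq_zero_iff_mem.mpr (Ideal.mem_span_singleton_self _), zero_mul]
      rw [this, zero_add]
    rw [h1, ← RingHom.map_det, Ideal.Quotient.eq_zero_iff_mem, Ideal.mem_span_singleton,
      Matrix.det_mul, Matrix.det_pow]
    apply Dvd.dvd.mul_right
    apply pow_dvd_pow_of_dvd
    rw [dvd_iff_isRoot, IsRoot.def, ← evP_C x0 y0]
    apply mulMat_det_eval hm hn _ hP
    simp
  have := natDegree_le_of_dvd hdvd hdet
  rw [natDegree_pow, natDegree_X_sub_C] at this
  omega

section
variable {R : Type*} [CommRing R]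

noncomputable def dec (Q : ℕ) (p : R[X]) : R[X] :=
  ∑ i ∈ Finset.range (p.natDegree + 1), monomial i (p.coeff (Q * i + (Q - 1)))

lemma dec_coeff {Q : ℕ} (hQ : 0 < Q) (p : R[X]) (i : ℕ) :
    (dec Q p).coeff i = p.coeff (Q * i + (Q - 1)) := by
  rw [dec, finsetSum_coeff]
  simp only [coeff_monomial]
  rw [Finset.sum_ite_eq' ]
  split_ifs with h
  · rfl
  · rw [coeff_eq_zero_of_natDegree_lt]
    simp at h
    nlinarith

lemma dec_add {Q : ℕ} (hQ : 0 < Q) (p q : R[X]) : dec Q (p + q) = dec Q p + dec Q q := by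
  ext i; simp [dec_coeff hQ]

lemma dec_zero {Q : ℕ} (hQ : 0 < Q) : dec Q (0 : R[X]) = 0 := by
  ext i; simp [dec_coeff hQ]

lemma dec_expand {Q : ℕ} (hQ : 0 < Q) (a h : R[X]) : dec Q (expand R Q a * h) = a * dec Q h := by
  induction a using Polynomial.induction_on' with
  | add p q hp hq => rw [map_add, add_mul, dec_add hQ, hp, hq, add_mul]
  | monomial k c =>
    ext i
    rw [dec_coeff hQ, expand_monomial, ← C_mul_X_pow_eq_monomial, ← C_mul_X_pow_eq_monomial,
      mul_assoc, mul_assoc, coeff_C_mul, coeff_C_mul, coeff_X_pow_mul', coeff_X_pow_mul',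
      dec_coeff hQ]
    by_cases hk : k ≤ i
    · rw [if_pos hk, if_pos (by nlinarith)]
      congr 2
      obtain ⟨m, rfl⟩ := Nat.exists_eq_add_of_le hk
      rw [Nat.add_sub_cancel_left]
      have : Q * (k + m) + (Q - 1) = k * Q + (Q * m + (Q - 1)) := by ring
      omega
    · rw [if_neg hk, if_neg]
      push Not at hk ⊢
      have : Q * (i + 1) ≤ Q * k := Nat.mul_le_mul_left _ hk
      have h2 : Q * (i + 1) = Q * i + Q := by ring
      have h3 : Q * k = k * Q := mul_comm _ _
      omega

noncomputable def TT (Q : ℕ) (p : R[X][X]) : R[X][X] :=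
  ∑ j ∈ Finset.range (p.natDegree + 1), monomial j (dec Q (p.coeff (Q * j + (Q - 1))))

lemma TT_coeff {Q : ℕ} (hQ : 0 < Q) (p : R[X][X]) (j : ℕ) :
    (TT Q p).coeff j = dec Q (p.coeff (Q * j + (Q - 1))) := by
  rw [TT, finsetSum_coeff]
  simp only [coeff_monomial]
  rw [Finset.sum_ite_eq' ]
  split_ifs with h
  · rfl
  · rw [coeff_eq_zero_of_natDegree_lt, dec_zero hQ]
    simp at h
    nlinarith

lemma TT_add {Q : ℕ} (hQ : 0 < Q) (p q : R[X][X]) : TT Q (p + q) = TT Q p + TT Q q := by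
  ext1 i; simp [TT_coeff hQ, dec_add hQ]

lemma TT_CC {Q : ℕ} (hQ : 0 < Q) (c : R) (p : R[X][X]) :
    TT Q (C (C c) * p) = C (C c) * TT Q p := by
  ext i j; simp [TT_coeff hQ, dec_coeff hQ]

/-- substitution `X ↦ X^Q`, `Y ↦ Y^Q` -/
noncomputable def exp2 (Q : ℕ) : R[X][X] →+* R[X][X] :=
  ((expand R[X] Q : R[X][X] →ₐ[R[X]] R[X][X]) : R[X][X] →+* R[X][X]).comp
    (mapRingHom ((expand R Q : R[X] →ₐ[R] R[X]) : R[X] →+* R[X]))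

lemma exp2_C (Q : ℕ) (a : R[X]) : exp2 Q (C a) = C (expand R Q a) := by
  simp [exp2]

lemma exp2_X (Q : ℕ) : exp2 Q (X : R[X][X]) = X ^ Q := by
  simp [exp2]

lemma exp2_monomial (Q k : ℕ) (c : R[X]) :
    exp2 Q (monomial k c) = C (expand R Q c) * X ^ (Q * k) := by
  rw [← C_mul_X_pow_eq_monomial, map_mul, map_pow, exp2_C, exp2_X, pow_mul]

lemma TT_exp2 {Q : ℕ} (hQ : 0 < Q) (a h : R[X][X]) : TT Q (exp2 Q a * h) = a * TT Q h := by
  induction a using Polynomial.induction_on' with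
  | add p q hp hq => rw [map_add, add_mul, TT_add hQ, hp, hq, add_mul]
  | monomial k c =>
    ext1 i
    rw [TT_coeff hQ, exp2_monomial, ← C_mul_X_pow_eq_monomial,
      mul_assoc, mul_assoc, coeff_C_mul, coeff_C_mul, coeff_X_pow_mul', coeff_X_pow_mul',
      TT_coeff hQ, dec_expand hQ]
    by_cases hk : k ≤ i
    · rw [if_pos hk, if_pos (by nlinarith)]
      congr 3
      obtain ⟨m, rfl⟩ := Nat.exists_eq_add_of_le hk
      rw [Nat.add_sub_cancel_left]
      have : Q * (k + m) + (Q - 1) = Q * k + (Q * m + (Q - 1)) := by ring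
      omega
    · rw [if_neg hk, if_neg, dec_zero hQ]
      push Not at hk ⊢
      have : Q * (i + 1) ≤ Q * k := Nat.mul_le_mul_left _ hk
      have h2 : Q * (i + 1) = Q * i + Q := by ring
      omega

lemma TD_TT {Q : ℕ} (hQ : 0 < Q) {E B : ℕ} (hEB : ∀ m, Q * m + 2 * (Q - 1) ≤ E → m ≤ B)
    {p : R[X][X]} (hp : TD E p) : TD B (TT Q p) := by
  intro i j h
  rw [TT_coeff hQ, dec_coeff hQ] at h
  have := hp _ _ h
  apply hEB
  rw [mul_add]
  omega

/-- one-variable decomposition -/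
lemma dec_decomp {Q : ℕ} (hQ : 0 < Q) (u : R[X]) :
    u = ∑ α ∈ Finset.range Q, X ^ α * expand R Q (dec Q (X ^ (Q - 1 - α) * u)) := by
  ext m
  rw [finsetSum_coeff]
  rw [Finset.sum_eq_single (m % Q)]
  · rw [coeff_X_pow_mul', if_pos (Nat.mod_le _ _), coeff_expand hQ]
    have h1 : m - m % Q = Q * (m / Q) := by
      have := Nat.div_add_mod m Q; omega
    rw [h1, if_pos (Dvd.intro _ rfl), Nat.mul_div_cancel_left _ hQ, dec_coeff hQ, coeff_X_pow_mul']
    have h2 := Nat.mod_lt m hQ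
    rw [if_pos (by omega)]
    congr 1
    have := Nat.div_add_mod m Q; omega
  · intro b hb hne
    rw [coeff_X_pow_mul']
    split_ifs with h
    · rw [coeff_expand hQ, if_neg]
      intro hd
      apply hne
      have hb' : b < Q := by simpa using hb
      obtain ⟨c, hc⟩ := hd
      have : m = b + Q * c := by omega
      rw [this, Nat.add_mul_mod_self_left, Nat.mod_eq_of_lt hb']
    · rfl
  · intro h
    exact absurd (Finset.mem_range.mpr (Nat.mod_lt m hQ)) h

lemma TT_decomp {Q : ℕ} (hQ : 0 < Q) (u : R[X][X]) :
    u = ∑ β ∈ Finset.range Q, ∑ α ∈ Finset.range Q,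
      (C (X ^ α) * X ^ β) * exp2 Q (TT Q ((C (X ^ (Q - 1 - α)) * X ^ (Q - 1 - β)) * u)) := by
  have key : ∀ (p : R[X][X]) (α β m : ℕ),
      ((C (X ^ α) * X ^ β) * exp2 Q p).coeff m = X ^ α * (if β ≤ m then
        (if Q ∣ (m - β) then expand R Q (p.coeff ((m - β) / Q)) else 0) else 0) := by
    intro p α β m
    rw [mul_assoc, coeff_C_mul, coeff_X_pow_mul']
    congr 1
    split_ifs with h h2
    · simp only [exp2, RingHom.comp_apply, RingHom.coe_coe]
      rw [coeff_expand hQ, if_pos h2]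
      simp
    · simp only [exp2, RingHom.comp_apply, RingHom.coe_coe]
      rw [coeff_expand hQ, if_neg h2]
    · rfl
  ext1 m
  rw [finsetSum_coeff]
  simp only [finsetSum_coeff, key]
  rw [Finset.sum_eq_single (m % Q)]
  · have h1 : m - m % Q = Q * (m / Q) := by
      have := Nat.div_add_mod m Q; omega
    conv_lhs => rw [dec_decomp hQ (u.coeff m)]
    apply Finset.sum_congr rfl
    intro α _
    rw [if_pos (Nat.mod_le _ _), h1, if_pos (Dvd.intro _ rfl), Nat.mul_div_cancel_left _ hQ]
    congr 2
    rw [TT_coeff hQ, mul_assoc, coeff_C_mul, coeff_X_pow_mul']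
    have h2 := Nat.mod_lt m hQ
    rw [if_pos (by omega)]
    congr 3
    have := Nat.div_add_mod m Q; omega
  · intro b hb hne
    apply Finset.sum_eq_zero
    intro α _
    have hb' : b < Q := by simpa using hb
    split_ifs with h h2
    · exfalso
      apply hne
      obtain ⟨c, hc⟩ := h2
      have : m = b + Q * c := by omega
      rw [this, Nat.add_mul_mod_self_left, Nat.mod_eq_of_lt hb']
    · simp
    · simp
  · intro h
    exact absurd (Finset.mem_range.mpr (Nat.mod_lt m hQ)) h

end

/-- coefficientwise Frobenius -/
noncomputable def frob2 {K : Type*} [Field K] [CharP K 2] (μ : ℕ) : K[X][X] →+* K[X][X] :=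
  mapRingHom (mapRingHom (iterateFrobenius K 2 μ))

lemma pow_eq_exp2_frob {K : Type*} [Field K] [CharP K 2] (μ : ℕ) (p : K[X][X]) :
    p ^ (2 ^ μ) = exp2 (2 ^ μ) (frob2 μ p) := by
  have h1 : ∀ a : K[X], a ^ (2^μ) = expand K (2^μ) (a.map (iterateFrobenius K 2 μ)) := by
    intro a
    rw [← map_expand, map_iterateFrobenius_expand]
  induction p using Polynomial.induction_on' with
  | add p q hp hq => rw [add_pow_char_pow, hp, hq, map_add, map_add]
  | monomial k c =>
    simp only [frob2, coe_mapRingHom, map_monomial]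
    rw [exp2_monomial, ← h1, ← C_mul_X_pow_eq_monomial, mul_pow, ← C_pow, ← pow_mul, mul_comm k]

section
variable {K : Type*} [Field K] [CharP K 2]

lemma frob2_monic (μ : ℕ) {Φ : K[X][X]} (hm : Φ.Monic) : (frob2 μ Φ).Monic := hm.map _

lemma frob2_natDegree (μ : ℕ) {Φ : K[X][X]} (hm : Φ.Monic) :
    (frob2 μ Φ).natDegree = Φ.natDegree := hm.natDegree_map _

lemma frob2_TD (μ : ℕ) {D : ℕ} {Φ : K[X][X]} (h : TD D Φ) : TD D (frob2 μ Φ) := by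
  intro i j hij
  apply h
  intro h0
  apply hij
  simp [frob2, h0, iterateFrobenius_def]

lemma frob2_irreducible [IsAlgClosed K] (μ : ℕ) {Φ : K[X][X]} (h : Irreducible Φ) :
    Irreducible (frob2 μ Φ) := by
  have : Fact (Nat.Prime 2) := ⟨Nat.prime_two⟩
  have e := mapEquiv (mapEquiv (iterateFrobeniusEquiv K 2 μ))
  have h2 : frob2 μ Φ = mapEquiv (mapEquiv (iterateFrobeniusEquiv K 2 μ)) Φ := by
    ext i j
    simp [frob2, mapEquiv, iterateFrobenius_def]
  rw [h2]
  exact (MulEquiv.irreducible_iff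
    (mapEquiv (mapEquiv (iterateFrobeniusEquiv K 2 μ)))).mpr h

noncomputable def kap (Φ : K[X][X]) (μ : ℕ) (h : K[X][X]) : K[X][X] :=
  TT (2 ^ μ) (Φ ^ (2 ^ μ - 1) * h) %ₘ frob2 μ Φ

variable {Φ : K[X][X]} {μ : ℕ}

lemma kap_add (a b : K[X][X]) : kap Φ μ (a + b) = kap Φ μ a + kap Φ μ b := by
  rw [kap, mul_add, TT_add (by positivity), add_modByMonic]; rfl

lemma kap_CC (c : K) (a : K[X][X]) : kap Φ μ (C (C c) * a) = C (C c) * kap Φ μ a := by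
  rw [kap, mul_left_comm, TT_CC (by positivity), ← smul_eq_C_mul (C c), smul_modByMonic,
    smul_eq_C_mul]; rfl

lemma kap_zero : kap Φ μ 0 = 0 := by
  have := kap_CC (Φ := Φ) (μ := μ) 0 0
  simpa using this

lemma kap_sum {ι : Type*} (s : Finset ι) (f : ι → K[X][X]) :
    kap Φ μ (∑ i ∈ s, f i) = ∑ i ∈ s, kap Φ μ (f i) := by
  classical
  induction s using Finset.induction_on with
  | empty => simp [kap_zero]
  | insert a s ha ih => rw [Finset.sum_insert ha, Finset.sum_insert ha, kap_add, ih]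

lemma kap_exp2 (hm : Φ.Monic) (a h : K[X][X]) :
    kap Φ μ (exp2 (2 ^ μ) a * h) = (a * kap Φ μ h) %ₘ frob2 μ Φ := by
  have hm' := frob2_monic μ hm
  rw [kap, mul_left_comm, TT_exp2 (by positivity), kap]
  have := modByMonic_add_div (TT (2 ^ μ) (Φ ^ (2 ^ μ - 1) * h)) (frob2 μ Φ)
  conv_lhs => rw [← this, mul_add, add_modByMonic]
  have h2 : (a * (frob2 μ Φ * (TT (2 ^ μ) (Φ ^ (2 ^ μ - 1) * h) /ₘ (frob2 μ) Φ))) %ₘ frob2 μ Φ = 0 := by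
    rw [modByMonic_eq_zero_iff_dvd hm']
    rw [mul_left_comm]
    exact Dvd.intro _ rfl
  rw [h2, add_zero]

lemma kap_self (hm : Φ.Monic) (h : K[X][X]) : kap Φ μ (Φ * h) = 0 := by
  have hm' := frob2_monic μ hm
  have h1 : Φ ^ (2 ^ μ - 1) * (Φ * h) = exp2 (2 ^ μ) (frob2 μ Φ) * h := by
    rw [← pow_eq_exp2_frob, ← mul_assoc, ← pow_succ]
    congr 2
    have : 0 < 2 ^ μ := by positivity
    omega
  rw [kap, h1, TT_exp2 (by positivity), modByMonic_eq_zero_iff_dvd hm']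
  exact Dvd.intro _ rfl

lemma kap_natDegree (hm : Φ.Monic) (hn : 0 < Φ.natDegree) (h : K[X][X]) :
    (kap Φ μ h).natDegree < Φ.natDegree := by
  rw [← frob2_natDegree μ hm] at hn ⊢
  apply natDegree_modByMonic_lt _ (frob2_monic μ hm)
  intro h1; rw [h1] at hn; simp at hn

lemma kap_TD (hm : Φ.Monic) (hT : TD Φ.natDegree Φ) {E B : ℕ} {h : K[X][X]} (hh : TD E h)
    (hEB : ∀ m, 2 ^ μ * m + 2 * (2 ^ μ - 1) ≤ (2 ^ μ - 1) * Φ.natDegree + E → m ≤ B) :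
    TD B (kap Φ μ h) := by
  apply TD_modByMonic (frob2_monic μ hm) (frob2_natDegree μ hm) (frob2_TD μ hT)
  exact TD_TT (by positivity) hEB (TD_mul (TD_pow hT _) hh)

lemma kap_zero_all (hm : Φ.Monic) (v : K[X][X])
    (hv : ∀ i < 2 ^ μ, ∀ l < Φ.natDegree, kap Φ μ (v * (C (X ^ i) * X ^ l)) = 0)
    (h : K[X][X]) : kap Φ μ (v * h) = 0 := by
  have h1 : ∀ i, ∀ l < Φ.natDegree, kap Φ μ (v * (C (X ^ i) * X ^ l)) = 0 := by
    intro i l hl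
    have : v * (C (X ^ i) * X ^ l) = exp2 (2 ^ μ) (C (X ^ (i / 2 ^ μ))) *
        (v * (C (X ^ (i % 2 ^ μ)) * X ^ l)) := by
      conv_lhs => rw [← Nat.div_add_mod i (2 ^ μ)]
      rw [exp2_C, map_pow (expand K (2 ^ μ)), expand_X, ← pow_mul, pow_add, C_mul]
      ring
    rw [this, kap_exp2 hm, hv _ (Nat.mod_lt _ (by positivity)) l hl]
    simp
  have h2 : ∀ p : K[X][X], p.natDegree < Φ.natDegree → kap Φ μ (v * p) = 0 := by
    intro p hp
    rw [p.as_sum_range_C_mul_X_pow' hp, Finset.mul_sum, kap_sum]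
    apply Finset.sum_eq_zero
    intro l hl
    rw [(p.coeff l).as_sum_range_C_mul_X_pow, map_sum, Finset.sum_mul, Finset.mul_sum, kap_sum]
    apply Finset.sum_eq_zero
    intro i _
    have : v * (C (C ((p.coeff l).coeff i) * X ^ i) * X ^ l) =
        C (C ((p.coeff l).coeff i)) * (v * (C (X ^ i) * X ^ l)) := by
      rw [C_mul]; ring
    rw [this, kap_CC, h1 i l (by simpa using hl), mul_zero]
  by_cases hΦ1 : Φ = 1
  · have := kap_self (μ := μ) hm (v * h)
    rwa [hΦ1, one_mul, ← hΦ1] at this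
  rw [← modByMonic_add_div h Φ, mul_add, kap_add, h2 _ (natDegree_modByMonic_lt _ hm hΦ1), zero_add,
    mul_left_comm, kap_self hm]

lemma kap_dvd (hm : Φ.Monic) (v : K[X][X])
    (hv : ∀ i < 2 ^ μ, ∀ l < Φ.natDegree, kap Φ μ (v * (C (X ^ i) * X ^ l)) = 0) : Φ ∣ v := by
  have h := kap_zero_all hm v hv
  have hQ : 0 < 2 ^ μ := by positivity
  have h1 : Φ ^ (2 ^ μ) ∣ Φ ^ (2 ^ μ - 1) * v := by
    rw [TT_decomp hQ (Φ ^ (2 ^ μ - 1) * v)]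
    apply Finset.dvd_sum
    intro β _
    apply Finset.dvd_sum
    intro α _
    apply Dvd.dvd.mul_left
    rw [pow_eq_exp2_frob]
    apply _root_.map_dvd
    rw [← modByMonic_eq_zero_iff_dvd (frob2_monic μ hm)]
    rw [mul_left_comm, mul_comm _ v]
    exact h _
  have h2 : Φ ^ (2 ^ μ) = Φ ^ (2 ^ μ - 1) * Φ := by
    rw [← pow_succ]; congr 1; omega
  rw [h2] at h1
  exact (mul_dvd_mul_iff_left (pow_ne_zero _ hm.ne_zero)).mp h1

end

lemma divX_telescope {R S : Type*} [CommRing R] [CommRing S] (f : R →+* S) (P : R[X]) (y y' : S)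
    (N : ℕ) : (y - y') * ∑ l ∈ Finset.range N, y ^ l * (divX^[l+1] P).eval₂ f y' =
      (∑ l ∈ Finset.range N, f (P.coeff l) * y ^ l) + y ^ N * (divX^[N] P).eval₂ f y'
        - P.eval₂ f y' := by
  have hc : ∀ N m, (divX^[N] P).coeff m = P.coeff (m + N) := by
    intro N
    induction N with
    | zero => intro m; simp
    | succ N ih =>
      intro m
      rw [Function.iterate_succ_apply', coeff_divX, ih]
      congr 1; omega
  induction N with
  | zero => simp
  | succ N ih =>
    rw [Finset.sum_range_succ, mul_add, ih, Finset.sum_range_succ]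
    have h1 := divX_mul_X_add (divX^[N] P)
    have h2 := congrArg (eval₂ f y') h1
    rw [eval₂_add, eval₂_mul, eval₂_X, eval₂_C, hc, ← Function.iterate_succ_apply' divX,
      zero_add] at h2
    rw [← h2]
    ring

lemma divX_iter_coeff {R : Type*} [CommRing R] (P : R[X]) (N m : ℕ) :
    (divX^[N] P).coeff m = P.coeff (m + N) := by
  induction N generalizing m with
  | zero => simp
  | succ N ih =>
    rw [Function.iterate_succ_apply', coeff_divX, ih]
    congr 1; omega

lemma divX_psi {R S : Type*} [CommRing R] [CommRing S] (f : R →+* S) (P : R[X]) (y y' : S) :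
    (y - y') * ∑ l ∈ Finset.range P.natDegree, y ^ l * (divX^[l+1] P).eval₂ f y' =
      P.eval₂ f y - P.eval₂ f y' := by
  rw [divX_telescope]
  have h : divX^[P.natDegree] P = C (P.coeff P.natDegree) := by
    ext m
    rw [divX_iter_coeff, coeff_C]
    split_ifs with h
    · rw [h, zero_add]
    · exact coeff_eq_zero_of_natDegree_lt (by omega)
  rw [h, eval₂_C, eval₂_eq_sum_range f y, Finset.sum_range_succ]
  ring

section
variable {K : Type*} [Field K] [IsAlgClosed K] [CharP K 2]

lemma X_pow_sub_X_dvd {h : ℕ} (hh : 0 < h) (c : K[X])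
    (hc : ∀ x : K, x ^ (2 ^ h) = x → c.eval x = 0) : (X ^ (2 ^ h) - X : K[X]) ∣ c := by
  by_cases hc0 : c = 0
  · rw [hc0]; exact dvd_zero _
  have h1 : 1 < 2 ^ h := Nat.one_lt_two_pow (by omega)
  have hsep : (X ^ (2 ^ h) - X : K[X]).Separable :=
    galois_poly_separable 2 (2 ^ h) (dvd_pow_self 2 (by omega))
  have hmon : (X ^ (2 ^ h) - X : K[X]).Monic := by
    apply monic_X_pow_sub
    rw [degree_X]
    exact_mod_cast h1
  have hs : (X ^ (2 ^ h) - X : K[X]).Splits := IsAlgClosed.splits _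
  rw [hs.eq_prod_roots_of_monic hmon, Multiset.prod_X_sub_C_dvd_iff_le_roots hc0,
    Multiset.le_iff_subset (nodup_roots hsep)]
  intro x hx
  rw [mem_roots hmon.ne_zero] at hx
  rw [mem_roots hc0]
  apply hc
  simpa [sub_eq_zero] using hx

noncomputable def psiQ (Φ : K[X][X]) (q : ℕ) : K[X][X] :=
  ∑ l ∈ Finset.range Φ.natDegree, X ^ l * exp2 q (divX^[l+1] Φ)

lemma divX_iter_map {R S : Type*} [CommRing R] [CommRing S] (f : R →+* S) (P : R[X]) (l : ℕ) :
    (divX^[l] P).map f = divX^[l] (P.map f) := by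
  ext m
  rw [coeff_map, divX_iter_coeff, divX_iter_coeff, coeff_map]

lemma exp2_map_eval {R : Type*} [CommRing R] (q : ℕ) (x : R) (hx : x ^ q = x) (p : R[X][X]) :
    (exp2 q p).map (evalRingHom x) = (p.map (evalRingHom x)).eval₂ C (X ^ q) := by
  induction p using Polynomial.induction_on' with
  | add p q hp hq => rw [map_add, Polynomial.map_add, hp, hq, Polynomial.map_add, eval₂_add]
  | monomial k c =>
    rw [exp2_monomial, map_monomial, eval₂_monomial, Polynomial.map_mul, map_C, Polynomial.map_pow,
      map_X, pow_mul]
    congr 2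
    simp [expand_eval, hx]

lemma gamma_exists {Φ : K[X][X]} (hm : Φ.Monic) {h : ℕ} (hh : 0 < h)
    (hfr : frob2 h Φ = Φ) (Bad : Finset K)
    (hno : ∀ x y : K, x ^ (2 ^ h) = x → y ^ (2 ^ h) = y → x ∉ Bad → evP x y Φ ≠ 0) :
    ∃ γ δ : K[X][X], C (∏ x ∈ Bad, (X - C x)) * psiQ Φ (2 ^ h) =
      C (X ^ (2 ^ h) - X) * γ + Φ * δ := by
  set m0 : K[X] := ∏ x ∈ Bad, (X - C x) with hm0
  have hdvd : C (X ^ (2 ^ h) - X : K[X]) ∣ (C m0 * psiQ Φ (2 ^ h)) %ₘ Φ := by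
    rw [C_dvd_iff_dvd_coeff]
    intro j
    apply X_pow_sub_X_dvd hh
    intro x hx
    have hz : ((C m0 * psiQ Φ (2 ^ h)) %ₘ Φ).map (evalRingHom x) = 0 := by
      rw [map_modByMonic _ hm, modByMonic_eq_zero_iff_dvd (hm.map _), Polynomial.map_mul, map_C]
      by_cases hb : x ∈ Bad
      · have : evalRingHom x m0 = 0 := by
          rw [hm0, map_prod]
          apply Finset.prod_eq_zero hb
          simp
        rw [this]; simp
      · apply Dvd.dvd.mul_left
        set P : K[X] := Φ.map (evalRingHom x) with hP
        have hnd : P.natDegree = Φ.natDegree := hm.natDegree_map _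
        have hpsi : (X - X ^ (2 ^ h)) * (psiQ Φ (2 ^ h)).map (evalRingHom x) = P - P ^ (2 ^ h) := by
          have h1 := divX_psi C P X (X ^ (2 ^ h))
          rw [hnd, eval₂_C_X] at h1
          have h2 : P.eval₂ C (X ^ (2 ^ h)) = P ^ (2 ^ h) := by
            have h3 : P.map (iterateFrobenius K 2 h) = P := by
              rw [hP, Polynomial.map_map]
              conv_rhs => rw [← hfr]
              rw [frob2, coe_mapRingHom, Polynomial.map_map]
              congr 1
              ext a
              · simp
              · simp [iterateFrobenius_def, hx]
            rw [← map_iterateFrobenius_expand (p := 2) (f := P), map_expand, h3]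
            rfl
          rw [← h2, ← h1, psiQ, Polynomial.map_sum]
          congr 1
          apply Finset.sum_congr rfl
          intro l _
          rw [Polynomial.map_mul, Polynomial.map_pow, map_X, exp2_map_eval _ _ hx, divX_iter_map]
        have hcop : IsCoprime P (X - X ^ (2 ^ h)) := by
          apply isCoprime_of_irreducible_dvd
          · rintro ⟨h1, -⟩
            exact (hm.map (evalRingHom x)).ne_zero h1
          · intro z hz hzP hzX
            obtain ⟨y, hy⟩ := IsAlgClosed.exists_root z (by
              intro h0
              exact hz.not_isUnit (isUnit_iff_degree_eq_zero.mpr h0))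
            have h1 := hy.dvd hzX
            have h2 := hy.dvd hzP
            apply hno x y hx _ hb
            · exact h2
            · simp [sub_eq_zero] at h1
              exact h1.symm
        apply hcop.dvd_of_dvd_mul_left
        rw [hpsi]
        apply dvd_sub dvd_rfl
        exact dvd_pow_self _ (by positivity)
    have := congrArg (fun p => p.coeff j) hz
    simpa using this
  obtain ⟨γ, hγ⟩ := hdvd
  exact ⟨γ, (C m0 * psiQ Φ (2 ^ h)) /ₘ Φ, by rw [← hγ]; exact (modByMonic_add_div _ _).symm⟩

/-- a polynomial of small `Y`-degree vanishing on all points of the curve is zero -/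
lemma vanish_on_curve {Φ G : K[X][X]} (hm : Φ.Monic) (hirr : Irreducible Φ)
    (hn : 0 < Φ.natDegree) (hG : G.natDegree < Φ.natDegree)
    (hv : ∀ x y : K, evP x y Φ = 0 → evP x y G = 0) : G = 0 := by
  by_contra hG0
  have hdet := mulMat_det_ne_zero hm (prime_of_irred_bi hirr) hG0 hG
  apply hdet
  apply Polynomial.funext
  intro x
  obtain ⟨y, hy⟩ := IsAlgClosed.exists_root (Φ.map (evalRingHom x)) (by
    intro h1
    have := hm.natDegree_map (evalRingHom x)
    rw [natDegree_eq_zero_iff_degree_le_zero.mpr h1.le] at this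
    omega)
  have h1 := mulMat_det_eval hm hn (evP x y) hy G (hv x y hy)
  simpa using h1

end

section
variable {K : Type*} [Field K]

lemma evP_exp2 (Q : ℕ) (x y : K) (p : K[X][X]) : evP x y (exp2 Q p) = evP (x ^ Q) (y ^ Q) p := by
  have : (evP x y).comp (exp2 Q) = evP (x ^ Q) (y ^ Q) := by
    ext <;> simp [exp2_C, exp2_X]
  exact congrArg (fun f => f p) this

lemma exp2_exp2 (Q r : ℕ) (p : K[X][X]) : exp2 Q (exp2 r p) = exp2 (Q * r) p := by
  have : (exp2 Q).comp (exp2 r) = (exp2 (Q * r) : K[X][X] →+* K[X][X]) := by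
    ext <;> simp [exp2_C, exp2_X, pow_mul]
  exact congrArg (fun f => f p) this

variable [CharP K 2]

lemma evP_frob2 (ρ : ℕ) (x y : K) (p : K[X][X]) :
    evP (x ^ (2 ^ ρ)) (y ^ (2 ^ ρ)) (frob2 ρ p) = (evP x y p) ^ (2 ^ ρ) := by
  rw [← map_pow, pow_eq_exp2_frob, evP_exp2]

lemma exp2_mod_ideal (ρ : ℕ) (x0 y0 : K) (θ : K[X][X]) :
    exp2 (2 ^ ρ) θ - C (C (evP (x0 ^ (2 ^ ρ)) (y0 ^ (2 ^ ρ)) θ)) ∈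
      Ideal.span {C ((X - C x0) ^ (2 ^ ρ)), (X - C (C y0)) ^ (2 ^ ρ)} := by
  set I : Ideal K[X][X] :=
    Ideal.span {C ((X - C x0) ^ (2 ^ ρ)), (X - C (C y0)) ^ (2 ^ ρ)} with hI
  rw [← Ideal.Quotient.eq]
  have : (Ideal.Quotient.mk I).comp (exp2 (2 ^ ρ)) =
      (Ideal.Quotient.mk I).comp ((C.comp C).comp (evP (x0 ^ (2 ^ ρ)) (y0 ^ (2 ^ ρ)))) := by
    apply Polynomial.ringHom_ext'
    · apply Polynomial.ringHom_ext'
      · ext c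
        simp [exp2_C]
      · simp only [RingHom.comp_apply, exp2_C, expand_X, evP_C, eval_X]
        rw [Ideal.Quotient.eq]
        apply Ideal.subset_span
        left
        rw [sub_pow_char_pow]; simp
    · simp only [RingHom.comp_apply, exp2_X, evP_X]
      rw [Ideal.Quotient.eq]
      apply Ideal.subset_span
      right
      rw [Set.mem_singleton_iff, sub_pow_char_pow]; simp
  exact congrArg (fun f => f θ) this

variable [IsAlgClosed K]

lemma injection_lemma {Φ : K[X][X]} (hm : Φ.Monic) (hirr : Irreducible Φ)
    (hn : 0 < Φ.natDegree) (hT : TD Φ.natDegree Φ) (μ ρ : ℕ) (hfr : frob2 (μ + ρ) Φ = Φ) (B : ℕ)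
    (hB : Φ.natDegree * B < 2 ^ ρ) (c : ℕ → ℕ → K[X][X])
    (hc : ∀ i < 2 ^ μ, ∀ l < Φ.natDegree, TD B (c i l) ∧ (c i l).natDegree < Φ.natDegree)
    (hdvd : frob2 μ Φ ∣ ∑ i ∈ Finset.range (2 ^ μ), ∑ l ∈ Finset.range Φ.natDegree,
      (C (X ^ (2 ^ ρ * (2 ^ μ - 1 - i))) * exp2 (2 ^ ρ) (divX^[l+1] Φ)) * c i l) :
    ∀ i < 2 ^ μ, ∀ l < Φ.natDegree, c i l = 0 := by
  set n := Φ.natDegree with hndef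
  set Φ' := frob2 μ Φ with hΦ'
  have hfr2 : frob2 ρ Φ' = Φ := by
    conv_rhs => rw [← hfr]
    rw [hΦ']
    ext i j
    simp [frob2, iterateFrobenius_def, pow_add, pow_mul]
  have hm' : Φ'.Monic := frob2_monic μ hm
  have hn' : Φ'.natDegree = n := frob2_natDegree μ hm
  have ha : ∀ x y : K, evP x y Φ = 0 →
      ∑ i ∈ Finset.range (2 ^ μ), ∑ l ∈ Finset.range n,
        C (C (x ^ (2 ^ μ - 1 - i) * evP x y (divX^[l+1] Φ))) * c i l = 0 := by
    intro x y hxy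
    obtain ⟨x0, hx0⟩ := IsAlgClosed.exists_pow_nat_eq x (n := 2 ^ ρ) (by positivity)
    obtain ⟨y0, hy0⟩ := IsAlgClosed.exists_pow_nat_eq y (n := 2 ^ ρ) (by positivity)
    have hP : evP x0 y0 Φ' = 0 := by
      have h1 := evP_frob2 ρ x0 y0 Φ'
      rw [hfr2, hx0, hy0, hxy] at h1
      exact pow_eq_zero_iff (by positivity) |>.mp h1.symm
    set a := ∑ i ∈ Finset.range (2 ^ μ), ∑ l ∈ Finset.range n,
        C (C (x ^ (2 ^ μ - 1 - i) * evP x y (divX^[l+1] Φ))) * c i l with hadef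
    set S := ∑ i ∈ Finset.range (2 ^ μ), ∑ l ∈ Finset.range n,
      (C (X ^ (2 ^ ρ * (2 ^ μ - 1 - i))) * exp2 (2 ^ ρ) (divX^[l+1] Φ)) * c i l with hS
    have hmem : S - a ∈ Ideal.span {C ((X - C x0) ^ (2 ^ ρ)), (X - C (C y0)) ^ (2 ^ ρ)} := by
      rw [hS, hadef, ← Finset.sum_sub_distrib]
      apply Ideal.sum_mem
      intro i _
      rw [← Finset.sum_sub_distrib]
      apply Ideal.sum_mem
      intro l _
      rw [← sub_mul]
      apply Ideal.mul_mem_right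
      have := exp2_mod_ideal ρ x0 y0 (C (X ^ (2 ^ μ - 1 - i)) * (divX^[l+1] Φ))
      rw [hx0, hy0, map_mul, map_mul, exp2_C, map_pow (expand K (2 ^ ρ)), expand_X, ← pow_mul,
        evP_C, eval_pow, eval_X] at this
      exact this
    rw [Ideal.mem_span_pair] at hmem
    obtain ⟨α, β, hαβ⟩ := hmem
    obtain ⟨γ, hγ⟩ := hdvd
    apply point_contra hm' (frob2_irreducible μ hirr) (hn'.symm ▸ hn) (hn'.symm ▸ frob2_TD μ hT)
      (B := B) (r := 2 ^ ρ) (by rw [hn']; exact hB) x0 y0 hP a (-α) (-β) γ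
    · apply TD_sum
      intro i hi
      apply TD_sum
      intro l hl
      exact TD_mono (by simp) (TD_mul (TD_CC _) (hc i (by simpa using hi) l (by simpa using hl)).1)
    · rw [hn']
      apply lt_of_le_of_lt (b := n - 1)
      · apply natDegree_sum_le_of_forall_le
        intro i hi
        apply natDegree_sum_le_of_forall_le
        intro l hl
        apply (natDegree_C_mul_le _ _).trans
        have := (hc i (by simpa using hi) l (by simpa using hl)).2
        omega
      · omega
    · have : a = S - (S - a) := by ring
      rw [this, ← hαβ, hγ]
      ring
  -- coefficients
  have hcoef : ∀ s t, ∀ l < n, ∀ i < 2 ^ μ, ((c i l).coeff t).coeff s = 0 := by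
    intro s t
    set G : K[X][X] := ∑ i ∈ Finset.range (2 ^ μ), ∑ l ∈ Finset.range n,
      C (C (((c i l).coeff t).coeff s) * X ^ (2 ^ μ - 1 - i)) * divX^[l+1] Φ with hG
    have hG0 : G = 0 := by
      apply vanish_on_curve hm hirr hn
      · apply lt_of_le_of_lt (b := n - 1)
        · apply natDegree_sum_le_of_forall_le
          intro i hi
          apply natDegree_sum_le_of_forall_le
          intro l hl
          apply (natDegree_C_mul_le _ _).trans
          rw [natDegree_le_iff_coeff_eq_zero]
          intro N hN
          rw [divX_iter_coeff]
          exact coeff_eq_zero_of_natDegree_lt (by omega)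
        · omega
      · intro x y hxy
        have h1 := congrArg (fun p => (p.coeff t).coeff s) (ha x y hxy)
        simp only [finsetSum_coeff, coeff_C_mul, coeff_zero] at h1
        rw [hG, map_sum]
        rw [← h1]
        apply Finset.sum_congr rfl
        intro i _
        rw [map_sum]
        apply Finset.sum_congr rfl
        intro l _
        rw [map_mul, evP_C]
        simp
        ring
    intro l
    induction l using Nat.strong_induction_on with
    | _ l ih =>
    intro hl i hi
    have h1 := congrArg (fun p => (p.coeff (n - 1 - l)).coeff (2 ^ μ - 1 - i)) hG0
    simp only [hG, finsetSum_coeff, coeff_C_mul, coeff_zero, divX_iter_coeff] at h1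
    rw [Finset.sum_eq_single i, Finset.sum_eq_single l] at h1
    · have h2 : n - 1 - l + (l + 1) = n := by omega
      rw [h2, hndef, coeff_natDegree, hm.leadingCoeff, mul_one, coeff_C_mul, coeff_X_pow,
        if_pos rfl, mul_one] at h1
      exact h1
    · intro l' hl' hne
      have hl'' : l' < n := by simpa using hl'
      rcases lt_or_gt_of_ne hne with h | h
      · rw [ih l' h hl'' i hi]
        simp
      · rw [coeff_eq_zero_of_natDegree_lt (p := Φ)]
        · simp
        · omega
    · intro h; exact absurd (Finset.mem_range.mpr hl) h
    · intro i' hi' hne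
      have hi'' : i' < 2 ^ μ := by simpa using hi'
      apply Finset.sum_eq_zero
      intro l' hl'
      have hl'' : l' < n := by simpa using hl'
      rcases lt_trichotomy l' l with h | h | h
      · rw [ih l' h hl'' i' hi'']
        simp
      · subst h
        have h2 : n - 1 - l' + (l' + 1) = n := by omega
        rw [h2, hndef, coeff_natDegree, hm.leadingCoeff, mul_one, coeff_C_mul, coeff_X_pow,
          if_neg (by omega), mul_zero]
      · rw [coeff_eq_zero_of_natDegree_lt (p := Φ)]
        · simp
        · omega
    · intro h; exact absurd (Finset.mem_range.mpr hi) h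
  intro i hi l hl
  ext t s
  rw [hcoef s t l hl i hi]; simp
end

section
variable {K : Type*} [Field K] [CharP K 2]

noncomputable def wPoly (n M : ℕ) (c : Fin n × Fin M → K) : K[X][X] :=
  ∑ x : Fin n × Fin M, C (C (c x)) * (C (X ^ (x.2 : ℕ)) * X ^ (x.1 : ℕ))

lemma wPoly_coeff (n M : ℕ) (c : Fin n × Fin M → K) (x : Fin n × Fin M) :
    ((wPoly n M c).coeff x.1).coeff x.2 = c x := by
  simp only [wPoly, finsetSum_coeff, coeff_C_mul, coeff_X_pow]
  rw [Finset.sum_eq_single x]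
  · simp
  · intro y _ hne
    by_cases h1 : (x.1 : ℕ) = y.1
    · by_cases h2 : (x.2 : ℕ) = y.2
      · exfalso; apply hne; ext
        · exact h1.symm
        · exact h2.symm
      · simp [h1, h2, coeff_X_pow]
    · simp [h1]
  · intro h; exact absurd (Finset.mem_univ x) h

lemma exists_w {Φ : K[X][X]} (hm : Φ.Monic) (hn : 0 < Φ.natDegree) (hT : TD Φ.natDegree Φ)
    (μ M B N0 : ℕ) (m0 : K[X]) (hm0 : m0.natDegree ≤ N0)
    (hB : ∀ m, 2 ^ μ * m + 2 * (2 ^ μ - 1) ≤ (2 ^ μ - 1) * Φ.natDegree +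
      (M + Φ.natDegree + N0 + 2 * Φ.natDegree) → m ≤ B)
    (hM : Φ.natDegree * Φ.natDegree * (B + 1) < M) :
    ∃ w : K[X][X], w ≠ 0 ∧ w.natDegree < Φ.natDegree ∧ TD (M + Φ.natDegree) w ∧
      ∀ i < Φ.natDegree, ∀ l < Φ.natDegree, kap Φ μ ((w * C m0) * (C (X ^ i) * X ^ l)) = 0 := by
  set n := Φ.natDegree with hndef
  let L : (Fin n × Fin M → K) →ₗ[K] (((Fin n × Fin n) × Fin n) × Fin (B + 1) → K) :=
    { toFun := fun c y => ((kap Φ μ ((wPoly n M c * C m0) * (C (X ^ (y.1.1.1 : ℕ)) *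
        X ^ (y.1.1.2 : ℕ)))).coeff y.1.2).coeff y.2
      map_add' := by
        intro c d
        ext y
        have : wPoly n M (c + d) = wPoly n M c + wPoly n M d := by
          simp [wPoly, add_mul, Finset.sum_add_distrib]
        simp only [this, add_mul, kap_add, coeff_add, Pi.add_apply]
      map_smul' := by
        intro a c
        ext y
        have : wPoly n M (a • c) = C (C a) * wPoly n M c := by
          simp [wPoly, mul_assoc, Finset.mul_sum]
        simp only [this, mul_assoc, kap_CC, coeff_C_mul, Pi.smul_apply, smul_eq_mul,
          RingHom.id_apply] }
  have hker : LinearMap.ker L ≠ ⊥ := by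
    apply LinearMap.ker_ne_bot_of_finrank_lt
    simp only [Module.finrank_fintype_fun_eq_card, Fintype.card_prod, Fintype.card_fin]
    nlinarith
  obtain ⟨c, hc, hc0⟩ := Submodule.exists_mem_ne_zero_of_ne_bot hker
  have hdeg : (wPoly n M c).natDegree < n := by
    apply lt_of_le_of_lt (b := n - 1)
    · apply natDegree_sum_le_of_forall_le
      intro x _
      apply (natDegree_C_mul_le _ _).trans
      apply (natDegree_C_mul_X_pow_le _ _).trans
      have := x.1.2
      omega
    · omega
  have hTw : TD (M + n) (wPoly n M c) := by
    apply TD_sum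
    intro x _
    refine TD_mono (D := 0 + (M + n * 1)) (by simp) (TD_mul (TD_CC _) (TD_mul (TD_C ?_)
      (TD_mono ?_ (TD_pow TD_X _))))
    · rw [natDegree_X_pow]; exact x.2.2.le
    · have := x.1.2
      omega
  refine ⟨wPoly n M c, ?_, hdeg, hTw, ?_⟩
  · intro h0
    apply hc0
    ext x
    rw [← wPoly_coeff n M c x, h0]; simp
  · intro i hi l hl
    have hTk : TD B (kap Φ μ ((wPoly n M c * C m0) * (C (X ^ i) * X ^ l))) := by
      apply kap_TD hm hT (E := M + n + N0 + 2 * n) _ hB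
      have h1 : TD (n + n * 1) (C (X ^ i) * X ^ l : K[X][X]) := by
        refine TD_mul (TD_C ?_) (TD_mono (by omega) (TD_pow TD_X _))
        rw [natDegree_X_pow]; omega
      exact TD_mono (by omega) (TD_mul (TD_mul hTw (TD_C hm0)) h1)
    have hdk := kap_natDegree (μ := μ) hm hn ((wPoly n M c * C m0) * (C (X ^ i) * X ^ l))
    ext t s
    by_contra hne
    have h1 := hTk s t (by simpa using hne)
    have ht : t < n := by
      by_contra ht
      apply hne
      have h0 : (kap Φ μ ((wPoly n M c * C m0) * (C (X ^ i) * X ^ l))).coeff t = 0 :=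
        coeff_eq_zero_of_natDegree_lt (by omega)
      rw [h0]
      simp
    apply hne
    have h2 := congrFun (LinearMap.mem_ker.mp hc)
      (((⟨i, hi⟩, ⟨l, hl⟩), ⟨t, ht⟩), ⟨s, by omega⟩)
    simpa [L] using h2

variable [IsAlgClosed K]

lemma weil_core {Φ : K[X][X]} (hm : Φ.Monic) (hirr : Irreducible Φ)
    (hn : 0 < Φ.natDegree) (hT : TD Φ.natDegree Φ) (μ ρ : ℕ) (hh : 0 < μ + ρ)
    (hfr : frob2 (μ + ρ) Φ = Φ) (Bad : Finset K)
    (M B' B : ℕ)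
    (hB' : ∀ m, 2 ^ μ * m + 2 * (2 ^ μ - 1) ≤ (2 ^ μ - 1) * Φ.natDegree +
      (M + Φ.natDegree + Bad.card + 2 * Φ.natDegree) → m ≤ B')
    (hM : Φ.natDegree * Φ.natDegree * (B' + 1) < M)
    (hB : ∀ m, 2 ^ μ * m + 2 * (2 ^ μ - 1) ≤ (2 ^ μ - 1) * Φ.natDegree +
      (M + Φ.natDegree + Bad.card + (2 ^ μ + Φ.natDegree)) → m ≤ B)
    (hr : Φ.natDegree * B < 2 ^ ρ) :
    ∃ x y : K, x ∉ Bad ∧ x ^ (2 ^ (μ + ρ)) = x ∧ y ^ (2 ^ (μ + ρ)) = y ∧ evP x y Φ = 0 := by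
  by_contra hcon
  push Not at hcon
  obtain ⟨γ, δ, hγδ⟩ := gamma_exists hm hh hfr Bad (fun x y hx hy hb => hcon x y hb hx hy)
  set n := Φ.natDegree with hndef
  set m0 : K[X] := ∏ x ∈ Bad, (X - C x) with hm0
  have hm0d : m0.natDegree = Bad.card := by
    rw [hm0, natDegree_finsetProd_X_sub_C_eq_card]
  have hm0ne : m0 ≠ 0 := Finset.prod_ne_zero_iff.mpr fun x _ => X_sub_C_ne_zero x
  obtain ⟨w, hw0, hwd, hwT, hwk⟩ := exists_w hm hn hT μ M B' Bad.card m0 hm0d.le hB' hM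
  set q := 2 ^ (μ + ρ) with hq
  have hqQr : q = 2 ^ μ * 2 ^ ρ := pow_add _ _ _
  set v := w * C m0 with hv
  set c : ℕ → ℕ → K[X][X] := fun i l => kap Φ μ (v * (C (X ^ i) * X ^ l)) with hcdef
  set θ : ℕ → ℕ → K[X][X] := fun i l =>
    C (X ^ (2 ^ ρ * (2 ^ μ - 1 - i))) * exp2 (2 ^ ρ) (divX^[l+1] Φ) with hθ
  set S := ∑ i ∈ Finset.range (2 ^ μ), ∑ l ∈ Finset.range n, θ i l * c i l with hS
  have hm' := frob2_monic μ hm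
  have hcT : ∀ i < 2 ^ μ, ∀ l < n, TD B (c i l) := by
    intro i hi l hl
    apply kap_TD hm hT (E := M + n + Bad.card + (2 ^ μ + n)) _ hB
    have h1 : TD (2 ^ μ + n * 1) (C (X ^ i) * X ^ l : K[X][X]) := by
      refine TD_mul (TD_C ?_) (TD_mono (by omega) (TD_pow TD_X _))
      rw [natDegree_X_pow]; omega
    exact TD_mono (by omega) (TD_mul (TD_mul hwT (TD_C hm0d.le)) h1)
  have hgeom : ((X - X ^ q) ^ (2 ^ μ - 1) : K[X]) =
      ∑ i ∈ Finset.range (2 ^ μ), X ^ i * (X ^ q) ^ (2 ^ μ - 1 - i) := by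
    have hne : (X - X ^ q : K[X]) ≠ 0 := by
      intro h0
      have h1 := congrArg (fun p => p.coeff 1) h0
      have h2 : 1 ≠ q := by
        have : 1 < q := Nat.one_lt_two_pow (by omega)
        omega
      simp [coeff_X_pow, h2] at h1
    apply mul_right_cancel₀ hne
    rw [geom_sum₂_mul, ← pow_succ]
    have : 2 ^ μ - 1 + 1 = 2 ^ μ := by
      have : 0 < 2 ^ μ := by positivity
      omega
    rw [this, sub_pow_char_pow]
  -- first computation
  have hR1 : kap Φ μ (v * psiQ Φ q * C ((X - X ^ q) ^ (2 ^ μ - 1))) = S %ₘ frob2 μ Φ := by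
    have e1 : v * psiQ Φ q * C ((X - X ^ q) ^ (2 ^ μ - 1)) =
        ∑ i ∈ Finset.range (2 ^ μ), ∑ l ∈ Finset.range n,
          exp2 (2 ^ μ) (θ i l) * (v * (C (X ^ i) * X ^ l)) := by
      rw [hgeom, psiQ, map_sum, Finset.mul_sum]
      apply Finset.sum_congr rfl
      intro i _
      rw [Finset.mul_sum, Finset.sum_mul]
      apply Finset.sum_congr rfl
      intro l _
      simp only [hθ]
      rw [map_mul (exp2 (2 ^ μ)), exp2_exp2, ← hqQr, exp2_C, map_pow (expand K (2 ^ μ)), expand_X, ← pow_mul,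
        ← pow_mul, ← mul_assoc (2 ^ μ), ← hqQr, C_mul]
      ring
    rw [e1, kap_sum, hS]
    have : ∀ (s : Finset ℕ) (f : ℕ → K[X][X]), (∑ i ∈ s, f i) %ₘ frob2 μ Φ =
        ∑ i ∈ s, f i %ₘ frob2 μ Φ := by
      intro s f
      exact map_sum (modByMonicHom (frob2 μ Φ)) f s
    rw [this]
    apply Finset.sum_congr rfl
    intro i _
    rw [this, kap_sum]
    apply Finset.sum_congr rfl
    intro l _
    rw [kap_exp2 hm]
  -- second computation
  have hR2 : kap Φ μ (v * psiQ Φ q * C ((X - X ^ q) ^ (2 ^ μ - 1))) =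
      C (X - X ^ q) * kap Φ μ (-γ * w) := by
    have e1 : v * psiQ Φ q * C ((X - X ^ q) ^ (2 ^ μ - 1)) =
        exp2 (2 ^ μ) (C (X - X ^ q)) * (-γ * w) +
          Φ * (w * δ * C ((X - X ^ q) ^ (2 ^ μ - 1))) := by
      have e2 : exp2 (2 ^ μ) (C (X - X ^ q) : K[X][X]) =
          C (X - X ^ q) * C ((X - X ^ q) ^ (2 ^ μ - 1)) := by
        rw [← C_mul, ← pow_succ', exp2_C]
        have : 2 ^ μ - 1 + 1 = 2 ^ μ := by
          have : 0 < 2 ^ μ := by positivity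
          omega
        rw [this, sub_pow_char_pow, map_sub, map_pow, expand_X, ← pow_mul, ← pow_mul, mul_comm q]
      rw [e2, hv, mul_assoc w, hγδ]
      simp only [C_sub]
      ring
    rw [e1, kap_add, kap_self hm, add_zero, kap_exp2 hm]
    rw [modByMonic_eq_self_iff hm', degree_eq_natDegree hm'.ne_zero, frob2_natDegree μ hm]
    apply lt_of_le_of_lt degree_le_natDegree
    have h1 := natDegree_C_mul_le (X - X ^ q : K[X]) (kap Φ μ (-γ * w))
    have h2 := kap_natDegree (μ := μ) hm hn (-γ * w)
    exact_mod_cast lt_of_le_of_lt h1 h2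
  have hSTD : TD (q - 1) (S %ₘ frob2 μ Φ) := by
    apply TD_modByMonic hm' (frob2_natDegree μ hm) (frob2_TD μ hT)
    apply TD_sum
    intro i hi
    have hi' : i < 2 ^ μ := by simpa using hi
    apply TD_sum
    intro l hl
    have hl' : l < n := by simpa using hl
    by_cases hin : i < n
    · have : c i l = 0 := hwk i hin l hl'
      rw [this, mul_zero]; exact TD_zero _
    · have hpsi : TD (2 ^ ρ * (n - 1)) (exp2 (2 ^ ρ) (divX^[l+1] Φ)) := by
        have h0 : TD (n - 1) (divX^[l+1] Φ) := by
          intro s t hst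
          rw [divX_iter_coeff] at hst
          have := hT _ _ hst
          omega
        rw [(divX^[l+1] Φ).as_sum_range, map_sum]
        apply TD_sum
        intro t _
        rw [exp2_monomial]
        rcases TD_coeff h0 t with h1 | h1
        · rw [h1]; simp; exact TD_zero _
        · refine TD_mono ?_ (TD_mul (TD_C (D := ((divX^[l+1] Φ).coeff t).natDegree * 2 ^ ρ) ?_)
            (TD_pow TD_X _))
          · calc _ = 2 ^ ρ * (((divX^[l+1] Φ).coeff t).natDegree + t) := by ring
              _ ≤ _ := Nat.mul_le_mul_left _ h1
          · rw [natDegree_expand]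
      refine TD_mono ?_ (TD_mul (TD_mul (TD_C (D := 2 ^ ρ * (2 ^ μ - 1 - i)) ?_) hpsi)
        (hcT i hi' l hl'))
      · have h1 : 2 ^ ρ * (2 ^ μ - 1 - i) + 2 ^ ρ * (n - 1) + 2 ^ ρ ≤ q := by
          rw [hqQr, ← mul_add, mul_comm (2 ^ μ)]
          calc _ = 2 ^ ρ * (2 ^ μ - 1 - i + (n - 1) + 1) := by ring
            _ ≤ _ := Nat.mul_le_mul_left _ (by omega)
        have h2 : B ≤ n * B := Nat.le_mul_of_pos_left _ hn
        omega
      · rw [natDegree_X_pow]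
  have hS0 : S %ₘ frob2 μ Φ = 0 := by
    have heq : S %ₘ frob2 μ Φ = C (X - X ^ q) * kap Φ μ (-γ * w) := by rw [← hR1, hR2]
    ext1 j
    by_contra hne
    rcases TD_coeff hSTD j with h1 | h1
    · exact hne h1
    · have h2 : (X - X ^ q : K[X]) ∣ (S %ₘ frob2 μ Φ).coeff j := by
        rw [heq, coeff_C_mul]; exact Dvd.intro _ rfl
      have h3 := natDegree_le_of_dvd h2 hne
      have hq1 : 1 < q := Nat.one_lt_two_pow (by omega)
      have h4 : (X - X ^ q : K[X]).natDegree = q := by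
        rw [natDegree_sub, FiniteField.X_pow_card_sub_X_natDegree_eq K hq1]
      omega
  have hc0 := injection_lemma hm hirr hn hT μ ρ hfr B hr c
    (fun i hi l hl => ⟨hcT i hi l hl, kap_natDegree hm hn _⟩)
    ((modByMonic_eq_zero_iff_dvd hm').mp hS0)
  have hdv := kap_dvd hm v hc0
  have hvd : v.natDegree < n := by
    rw [hv, mul_comm]
    exact lt_of_le_of_lt (natDegree_C_mul_le _ _) hwd
  have hv0 : v ≠ 0 := mul_ne_zero hw0 (C_ne_zero.mpr hm0ne)
  have := natDegree_le_of_dvd hdv hv0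
  omega

/-- The elementary point-existence theorem. -/
theorem weil_points {Φ : K[X][X]} (hm : Φ.Monic) (hirr : Irreducible Φ)
    (hn : 0 < Φ.natDegree) (hT : TD Φ.natDegree Φ) (h : ℕ)
    (hfr : frob2 h Φ = Φ) (hq : 16 * (Φ.natDegree + 2) ^ 4 ≤ 2 ^ h) (Bad : Finset K)
    (hBad : Bad.card ≤ 4 * Φ.natDegree) :
    ∃ x y : K, x ∉ Bad ∧ x ^ (2 ^ h) = x ∧ y ^ (2 ^ h) = y ∧ evP x y Φ = 0 := by
  set n := Φ.natDegree with hndef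
  obtain ⟨μ, h1, h2⟩ : ∃ μ, 2 * n ^ 2 ≤ 2 ^ μ ∧ 2 ^ μ < 4 * n ^ 2 := by
    have hpos : 2 * n ^ 2 ≠ 0 := by positivity
    refine ⟨Nat.clog 2 (2 * n ^ 2), Nat.le_pow_clog (by norm_num) _, ?_⟩
    have hgt : 1 < 2 * n ^ 2 := by nlinarith
    have := Nat.pow_pred_clog_lt_self (b := 2) (by norm_num) hgt
    have hc : Nat.clog 2 (2 * n ^ 2) ≠ 0 := (Nat.clog_pos (by norm_num) hgt).ne'
    obtain ⟨k, hk⟩ := Nat.exists_eq_succ_of_ne_zero hc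
    rw [hk] at this ⊢
    simp only [Nat.succ_eq_add_one, Nat.pred_eq_sub_one, Nat.add_sub_cancel] at this
    rw [Nat.succ_eq_add_one, pow_succ]
    omega
  have hle : μ ≤ h := by
    by_contra hc
    push Not at hc
    have : 2 ^ h < 2 ^ μ := Nat.pow_lt_pow_right (by norm_num) hc
    nlinarith [sq_nonneg n, Nat.zero_le (n ^ 3), Nat.zero_le (n ^ 4)]
  obtain ⟨ρ, rfl⟩ := Nat.exists_eq_add_of_le hle
  have hQ : 0 < 2 ^ μ := by positivity
  obtain ⟨Q', hQ'⟩ : ∃ Q', 2 ^ μ = Q' + 1 := ⟨2 ^ μ - 1, by omega⟩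
  have hn1 : 1 ≤ n := hn
  refine weil_core hm hirr hn hT μ ρ ?_ hfr Bad (n * n * (2 * n + 7) + 1) (2 * n + 6) (2 * n + 7)
    ?_ ?_ ?_ ?_
  · by_contra h0
    have : μ + ρ = 0 := by omega
    rw [this] at hq
    nlinarith [Nat.zero_le n, Nat.zero_le (n ^ 2), Nat.zero_le (n ^ 3), Nat.zero_le (n ^ 4)]
  · intro m hmle
    by_contra hmc
    push Not at hmc
    rw [← hndef, hQ', Nat.add_sub_cancel] at hmle
    rw [hQ'] at h1
    have h3 : (Q' + 1) * (2 * n + 7) ≤ (Q' + 1) * m := Nat.mul_le_mul_left _ hmc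
    have h4 : 2 * n ^ 2 * (n + 9) ≤ (Q' + 1) * (n + 9) := Nat.mul_le_mul_right _ h1
    nlinarith
  · rw [← hndef]
    have : 2 * n + 6 + 1 = 2 * n + 7 := by ring
    rw [this]; omega
  · intro m hmle
    by_contra hmc
    push Not at hmc
    rw [← hndef, hQ', Nat.add_sub_cancel] at hmle
    rw [hQ'] at h1
    have h3 : (Q' + 1) * (2 * n + 8) ≤ (Q' + 1) * m := Nat.mul_le_mul_left _ hmc
    have h4 : 2 * n ^ 2 * (n + 9) ≤ (Q' + 1) * (n + 9) := Nat.mul_le_mul_right _ h1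
    nlinarith
  · rw [← hndef]
    by_contra hc
    push Not at hc
    rw [pow_add] at hq
    have h3 : 2 ^ μ * 2 ^ ρ ≤ (4 * n ^ 2) * (n * (2 * n + 7)) := Nat.mul_le_mul h2.le hc
    have h4 : (4 * n ^ 2) * (n * (2 * n + 7)) = 8 * n ^ 4 + 28 * n ^ 3 := by ring
    have h5 : 16 * (n + 2) ^ 4 = 16 * n ^ 4 + 128 * n ^ 3 + (384 * n ^ 2 + 512 * n + 256) := by ring
    nlinarith [Nat.zero_le (n ^ 4), Nat.zero_le (n ^ 3), Nat.zero_le (n ^ 2)]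
end

lemma monic_irred_rel_prime {R : Type*} [CommRing R] [IsDomain R]
    {p q : R[X]} (hp : p.Monic) (hq : q.Monic) (hpi : Irreducible p) (hqi : Irreducible q)
    (hne : p ≠ q) : IsRelPrime p q := by
  intro d hdp hdq
  by_contra hd
  have h1 : Associated d p := (hpi.dvd_iff.mp hdp).resolve_left hd |>.symm
  have h2 : Associated d q := (hqi.dvd_iff.mp hdq).resolve_left hd |>.symm
  exact hne (eq_of_monic_of_associated hp hq (h1.symm.trans h2))

theorem component_lemma {R L : Type*} [CommRing R] [IsDomain R] [UniqueFactorizationMonoid R]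
    [Field L] (φ : R ≃+* R) (Ψ : R[X]) (hm : Ψ.Monic) (hφ : Ψ.map (φ : R →+* R) = Ψ) (r : ℕ)
    (hr : r.Prime) (hrd : Ψ.natDegree < r) (ev : R[X] →+* L) (h0 : ev Ψ = 0)
    (h1 : ev (derivative Ψ) ≠ 0)
    (hev : ∀ p, ev p = 0 → ev ((fun p : R[X] => p.map (φ : R →+* R))^[r] p) = 0) :
    ∃ Z : R[X], Z.Monic ∧ Irreducible Z ∧ Z ∣ Ψ ∧ Z.map (φ : R →+* R) = Z ∧ ev Z = 0 := by
  classical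
  set τ : R[X] → R[X] := fun p => p.map (φ : R →+* R) with hτ
  have hdec : DecompositionMonoid R[X] := inferInstance
  obtain ⟨Z, hZm, hZi, hZd, hZ0⟩ : ∃ Z : R[X], Z.Monic ∧ Irreducible Z ∧ Z ∣ Ψ ∧ ev Z = 0 := by
    have hassoc := UniqueFactorizationMonoid.factors_prod hm.ne_zero
    have h2 : ev (UniqueFactorizationMonoid.factors Ψ).prod = 0 := by
      obtain ⟨u, hu⟩ := hassoc
      have h3 : ev (UniqueFactorizationMonoid.factors Ψ).prod * ev u = 0 := by
        rw [← map_mul, hu, h0]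
      rcases mul_eq_zero.mp h3 with h | h
      · exact h
      · exact absurd h (u.isUnit.map ev).ne_zero
    rw [map_multiset_prod, Multiset.prod_eq_zero_iff, Multiset.mem_map] at h2
    obtain ⟨p, hp, hp0⟩ := h2
    have hpi := UniqueFactorizationMonoid.irreducible_of_factor p hp
    have hpd : p ∣ Ψ := UniqueFactorizationMonoid.dvd_of_mem_factors hp
    obtain ⟨t, ht⟩ := hpd
    have hlu : IsUnit p.leadingCoeff := by
      have := congrArg leadingCoeff ht
      rw [hm.leadingCoeff, leadingCoeff_mul] at this
      exact IsUnit.of_mul_eq_one _ this.symm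
    obtain ⟨u, hu⟩ := hlu
    have hass : Associated (C (↑u⁻¹ : R) * p) p := by
      apply associated_unit_mul_left
      exact isUnit_C.mpr (Units.isUnit _)
    refine ⟨C (↑u⁻¹ : R) * p, ?_, ?_, ?_, ?_⟩
    · rw [Monic, leadingCoeff_mul, leadingCoeff_C, ← hu]; simp
    · exact hass.symm.irreducible hpi
    · exact hass.dvd.trans ⟨t, ht⟩
    · rw [map_mul, hp0, mul_zero]
  have hτm : ∀ p : R[X], p.Monic → (τ p).Monic := fun p hp => hp.map _
  have hτi : ∀ p : R[X], Irreducible p → Irreducible (τ p) := fun p hp =>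
    (MulEquiv.irreducible_iff (mapEquiv φ)).mpr hp
  have hτd : ∀ p : R[X], p ∣ Ψ → τ p ∣ Ψ := by
    intro p hp
    have := Polynomial.map_dvd (φ : R →+* R) hp
    rwa [hφ] at this
  have hit : ∀ i, (τ^[i] Z).Monic ∧ Irreducible (τ^[i] Z) ∧ τ^[i] Z ∣ Ψ := by
    intro i
    induction i with
    | zero => exact ⟨hZm, hZi, hZd⟩
    | succ i ih =>
      rw [Function.iterate_succ_apply']
      exact ⟨hτm _ ih.1, hτi _ ih.2.1, hτd _ ih.2.2⟩
  have hper : τ^[r] Z = Z := by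
    by_contra hne
    have hrel := monic_irred_rel_prime (hit r).1 hZm (hit r).2.1 hZi hne
    obtain ⟨t, ht⟩ := hrel.mul_dvd (hit r).2.2 hZd
    apply h1
    rw [ht, derivative_mul, derivative_mul, map_add, map_mul, map_mul, map_add, map_mul, map_mul,
      map_mul, hev Z hZ0, hZ0]
    ring
  refine ⟨Z, hZm, hZi, hZd, ?_, hZ0⟩
  by_contra hfix
  have : Fact r.Prime := ⟨hr⟩
  have hmp : Function.minimalPeriod τ Z = r := Function.minimalPeriod_eq_prime hper hfix
  have hinj := Function.iterate_injOn_Iio_minimalPeriod (f := τ) (x := Z)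
  rw [hmp] at hinj
  have hprod : ∏ i ∈ Finset.range r, τ^[i] Z ∣ Ψ := by
    apply Finset.prod_dvd_of_isRelPrime
    · intro i hi j hj hij
      apply monic_irred_rel_prime (hit i).1 (hit j).1 (hit i).2.1 (hit j).2.1
      intro heq
      exact hij (hinj (by simpa using hi) (by simpa using hj) heq)
    · intro i _
      exact (hit i).2.2
  have h3 := natDegree_le_of_dvd hprod hm.ne_zero
  rw [natDegree_prod_of_monic _ _ (fun i _ => (hit i).1)] at h3
  have h4 : ∀ i ∈ Finset.range r, 1 ≤ (τ^[i] Z).natDegree := by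
    intro i _
    by_contra hc
    have : (τ^[i] Z).natDegree = 0 := by omega
    have := (hit i).1.natDegree_eq_zero.mp this
    exact (hit i).2.1.not_isUnit (this ▸ isUnit_one)
  have h5 := Finset.sum_le_sum h4
  simp at h5
  omega

section
variable {R : Type*} [CommRing R]

noncomputable def chi : R[X][X] →+* R[X][X][X] :=
  @eval₂RingHom R[X] R[X][X][X] _ _ (@eval₂RingHom R R[X][X][X] _ _
    ((C : R[X][X] →+* R[X][X][X]).comp
    ((C : R[X] →+* R[X][X]).comp (C : R →+* R[X]))) (C (C X) * X)) (C X * X)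

lemma chi_monomial (i j : ℕ) (c : R) :
    chi (monomial j (monomial i c)) = monomial (i + j) (monomial j (monomial i c)) := by
  simp only [chi, coe_eval₂RingHom, eval₂_monomial, RingHom.comp_apply]
  simp only [← C_mul_X_pow_eq_monomial, C_mul, C_pow]
  ring

lemma chi_coeff (p : R[X][X]) (m i j : ℕ) :
    (((chi p).coeff m).coeff j).coeff i = if i + j = m then (p.coeff j).coeff i else 0 := by
  induction p using Polynomial.induction_on' with
  | add p q hp hq => simp only [map_add, coeff_add, hp, hq]; split_ifs <;> simp
  | monomial k c =>
    induction c using Polynomial.induction_on' with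
    | add p q hp hq =>
      simp only [map_add, coeff_add] at hp hq ⊢
      rw [hp, hq]; split_ifs <;> simp
    | monomial l c =>
      rw [chi_monomial]
      simp only [coeff_monomial]
      by_cases h1 : l + k = m
      · by_cases h2 : k = j
        · by_cases h3 : l = i
          · subst h2 h3; simp [h1]
          · subst h2; simp [h1, h3, coeff_monomial]
        · simp [h1, h2, coeff_monomial]
      · by_cases h2 : k = j
        · by_cases h3 : l = i
          · subst h2 h3; simp [h1]
          · subst h2; simp [h1, h3, coeff_monomial]
        · simp [h1, h2]

lemma TD_iff_chi (p : R[X][X]) (D : ℕ) : TD D p ↔ (chi p).natDegree ≤ D := by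
  constructor
  · intro h
    rw [natDegree_le_iff_coeff_eq_zero]
    intro N hN
    ext j i
    rw [chi_coeff]
    split_ifs with h1
    · by_contra h2
      have := h i j (by simpa using h2)
      omega
    · simp
  · intro h i j hij
    by_contra hc
    apply hij
    have h1 := chi_coeff p (i + j) i j
    rw [if_pos rfl] at h1
    rw [← h1, coeff_eq_zero_of_natDegree_lt (p := chi p) (by omega)]
    simp

lemma TD_factor [IsDomain R] {p q : R[X][X]} (hp : p.Monic) (hq : q.Monic)
    (h : TD (p * q).natDegree (p * q)) : TD p.natDegree p := by
  have key : ∀ p : R[X][X], p.Monic → p.natDegree ≤ (chi p).natDegree ∧ chi p ≠ 0 := by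
    intro p hp
    have h1 := chi_coeff p (p.natDegree) 0 p.natDegree
    rw [if_pos (by simp), coeff_natDegree, hp.leadingCoeff, coeff_one_zero] at h1
    have h2 : (chi p).coeff p.natDegree ≠ 0 := by
      intro h0; rw [h0] at h1; simp at h1
    exact ⟨le_natDegree_of_ne_zero h2, fun h0 => h2 (by rw [h0]; simp)⟩
  rw [TD_iff_chi, map_mul, natDegree_mul (key p hp).2 (key q hq).2, hp.natDegree_mul hq] at h
  rw [TD_iff_chi]
  have := (key q hq).1
  omega

lemma mulMat_det_eval_ring {S : Type*} [CommRing S] [IsDomain R] {Φ : R[X][X]} (hm : Φ.Monic)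
    (hn : 0 < Φ.natDegree) (ev : R[X][X] →+* S) (hev : ev Φ = 0) (b : R[X][X]) (hb : ev b = 0) :
    ev (C (mulMat hm b).det) = 0 := by
  set N : Matrix (Fin Φ.natDegree) (Fin Φ.natDegree) S := (mulMat hm b).map (ev.comp C) with hN
  have h1 : ev (C (mulMat hm b).det) = N.det := by
    rw [hN]
    exact RingHom.map_det (ev.comp C) _
  rw [h1]
  set v : Fin Φ.natDegree → S := fun i => ev X ^ (i : ℕ) with hv
  have hvN : Matrix.vecMul v N = 0 := by
    ext j
    simp only [Matrix.vecMul, dotProduct, hN, Matrix.map_apply, mulMat_apply, RingHom.comp_apply,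
      Pi.zero_apply, hv]
    set p := (b * X ^ (j : ℕ)) %ₘ Φ with hp
    have hp0 : ev p = 0 := by
      have := modByMonic_add_div (b * X ^ (j : ℕ)) Φ
      have h2 := congrArg ev this
      rw [map_add, map_mul, hev, zero_mul, add_zero, map_mul, hb, zero_mul] at h2
      exact h2
    have hdeg : p.natDegree < Φ.natDegree := by
      apply natDegree_modByMonic_lt _ hm
      intro h; rw [h] at hn; simp at hn
    have hsum : p = ∑ i : Fin Φ.natDegree, C (p.coeff i) * X ^ (i : ℕ) := by
      conv_lhs => rw [p.as_sum_range_C_mul_X_pow' hdeg]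
      rw [Finset.sum_range]
    rw [← hp0]
    conv_rhs => rw [hsum]
    rw [map_sum]
    apply Finset.sum_congr rfl
    intro i _
    rw [map_mul, map_pow, mul_comm]
  have h2 : Matrix.vecMul (Matrix.vecMul v N) N.adjugate = 0 := by rw [hvN]; simp
  rw [Matrix.vecMul_vecMul, Matrix.mul_adjugate] at h2
  have h3 := congrFun h2 ⟨0, hn⟩
  simpa [Matrix.vecMul_smul, hv] using h3
end

section
variable {K : Type*} [Field K]

/-- the substitution `σ ↦ s u` -/
noncomputable def gS : K[X][X] →+* K[X][X] :=
  eval₂RingHom (eval₂RingHom (C.comp C) (C X * X)) X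

lemma gS_monomial (i j : ℕ) (c : K) :
    gS (monomial j (monomial i c)) = monomial (i + j) (monomial i c) := by
  simp only [gS, coe_eval₂RingHom, eval₂_monomial, RingHom.comp_apply]
  simp only [← C_mul_X_pow_eq_monomial, C_mul, C_pow]
  ring

lemma gS_coeff (p : K[X][X]) (m : ℕ) : ((gS p).coeff m).natDegree ≤ m := by
  induction p using Polynomial.induction_on' with
  | add p q hp hq =>
    rw [map_add, coeff_add]
    exact (natDegree_add_le _ _).trans (max_le hp hq)
  | monomial k c =>
    induction c using Polynomial.induction_on' with
    | add p q hp hq =>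
      rw [map_add, map_add, coeff_add]
      exact (natDegree_add_le _ _).trans (max_le hp hq)
    | monomial l c =>
      rw [gS_monomial, coeff_monomial]
      split_ifs with h
      · exact (natDegree_monomial_le _).trans (by omega)
      · simp

lemma gS_mem (L : ℕ) (c : K[X]) (hc : c.natDegree ≤ L) :
    (monomial L c : K[X][X]) ∈ (gS : K[X][X] →+* K[X][X]).range := by
  rw [c.as_sum_range' (L + 1) (by omega), map_sum]
  apply Subring.sum_mem
  intro i hi
  have hi' : i < L + 1 := by simpa using hi
  refine ⟨monomial (L - i) (monomial i (c.coeff i)), ?_⟩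
  rw [gS_monomial]
  congr 2
  omega

lemma newton_trunc (P : K[X][X][X]) (hcoef : ∀ j, P.coeff j ∈ (gS : K[X][X] →+* K[X][X]).range)
    (t : K[X]) (ζ : K) (ht : P.map constantCoeff = t.map C) (hζ : t.eval ζ = 0)
    (hζ' : (derivative t).eval ζ ≠ 0) (L : ℕ) :
    ∃ z : K[X][X], z ∈ (gS : K[X][X] →+* K[X][X]).range ∧ z.coeff 0 = C ζ ∧
      X ^ (L + 1) ∣ P.eval z := by
  have hev0 : ∀ (p : K[X][X][X]) (z : K[X][X]), (p.eval z).coeff 0 =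
      (p.map constantCoeff).eval (z.coeff 0) := by
    intro p z
    have : (constantCoeff : K[X][X] →+* K[X]) (p.eval z) = (p.map constantCoeff).eval (constantCoeff z) := by
      rw [eval_map, eval₂_hom]
    simpa using this
  induction L with
  | zero =>
    refine ⟨C (C ζ), ⟨C (C ζ), by simp [gS]⟩, by simp, ?_⟩
    rw [zero_add, pow_one, X_dvd_iff, hev0, ht, coeff_C_zero, eval_map_apply, hζ]
    simp
  | succ L ih =>
    obtain ⟨z, hz, hz0, hzd⟩ := ih
    have hmem : P.eval z ∈ (gS : K[X][X] →+* K[X][X]).range := by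
      rw [eval_eq_sum_range]
      apply Subring.sum_mem
      intro j _
      exact Subring.mul_mem _ (hcoef j) (Subring.pow_mem _ hz _)
    set e : K[X] := -((P.eval z).coeff (L + 1) * C ((derivative t).eval ζ)⁻¹) with he
    have hed : e.natDegree ≤ L + 1 := by
      rw [he, natDegree_neg]
      apply natDegree_mul_le.trans
      obtain ⟨w, hw⟩ := hmem
      rw [natDegree_C, ← hw]
      exact gS_coeff w (L + 1)
    refine ⟨z + monomial (L + 1) e, Subring.add_mem _ hz (gS_mem _ _ hed), ?_, ?_⟩
    · simp [hz0, coeff_monomial]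
    · obtain ⟨k, hk⟩ := binomExpansion P z (monomial (L + 1) e)
      rw [hk]
      have h2 : (X ^ (L + 1 + 1) : K[X][X]) ∣ k * (monomial (L + 1) e) ^ 2 := by
        apply Dvd.dvd.mul_left
        rw [← C_mul_X_pow_eq_monomial, mul_pow, ← pow_mul]
        apply Dvd.dvd.mul_left
        exact pow_dvd_pow _ (by omega)
      apply dvd_add _ h2
      rw [X_pow_dvd_iff]
      intro m hm
      rcases Nat.lt_succ_iff_lt_or_eq.mp hm with h | h
      · rw [coeff_add, X_pow_dvd_iff.mp hzd m h, ← C_mul_X_pow_eq_monomial, ← mul_assoc,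
          coeff_mul_X_pow', if_neg (by omega), add_zero]
      · rw [h, coeff_add, ← C_mul_X_pow_eq_monomial, ← mul_assoc, coeff_mul_X_pow', if_pos le_rfl,
          Nat.sub_self, mul_coeff_zero, coeff_C_zero, hev0, ← derivative_map, ht, hz0,
          derivative_map, eval_map_apply, he]
        have : (C (eval ζ (derivative t)) : K[X]) * C ((derivative t).eval ζ)⁻¹ = 1 := by
          rw [← C_mul, mul_inv_cancel₀ hζ', C_1]
        linear_combination (-(P.eval z).coeff (L + 1)) * this
end

lemma exists_minor_field {k : Type*} [Field k] {m n : Type*} [Fintype m] [Fintype n] [DecidableEq n]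
    (M : Matrix m n k) (h : ∀ v : n → k, M.mulVec v = 0 → v = 0) :
    ∃ r : n → m, (M.submatrix r id).det ≠ 0 := by
  classical
  have hrank : M.rank = Fintype.card n := by
    rw [Matrix.rank, LinearMap.finrank_range_of_inj]
    · simp
    · rw [injective_iff_map_eq_zero]
      intro v hv
      exact h v hv
  have hspan : Submodule.span k (Set.range M.row) = ⊤ := by
    apply Submodule.eq_top_of_finrank_eq
    rw [← Matrix.rank_eq_finrank_span_row, hrank]
    simp
  obtain ⟨κ, a, ha, hs, hli⟩ := exists_linearIndependent' k M.row
  have hB : ⊤ ≤ Submodule.span k (Set.range (M.row ∘ a)) := by rw [hs, hspan]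
  let b := Module.Basis.mk hli hB
  have : Finite κ := Finite.of_injective a ha
  have : Fintype κ := Fintype.ofFinite κ
  have hc : Fintype.card κ = Fintype.card n := by
    have h1 := Module.finrank_eq_card_basis b
    simpa using h1.symm
  let e : n ≃ κ := (Fintype.equivOfCardEq hc).symm
  refine ⟨a ∘ e, ?_⟩
  have h2 : LinearIndependent k (M.submatrix (a ∘ e) id).row := by
    have := hli.comp e e.injective
    exact this
  have := Matrix.linearIndependent_rows_iff_isUnit.mp h2
  rw [Matrix.isUnit_iff_isUnit_det] at this
  exact this.ne_zero

lemma exists_minor {R : Type*} [CommRing R] [IsDomain R] {m n : Type*} [Fintype m] [Fintype n]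
    [DecidableEq n] (M : Matrix m n R) (h : ∀ v : n → R, M.mulVec v = 0 → v = 0) :
    ∃ r : n → m, (M.submatrix r id).det ≠ 0 := by
  classical
  let k := FractionRing R
  obtain ⟨r, hr⟩ := exists_minor_field (M.map (algebraMap R k)) (by
    intro v hv
    obtain ⟨b, hb⟩ := IsLocalization.exist_integer_multiples_of_finite (nonZeroDivisors R) v
    choose w hw using hb
    have hw0 : w = 0 := by
      apply h
      ext i
      apply IsFractionRing.injective R k
      have h1 := congrFun hv i
      simp only [Matrix.mulVec, dotProduct, Matrix.map_apply, Pi.zero_apply, map_zero, map_sum,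
        map_mul] at h1 ⊢
      have h2 : ∀ x, algebraMap R k (M i x) * algebraMap R k (w x) =
          algebraMap R k b * (algebraMap R k (M i x) * v x) := by
        intro x
        rw [hw, Algebra.smul_def]
        ring
      rw [Finset.sum_congr rfl (fun x _ => h2 x), ← Finset.mul_sum, h1, mul_zero]
    ext i
    have h3 := hw i
    rw [hw0, Algebra.smul_def] at h3
    simp only [Pi.zero_apply, map_zero] at h3
    have h4 : algebraMap R k b ≠ 0 := by
      rw [Ne, IsFractionRing.to_map_eq_zero_iff]
      exact nonZeroDivisors.coe_ne_zero b
    exact (mul_eq_zero.mp h3.symm).resolve_left h4)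
  refine ⟨r, fun h0 => hr ?_⟩
  have : (M.map (algebraMap R k)).submatrix r id = (algebraMap R k).mapMatrix (M.submatrix r id) := rfl
  rw [this, ← RingHom.map_det, h0, map_zero]

lemma det_natDegree_le {R ι : Type*} [CommRing R] [Fintype ι] [DecidableEq ι] (B : ℕ)
    (M : Matrix ι ι R[X]) (hM : ∀ i j, (M i j).natDegree ≤ B) :
    M.det.natDegree ≤ Fintype.card ι * B := by
  rw [Matrix.det_apply]
  apply natDegree_sum_le_of_forall_le
  intro σ _
  refine (natDegree_smul_le _ _).trans ((natDegree_prod_le _ _).trans ?_)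
  refine (Finset.sum_le_sum (fun i _ => hM _ _)).trans ?_
  simp

section
variable {K : Type*} [Field K]

theorem bertini (P : K[X][X][X]) (hm : P.Monic) (hp : Prime P) (hn : 0 < P.natDegree)
    (hT : TD P.natDegree P)
    (hcoef : ∀ j, P.coeff j ∈ (gS : K[X][X] →+* K[X][X]).range)
    (t : K[X]) (ζ : K) (ht : P.map constantCoeff = t.map C) (hζ : t.eval ζ = 0)
    (hζ' : (derivative t).eval ζ ≠ 0) :
    ∃ Δ : K[X], Δ ≠ 0 ∧ Δ.natDegree ≤ 2 * P.natDegree ^ 4 ∧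
      ∀ s0, Δ.eval s0 ≠ 0 → Irreducible (P.map (mapRingHom (evalRingHom s0))) := by
  classical
  set n := P.natDegree with hnn
  set L := 2 * n ^ 2 with hL
  obtain ⟨z, hz, hz0, hzd⟩ := newton_trunc P hcoef t ζ ht hζ hζ' L
  have hzL : X ^ L ∣ P.eval z := (pow_dvd_pow _ (by omega)).trans hzd
  -- the matrix
  set M : Matrix (Fin L) (Fin n × Fin n) K[X] :=
    fun m ij => (X ^ (ij.1 : ℕ) * z ^ (ij.2 : ℕ)).coeff m with hM
  have hMdeg : ∀ m ij, (M m ij).natDegree ≤ L := by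
    intro m ij
    have : X ^ (ij.1 : ℕ) * z ^ (ij.2 : ℕ) ∈ (gS : K[X][X] →+* K[X][X]).range := by
      apply Subring.mul_mem _ _ (Subring.pow_mem _ hz _)
      apply Subring.pow_mem
      exact ⟨X, by simp [gS]⟩
    obtain ⟨w, hw⟩ := this
    rw [hM]
    simp only
    rw [← hw]
    exact (gS_coeff w m).trans m.2.le
  obtain ⟨r, hr⟩ := exists_minor M (by
    intro v hv
    set g : K[X][X][X] := ∑ ij : Fin n × Fin n, C (C (v ij) * X ^ (ij.1 : ℕ)) * X ^ (ij.2 : ℕ) with hg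
    have hgc : ∀ ij : Fin n × Fin n, ((g.coeff ij.2).coeff ij.1) = v ij := by
      intro ij
      simp only [hg, finsetSum_coeff, coeff_C_mul, coeff_X_pow]
      rw [Finset.sum_eq_single ij]
      · simp
      · intro b _ hb
        by_cases h2 : (ij.2 : ℕ) = b.2
        · have h1 : (ij.1 : ℕ) ≠ b.1 := by
            intro h1; apply hb
            exact Prod.ext (Fin.ext h1.symm) (Fin.ext h2.symm)
          simp [h2, coeff_X_pow, h1]
        · simp [h2]
      · simp
    have hge : X ^ L ∣ g.eval z := by
      rw [X_pow_dvd_iff]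
      intro m hmL
      have h1 := congrFun hv ⟨m, hmL⟩
      simp only [Matrix.mulVec, dotProduct, hM, Pi.zero_apply] at h1
      rw [hg, eval_finsetSum, finsetSum_coeff, ← h1]
      apply Finset.sum_congr rfl
      intro ij _
      rw [eval_mul, eval_C, eval_pow, eval_X, mul_assoc, coeff_C_mul, mul_comm]
    have hg0 : g = 0 := by
      by_contra hg0
      have hgd : g.natDegree < n := by
        have : g.natDegree ≤ n - 1 := by
          apply natDegree_sum_le_of_forall_le
          intro ij _
          refine (natDegree_C_mul_X_pow_le _ _).trans ?_
          have := ij.2.2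
          omega
        omega
      have hTg : TD (2 * n - 2) g := by
        apply TD_sum
        intro ij _
        have h1 := ij.1.2
        have h2 := ij.2.2
        apply TD_mono (D := ij.1 + ij.2 * 1) (by omega)
        apply TD_mul _ (TD_pow TD_X _)
        exact TD_C (natDegree_C_mul_X_pow_le _ _)
      have hd0 := mulMat_det_ne_zero hm hp hg0 hgd
      have hdb := mulMat_det_bound hm hT hTg
      have hev := mulMat_det_eval_ring (S := K[X][X] ⧸ Ideal.span {(X ^ L : K[X][X])}) hm hn
        ((Ideal.Quotient.mk (Ideal.span {(X ^ L : K[X][X])})).comp (evalRingHom z))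
        (by simpa [Ideal.Quotient.eq_zero_iff_mem, Ideal.mem_span_singleton] using hzL) g
        (by simpa [Ideal.Quotient.eq_zero_iff_mem, Ideal.mem_span_singleton] using hge)
      have hdd : X ^ L ∣ (mulMat hm g).det := by
        simpa [Ideal.Quotient.eq_zero_iff_mem, Ideal.mem_span_singleton] using hev
      have h3 := natDegree_le_of_dvd hdd hd0
      rw [natDegree_X_pow] at h3
      have h4 : L ≤ n * (2 * n - 2) := h3.trans hdb
      have h5 : n * (2 * n - 2) < n * (2 * n) := by
        apply Nat.mul_lt_mul_of_pos_left _ hn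
        omega
      have h6 : n * (2 * n) = L := by rw [hL]; ring
      omega
    ext1 ij
    rw [← hgc, hg0]
    simp)
  refine ⟨(M.submatrix r id).det, hr, ?_, ?_⟩
  · refine (det_natDegree_le L _ (fun i j => hMdeg _ _)).trans ?_
    simp only [Fintype.card_prod, Fintype.card_fin, hL]
    apply le_of_eq; ring
  · intro s0 hs0
    set φ : K[X][X] →+* K[X] := mapRingHom (evalRingHom s0) with hφ
    set Z := P.map φ with hZ
    have hZm : Z.Monic := hm.map φ
    have hZd : Z.natDegree = n := hm.natDegree_map φ
    have hφc : ∀ (p : K[X][X]) (m : ℕ), (φ p).coeff m = (p.coeff m).eval s0 := by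
      intro p m; simp [hφ]
    have hZT : TD Z.natDegree Z := by
      rw [hZd]
      intro i j hij
      apply hT i j
      intro h0
      apply hij
      rw [hZ, coeff_map, hφc, h0, eval_zero]
    set z0 := φ z with hz0'
    have hz00 : z0.coeff 0 = ζ := by rw [hz0', hφc, hz0, eval_C]
    have hZz : X ^ L ∣ Z.eval z0 := by
      rw [hZ, hz0', eval_map, eval₂_hom]
      have := _root_.map_dvd φ hzL
      simpa [hφ] using this
    have hZt : Z.map constantCoeff = t := by
      have h1 : (constantCoeff : K[X] →+* K).comp φ = (evalRingHom s0).comp constantCoeff := by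
        ext p <;> simp [hφ]
      rw [hZ, map_map, h1, ← map_map, ht, map_map]
      have : (evalRingHom s0).comp C = RingHom.id K := by ext; simp
      rw [this, map_id]
    have hZ1 : Z ≠ 1 := by
      intro h1; rw [h1] at hZd; simp at hZd; omega
    rw [hZm.irreducible_iff_natDegree']
    refine ⟨hZ1, ?_⟩
    have hev0 : ∀ (p : K[X][X]), (p.eval z0).coeff 0 = (p.map constantCoeff).eval ζ := by
      intro p
      have : (constantCoeff : K[X] →+* K) (p.eval z0) = (p.map constantCoeff).eval (constantCoeff z0) := by
        rw [eval_map, eval₂_hom]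
      rw [constantCoeff_apply, constantCoeff_apply, hz00] at this
      exact this
    have key : ∀ g k : K[X][X], g.Monic → k.Monic → g * k = Z → 0 < k.natDegree →
        (k.map constantCoeff).eval ζ ≠ 0 → False := by
      intro g k hg hk hgk hk0 hkz
      have hTg : TD g.natDegree g := by
        apply TD_factor hg hk; rw [hgk]; exact hZT
      have hgd : g.natDegree < n := by
        have := hg.natDegree_mul hk
        rw [hgk, hZd] at this; omega
      have h1 : X ^ L ∣ g.eval z0 := by
        have h2 : X ^ L ∣ g.eval z0 * k.eval z0 := by rw [← eval_mul, hgk]; exact hZz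
        refine (prime_X).pow_dvd_of_dvd_mul_right L ?_ h2
        rw [X_dvd_iff, hev0]
        exact hkz
      apply hs0
      have h3 : ((M.submatrix r id).det).eval s0 =
          (((evalRingHom s0).mapMatrix (M.submatrix r id))).det := by
        rw [← RingHom.map_det]; rfl
      rw [h3, ← Matrix.exists_mulVec_eq_zero_iff]
      refine ⟨fun ij => (g.coeff ij.2).coeff ij.1, ?_, ?_⟩
      · intro h0
        have := congrFun h0 (⟨0, hn⟩, ⟨g.natDegree, hgd⟩)
        simp [hg.leadingCoeff] at this
      · ext i
        rw [X_pow_dvd_iff] at h1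
        have h4 := h1 (r i) (r i).2
        have h5 : g = ∑ ij : Fin n × Fin n, C (C ((g.coeff ij.2).coeff ij.1) * X ^ (ij.1 : ℕ)) * X ^ (ij.2 : ℕ) := by
          rw [Fintype.sum_prod_type_right]
          conv_lhs => rw [g.as_sum_range_C_mul_X_pow' hgd, Finset.sum_range]
          apply Finset.sum_congr rfl
          intro j _
          simp only
          rw [← Finset.sum_mul, ← map_sum]
          congr 2
          have h6 : (g.coeff j).natDegree < n := by
            by_cases h0 : g.coeff j = 0
            · rw [h0]; simpa using hn
            · have := hTg (g.coeff j).natDegree j (by simpa using h0)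
              omega
          conv_lhs => rw [(g.coeff j).as_sum_range_C_mul_X_pow' h6, Finset.sum_range]
        rw [h5, eval_finsetSum, finsetSum_coeff] at h4
        simp only [Pi.zero_apply]
        rw [← h4]
        simp only [Matrix.mulVec, dotProduct]
        apply Finset.sum_congr rfl
        intro ij _
        rw [eval_mul, eval_C, eval_pow, eval_X, mul_assoc, coeff_C_mul, mul_comm]
        congr 1
        rw [RingHom.mapMatrix_apply, Matrix.map_apply, Matrix.submatrix_apply, id]
        have h7 : M (r i) ij = (X ^ (ij.1 : ℕ) * z ^ (ij.2 : ℕ)).coeff (r i) := rfl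
        rw [h7, coe_evalRingHom, ← hφc, map_mul, map_pow, map_pow, ← hz0']
        simp [hφ]
    intro g k hg hk hgk
    intro hcon
    rw [Finset.mem_Ioc] at hcon
    have hgk0 : g.natDegree + k.natDegree = n := by
      rw [← hg.natDegree_mul hk, hgk, hZd]
    have htt : g.map constantCoeff * k.map constantCoeff = t := by
      rw [← Polynomial.map_mul, hgk, hZt]
    by_cases hkz : (k.map constantCoeff).eval ζ = 0
    · refine key k g hk hg (by rw [mul_comm, hgk]) (by omega) ?_
      intro hgz
      apply hζ'
      rw [← htt, derivative_mul, eval_add, eval_mul, eval_mul, hkz, hgz]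
      ring
    · exact key g k hg hk hgk hcon.1 hkz
end

lemma irreducible_gS {K : Type*} [Field K] {Z : K[X][X][X]} (hm : Z.Monic) (hirr : Irreducible Z) :
    Irreducible (Z.map gS) := by
  let Q := FractionRing K[X][X]
  let ι : K[X][X] →+* Q := eval₂RingHom (eval₂RingHom ((algebraMap K[X][X] Q).comp (C.comp C))
    (algebraMap K[X][X] Q (C X) / algebraMap K[X][X] Q X)) (algebraMap K[X][X] Q X)
  have hX : algebraMap K[X][X] Q X ≠ 0 := by
    rw [Ne, IsFractionRing.to_map_eq_zero_iff]
    exact X_ne_zero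
  have hι : ι.comp gS = algebraMap K[X][X] Q := by
    ext
    · simp [ι, gS]
    · simp [ι, gS]
      exact div_mul_cancel₀ _ hX
    · simp [ι, gS]
  apply (hm.map gS).irreducible_of_irreducible_map ι
  rw [map_map, hι]
  exact (hm.irreducible_iff_irreducible_map_fraction_map (K := Q)).mp hirr

/-- the finite subfield as a finset -/
noncomputable def fixF (K : Type*) [Field K] (h : ℕ) : Finset K :=
  letI := Classical.decEq K
  (X ^ (2 ^ h) - X : K[X]).roots.toFinset

lemma mem_fixF {K : Type*} [Field K] {h : ℕ} (hh : 0 < h) (x : K) :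
    x ∈ fixF K h ↔ x ^ (2 ^ h) = x := by
  have h1 : 1 < 2 ^ h := Nat.one_lt_two_pow (by omega)
  have h0 : (X ^ (2 ^ h) - X : K[X]) ≠ 0 := FiniteField.X_pow_card_sub_X_ne_zero K h1
  simp [fixF, mem_roots h0, sub_eq_zero]

lemma card_fixF {K : Type*} [Field K] [CharP K 2] [IsAlgClosed K] {h : ℕ} (hh : 0 < h) :
    (fixF K h).card = 2 ^ h := by
  classical
  have h1 : 1 < 2 ^ h := Nat.one_lt_two_pow (by omega)
  have hs : (X ^ (2 ^ h) - X : K[X]).Separable :=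
    galois_poly_separable 2 _ (dvd_pow_self 2 (by omega))
  rw [fixF, Multiset.toFinset_card_of_nodup (by convert nodup_roots hs)]
  rw [← (IsAlgClosed.splits (X ^ (2 ^ h) - X : K[X])).natDegree_eq_card_roots]
  exact FiniteField.X_pow_card_sub_X_natDegree_eq K h1

section
variable {S : Type*} [CommRing S]

/-- complete homogeneous polynomial in `1, z, σ` -/
def Hh (z σ : S) : ℕ → S
  | 0 => 1
  | m + 1 => z * Hh z σ m + ∑ l ∈ Finset.range (m + 2), σ ^ l

lemma Hh_identity (z σ : S) (m : ℕ) :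
    (1 - σ ^ (m + 2)) * (z - σ) - (z ^ (m + 2) - σ ^ (m + 2)) * (1 - σ) =
      (1 - z) * (z - σ) * (1 - σ) * Hh z σ m := by
  induction m with
  | zero => simp [Hh]; ring
  | succ m ih =>
    have h1 : (∑ l ∈ Finset.range (m + 2), σ ^ l) * (σ - 1) = σ ^ (m + 2) - 1 := geom_sum_mul σ (m + 2)
    rw [Hh]
    linear_combination z * ih + (1 - z) * (z - σ) * h1

lemma Hh_map {T : Type*} [CommRing T] (φ : S →+* T) (z σ : S) (m : ℕ) :
    φ (Hh z σ m) = Hh (φ z) (φ σ) m := by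
  induction m with
  | zero => simp [Hh]
  | succ m ih => simp [Hh, ih]

lemma Hh_monic [Nontrivial S] (c : S) (m : ℕ) :
    (Hh (X : S[X]) (C c) m).Monic ∧ (Hh (X : S[X]) (C c) m).natDegree = m := by
  induction m with
  | zero => simp [Hh]
  | succ m ih =>
    have h1 : (X * Hh (X : S[X]) (C c) m).Monic := monic_X.mul ih.1
    have h2 : (X * Hh (X : S[X]) (C c) m).natDegree = m + 1 := by
      rw [monic_X.natDegree_mul ih.1, natDegree_X, ih.2, add_comm]
    have h3 : (∑ l ∈ Finset.range (m + 2), (C c : S[X]) ^ l) = C (∑ l ∈ Finset.range (m + 2), c ^ l) := by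
      simp
    rw [Hh, h3]
    constructor
    · apply h1.add_of_left
      apply lt_of_le_of_lt degree_C_le
      rw [degree_eq_natDegree h1.ne_zero, h2]
      exact_mod_cast Nat.succ_pos m
    · rw [natDegree_add_C, h2]

lemma Hh_TD (z σ : S[X][X]) (hz : TD 1 z) (hσ : TD 1 σ) (m : ℕ) : TD m (Hh z σ m) := by
  induction m with
  | zero => exact TD_one
  | succ m ih =>
    rw [Hh]
    apply TD_add
    · rw [add_comm]; exact TD_mul hz ih
    · apply TD_sum
      intro l hl
      have : l < m + 2 := by simpa using hl
      exact TD_mono (by omega) (TD_pow hσ l)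

/-- The surface of collinear triples. -/
noncomputable def Theta (f : S[X]) : S[X][X][X] :=
  ∑ m ∈ Finset.range (f.natDegree - 1),
    C (C (C (f.coeff (m + 2))) * X ^ (f.natDegree - 2 - m)) * Hh (X : S[X][X][X]) (C (C X)) m

lemma Theta_monic [Nontrivial S] {f : S[X]} (hf : f.Monic) (hd : 2 ≤ f.natDegree) :
    (Theta f).Monic ∧ (Theta f).natDegree = f.natDegree - 2 := by
  obtain ⟨n, hn⟩ : ∃ n, f.natDegree = n + 2 := ⟨f.natDegree - 2, by omega⟩
  have h1 : f.natDegree - 1 = n + 1 := by omega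
  have hlast : f.coeff (n + 2) = 1 := by rw [← hn]; exact hf
  rw [Theta, h1, Finset.sum_range_succ, hlast]
  have h2 : f.natDegree - 2 = n := by omega
  rw [h2, Nat.sub_self]
  have h3 := Hh_monic (C X : S[X][X]) n
  simp only [map_one, pow_zero, one_mul, mul_one]
  have hlt : (∑ m ∈ Finset.range n, C (C (C (f.coeff (m + 2))) * X ^ (n - m)) *
      Hh (X : S[X][X][X]) (C (C X)) m).degree < (Hh (X : S[X][X][X]) (C (C X)) n).degree := by
    rw [degree_eq_natDegree h3.1.ne_zero, h3.2]
    apply lt_of_le_of_lt (degree_sum_le _ _)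
    rw [Finset.sup_lt_iff (by exact WithBot.bot_lt_coe n)]
    intro m hm
    have hm' : m < n := by simpa using hm
    refine lt_of_le_of_lt (degree_mul_le _ _) ?_
    refine lt_of_le_of_lt (add_le_add degree_C_le le_rfl) ?_
    rw [zero_add, degree_eq_natDegree (Hh_monic (C X : S[X][X]) m).1.ne_zero, (Hh_monic (C X : S[X][X]) m).2]
    exact_mod_cast hm'
  refine ⟨h3.1.add_of_right hlt, ?_⟩
  rw [natDegree_add_eq_right_of_degree_lt hlt, h3.2]

lemma Theta_map {T : Type*} [CommRing T] (φ : S[X][X] →+* T) (f : S[X]) :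
    (Theta f).map φ = ∑ m ∈ Finset.range (f.natDegree - 1),
      C (φ (C (C (f.coeff (m + 2)))) * (φ X) ^ (f.natDegree - 2 - m)) * Hh X (C (φ (C X))) m := by
  rw [Theta, Polynomial.map_sum]
  apply Finset.sum_congr rfl
  intro m _
  have h1 : (Hh (X : S[X][X][X]) (C (C X)) m).map φ = Hh X (C (φ (C X))) m := by
    have := Hh_map (mapRingHom φ) (X : S[X][X][X]) (C (C X)) m
    simpa using this
  rw [Polynomial.map_mul, map_C, h1]
  simp

/-- evaluation at a triple `(σ, u, z)` -/
noncomputable def ev3 (σ u z : S) : S[X][X][X] →+* S := eval₂RingHom (evP σ u) z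

lemma ev3_C (σ u z : S) (p : S[X][X]) : ev3 σ u z (C p) = evP σ u p := by simp [ev3]

lemma ev3_X (σ u z : S) : ev3 σ u z X = z := by simp [ev3]

lemma Theta_eval (σ u z : S) (f : S[X]) : ev3 σ u z (Theta f) =
    ∑ m ∈ Finset.range (f.natDegree - 1), f.coeff (m + 2) * u ^ (f.natDegree - 2 - m) * Hh z σ m := by
  rw [Theta, map_sum]
  apply Finset.sum_congr rfl
  intro m _
  have h1 : ev3 σ u z (Hh (X : S[X][X][X]) (C (C X)) m) = Hh z σ m := by
    have := Hh_map (ev3 σ u z) (X : S[X][X][X]) (C (C X)) m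
    rw [this]
    simp [ev3]
  rw [map_mul, h1, ev3_C]
  simp

/-- homogenised `f` -/
noncomputable def hom1 (f : S[X]) (u t : S) : S :=
  ∑ i ∈ Finset.range (f.natDegree + 1), f.coeff i * u ^ (f.natDegree - i) * t ^ i

lemma Theta_identity_gen (N : ℕ) (hd : 2 ≤ N) (z σ : S) (w : ℕ → S) :
    (∑ i ∈ Finset.range (N + 1), w i * (1 - σ ^ i)) * (z - σ) -
    (∑ i ∈ Finset.range (N + 1), w i * (z ^ i - σ ^ i)) * (1 - σ) =
    (1 - z) * (z - σ) * (1 - σ) * ∑ m ∈ Finset.range (N - 1), w (m + 2) * Hh z σ m := by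
  obtain ⟨n, hn⟩ : ∃ n, N = n + 2 := ⟨N - 2, by omega⟩
  rw [hn]
  have h1 : n + 2 + 1 = (n + 1) + 1 + 1 := rfl
  have h2 : n + 2 - 1 = n + 1 := rfl
  have hs : ∀ G : ℕ → S, ∑ i ∈ Finset.range (n + 1 + 1 + 1), G i =
      ∑ i ∈ Finset.range (n + 1), G (i + 2) + G 1 + G 0 := by
    intro G
    rw [Finset.sum_range_succ', Finset.sum_range_succ']
  rw [h1, h2, hs, hs, Finset.mul_sum]
  have h3 : ∀ m, (1 - z) * (z - σ) * (1 - σ) * (w (m + 2) * Hh z σ m) =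
      w (m + 2) * (1 - σ ^ (m + 2)) * (z - σ) - w (m + 2) * (z ^ (m + 2) - σ ^ (m + 2)) * (1 - σ) := by
    intro m
    linear_combination (-w (m + 2)) * Hh_identity z σ m
  rw [Finset.sum_congr rfl (fun m _ => h3 m), Finset.sum_sub_distrib, ← Finset.sum_mul, ← Finset.sum_mul]
  simp only [pow_zero, pow_one]
  ring

lemma Theta_identity (f : S[X]) (hd : 2 ≤ f.natDegree) (σ u z : S) :
    (hom1 f u 1 - hom1 f u σ) * (z - σ) - (hom1 f u z - hom1 f u σ) * (1 - σ) =
    (1 - z) * (z - σ) * (1 - σ) * ev3 σ u z (Theta f) := by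
  have := Theta_identity_gen f.natDegree hd z σ (fun i => f.coeff i * u ^ (f.natDegree - i))
  rw [Theta_eval]
  have h2 : ∀ m, f.natDegree - 2 - m = f.natDegree - (m + 2) := by intro m; omega
  simp only [h2]
  rw [← this]
  simp only [hom1, mul_sub, Finset.sum_sub_distrib, one_pow]
end

lemma hom1_eq {K : Type*} [Field K] (f : K[X]) (u t : K) (hu : u ≠ 0) :
    hom1 f u t = u ^ f.natDegree * f.eval (t / u) := by
  rw [hom1, eval_eq_sum_range, Finset.mul_sum]
  apply Finset.sum_congr rfl
  intro i hi
  have hi' : i < f.natDegree + 1 := by simpa using hi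
  have : u ^ f.natDegree = u ^ (f.natDegree - i) * u ^ i := by rw [← pow_add]; congr 1; omega
  rw [this, div_pow]
  field_simp

section
variable {K : Type*} [Field K] [CharP K 2]

lemma ev3_frob (H : ℕ) (σ u z : K) (hσ : σ ^ (2 ^ H) = σ) (hu : u ^ (2 ^ H) = u) (hz : z ^ (2 ^ H) = z)
    (p : K[X][X][X]) :
    ev3 σ u z (p.map (mapRingHom (mapRingHom (iterateFrobenius K 2 H)))) = (ev3 σ u z p) ^ (2 ^ H) := by
  have h : (ev3 σ u z).comp (mapRingHom (mapRingHom (mapRingHom (iterateFrobenius K 2 H)))) =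
      (iterateFrobenius K 2 H).comp (ev3 σ u z) := by
    ext
    · simp [ev3]
    · simp [ev3, iterateFrobenius_def, hσ]
    · simp [ev3, iterateFrobenius_def, hu]
    · simp [ev3, iterateFrobenius_def, hz]
  have := congrArg (fun φ : K[X][X][X] →+* K => φ p) h
  simpa [iterateFrobenius_def] using this

lemma frob_iter (h r : ℕ) (φ : K[X][X] →+* K[X][X])
    (hφ : φ = mapRingHom (mapRingHom (iterateFrobenius K 2 h))) (p : K[X][X][X]) :
    (fun p : K[X][X][X] => p.map φ)^[r] p =
      p.map (mapRingHom (mapRingHom (iterateFrobenius K 2 (h * r)))) := by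
  induction r with
  | zero =>
    have : mapRingHom (mapRingHom (iterateFrobenius K 2 (h * 0))) = RingHom.id K[X][X] := by
      ext <;> simp [iterateFrobenius_def]
    rw [this, map_id]; rfl
  | succ r ih =>
    rw [Function.iterate_succ_apply', ih, hφ, map_map]
    congr 1
    ext
    · simp [iterateFrobenius_def, ← pow_mul, ← pow_add, mul_add]
    · simp
    · simp

/-- Frobenius on coefficients as an equivalence -/
noncomputable def phiE (K : Type*) [Field K] [CharP K 2] [PerfectRing K 2] (h : ℕ) : K[X][X] ≃+* K[X][X] :=
  mapEquiv (mapEquiv (iterateFrobeniusEquiv K 2 h))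

lemma phiE_coe [PerfectRing K 2] (h : ℕ) : (phiE K h : K[X][X] →+* K[X][X]) =
    mapRingHom (mapRingHom (iterateFrobenius K 2 h)) := by
  ext <;> simp [phiE]

lemma eval_TD_natDegree {R : Type*} [CommRing R] {p : R[X][X]} {D : ℕ} (hp : TD D p) (c : R[X])
    (hc : c.natDegree ≤ 1) : (p.eval c).natDegree ≤ D := by
  rw [eval_eq_sum_range]
  apply natDegree_sum_le_of_forall_le
  intro j _
  by_cases h0 : p.coeff j = 0
  · rw [h0]; simp
  have h1 : (p.coeff j).natDegree + j ≤ D := by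
    apply hp
    simpa using h0
  refine natDegree_mul_le.trans ?_
  have h2 : (c ^ j).natDegree ≤ j * 1 := natDegree_pow_le.trans (Nat.mul_le_mul_left _ hc)
  omega

lemma evP_eval {R : Type*} [CommRing R] (x : R) (c : R[X]) (p : R[X][X]) :
    (p.eval c).eval x = evP x (c.eval x) p := by
  rw [evP_apply, eval_map]
  have := (eval₂_hom (evalRingHom x) c (p := p))
  simpa using this.symm

lemma hom1_derivative_zero {K : Type*} [Field K] (f : K[X]) (hf : derivative f = 0) (u z : K) :
    (∑ i ∈ Finset.range (f.natDegree + 1), C (f.coeff i * u ^ (f.natDegree - i)) * X ^ i).derivative.eval z = 0 := by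
  have : (∑ i ∈ Finset.range (f.natDegree + 1), C (f.coeff i * u ^ (f.natDegree - i)) * X ^ i).derivative = 0 := by
    rw [derivative_sum]
    apply Finset.sum_eq_zero
    intro i _
    rw [derivative_C_mul_X_pow]
    have h1 : f.coeff i * (i : K) = 0 := by
      rcases i with _ | i
      · simp
      · have := congrArg (fun p => p.coeff i) hf
        simp only [coeff_derivative, coeff_zero] at this
        push_cast
        exact this
    have : f.coeff i * u ^ (f.natDegree - i) * (i : K) = 0 := by linear_combination u ^ (f.natDegree - i) * h1
    rw [this]; simp
  rw [this, eval_zero]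

lemma char2_sub (a b : K) : a - b = a + b := by
  rw [CharTwo.sub_eq_add]

end

section
variable {K : Type*} [Field K]

lemma ev3_eq (σ u z : K) (p : K[X][X][X]) : ev3 σ u z p = (p.map (evP σ u)).eval z := by
  rw [ev3, eval_map]; rfl

lemma Theta_deriv (f : K[X]) (hd : 2 ≤ f.natDegree) (hf : derivative f = 0) (σ u z : K)
    (h0 : ev3 σ u z (Theta f) = 0) :
    hom1 f u 1 - hom1 f u σ = (1 - z) * (z - σ) * (1 - σ) * ev3 σ u z (derivative (Theta f)) := by
  have key := Theta_identity_gen f.natDegree hd (X : K[X]) (C σ)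
    (fun i => C (f.coeff i * u ^ (f.natDegree - i)))
  have h2 : ∀ m, f.natDegree - 2 - m = f.natDegree - (m + 2) := by intro m; omega
  have hΘ : (Theta f).map (evP σ u) = ∑ m ∈ Finset.range (f.natDegree - 1),
      C (f.coeff (m + 2) * u ^ (f.natDegree - (m + 2))) * Hh X (C σ) m := by
    rw [Theta_map]
    apply Finset.sum_congr rfl
    intro m _
    simp [h2]
  rw [← hΘ] at key
  have h1 := congrArg (fun p => (derivative p).eval z) key
  have e1 : (∑ i ∈ Finset.range (f.natDegree + 1), (C (f.coeff i * u ^ (f.natDegree - i)) : K[X]) * (1 - C σ ^ i)) =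
      C (hom1 f u 1 - hom1 f u σ) := by
    rw [hom1, hom1, ← Finset.sum_sub_distrib, map_sum]
    apply Finset.sum_congr rfl
    intro i _
    simp only [one_pow, C_mul, C_sub, C_pow, mul_sub, C_1]
  have e2 : (∑ i ∈ Finset.range (f.natDegree + 1), (C (f.coeff i * u ^ (f.natDegree - i)) : K[X]) * (X ^ i - C σ ^ i)) =
      (∑ i ∈ Finset.range (f.natDegree + 1), C (f.coeff i * u ^ (f.natDegree - i)) * X ^ i) - C (hom1 f u σ) := by
    rw [hom1, map_sum, ← Finset.sum_sub_distrib]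
    apply Finset.sum_congr rfl
    intro i _
    simp only [C_mul, C_pow, mul_sub]
  rw [e1, e2] at h1
  have h3 := hom1_derivative_zero f hf u z
  have h0' : ((Theta f).map (evP σ u)).eval z = 0 := by rw [← ev3_eq]; exact h0
  simp only [derivative_mul, derivative_sub, derivative_C, derivative_X, derivative_one, eval_mul,
    eval_sub, eval_add, eval_C, eval_X, eval_one, eval_zero, h3, h0'] at h1
  rw [ev3_eq, ← derivative_map]
  linear_combination h1

variable [CharP K 2] [IsAlgClosed K]

lemma exists_fix_nonroot (h : ℕ) (hh : 0 < h) (Δ : K[X]) (h0 : Δ ≠ 0) (hd : Δ.natDegree < 2 ^ h) :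
    ∃ s : K, s ^ (2 ^ h) = s ∧ Δ.eval s ≠ 0 := by
  by_contra hc
  push Not at hc
  apply h0
  apply eq_zero_of_natDegree_lt_card_of_eval_eq_zero' Δ (fixF K h)
  · intro s hs
    exact hc s ((mem_fixF hh s).mp hs)
  · rw [card_fixF hh]; exact hd

/-- Components of the surface give rational points. -/
lemma surface_points (f : K[X]) (hf : f.Monic) (hd : 2 ≤ f.natDegree) (hev : Even f.natDegree)
    (h : ℕ) (hq : 16 * f.natDegree ^ 4 ≤ 2 ^ h) (Z : K[X][X][X]) (hZm : Z.Monic)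
    (hZirr : Irreducible Z) (hZd : Z ∣ Theta f)
    (hZfr : Z.map (mapRingHom (mapRingHom (iterateFrobenius K 2 h))) = Z) :
    ∃ σ u z : K, ∃ s : K, s ^ (2 ^ h) = s ∧ u ^ (2 ^ h) = u ∧ z ^ (2 ^ h) = z ∧ σ = s * u ∧ u ≠ 0 ∧ σ ≠ 1 ∧
      z ≠ 1 ∧ z ≠ σ ∧ ev3 σ u z (Theta f) = 0 := by
  classical
  have hh : 0 < h := by
    rcases Nat.eq_zero_or_pos h with h0 | h0
    · rw [h0] at hq
      have : 2 ^ 4 ≤ f.natDegree ^ 4 := Nat.pow_le_pow_left hd 4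
      omega
    · exact h0
  obtain ⟨W, hW⟩ := hZd
  have hTm := Theta_monic hf hd
  have hWm : W.Monic := hZm.of_mul_monic_left (by rw [← hW]; exact hTm.1)
  have hn0 : 0 < Z.natDegree := by
    rw [hZm.natDegree_pos]
    intro h0
    rw [h0] at hZirr
    exact not_irreducible_one hZirr
  set n := Z.natDegree with hn
  have hnd : n + 2 ≤ f.natDegree := by
    have : (Theta f).natDegree = n + W.natDegree := by rw [hW, hZm.natDegree_mul hWm]
    rw [hTm.2] at this; omega
  -- generic plane section
  set P := Z.map gS with hP
  have hPm : P.Monic := hZm.map gS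
  have hPd : P.natDegree = n := hZm.natDegree_map gS
  have hPp : Prime P := UniqueFactorizationMonoid.irreducible_iff_prime.mp (irreducible_gS hZm hZirr)
  have hPT : TD P.natDegree P := by
    apply TD_factor hPm (hWm.map gS)
    rw [hP, ← Polynomial.map_mul, ← hW, hTm.1.natDegree_map, hTm.2, Theta_map]
    apply TD_sum
    intro m hm
    have hm' : m < f.natDegree - 1 := by simpa using hm
    have e1 : f.natDegree - 2 = (f.natDegree - 2 - m) + m := by omega
    rw [e1]
    apply TD_mul
    · apply TD_C
      simp only [gS, coe_eval₂RingHom, eval₂_C, eval₂_X, RingHom.comp_apply]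
      rw [Nat.add_sub_cancel]
      exact natDegree_C_mul_X_pow_le _ _
    · apply Hh_TD _ _ TD_X
      apply TD_C
      simp only [gS, coe_eval₂RingHom, eval₂_C, eval₂_X]
      exact (natDegree_C_mul_le _ _).trans natDegree_X_le
  have hcoef : ∀ j, P.coeff j ∈ (gS : K[X][X] →+* K[X][X]).range := by
    intro j
    rw [hP, coeff_map]
    exact ⟨_, rfl⟩
  set cc : K[X][X] →+* K := (constantCoeff).comp constantCoeff with hcc
  set t := Z.map cc with ht
  have hPt : P.map constantCoeff = t.map C := by
    rw [hP, ht, map_map, map_map]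
    congr 1
    ext <;> simp [gS, cc]
  have hsum : (Theta f).map cc = ∑ j ∈ Finset.range (f.natDegree - 1), X ^ j := by
    have hH : ∀ m, Hh (X : K[X]) 0 m = ∑ j ∈ Finset.range (m + 1), X ^ j := by
      intro m
      induction m with
      | zero => simp [Hh]
      | succ m ih =>
        have e1 : ∑ l ∈ Finset.range (m + 2), (0 : K[X]) ^ l = 1 := by
          rw [Finset.sum_range_succ']
          simp
        rw [Hh, ih, e1, Finset.sum_range_succ' (fun j => (X : K[X]) ^ j) (m + 1), Finset.mul_sum]
        congr 1
        apply Finset.sum_congr rfl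
        intro i _
        rw [pow_succ']
    obtain ⟨k, hk⟩ : ∃ k, f.natDegree = k + 2 := ⟨f.natDegree - 2, by omega⟩
    have hk1 : f.natDegree - 1 = k + 1 := by omega
    have hlast : f.coeff (k + 2) = 1 := by rw [← hk]; exact hf
    rw [Theta_map, hk1, Finset.sum_range_succ, Finset.sum_eq_zero]
    · have : f.natDegree - 2 - k = 0 := by omega
      rw [this, hlast]
      simp [cc, hH]
    · intro m hm
      have hm' : m < k := by simpa using hm
      have : f.natDegree - 2 - m ≠ 0 := by omega
      simp [cc, this]
  have htd : t ∣ ∑ j ∈ Finset.range (f.natDegree - 1), (X : K[X]) ^ j := by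
    rw [← hsum, hW, Polynomial.map_mul]
    exact Dvd.intro _ rfl
  have hodd : ((f.natDegree - 1 : ℕ) : K) = 1 := by
    obtain ⟨k, hk⟩ := hev
    have : f.natDegree - 1 = 2 * (k - 1) + 1 := by omega
    rw [this]
    push_cast
    rw [CharTwo.two_eq_zero]; ring
  have hsep : t.Separable := by
    have h1 : (X ^ (f.natDegree - 1) - 1 : K[X]).Separable := by
      rw [X_pow_sub_one_separable_iff, hodd]
      exact one_ne_zero
    refine h1.of_dvd (htd.trans ?_)
    rw [← geom_sum_mul]
    exact Dvd.intro _ rfl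
  have ht1 : t.eval 1 ≠ 0 := by
    intro h0
    have := eval_dvd (x := (1 : K)) htd
    rw [h0, zero_dvd_iff] at this
    simp [eval_finsetSum, hodd] at this
  have ht0 : t.eval 0 ≠ 0 := by
    intro h0
    have := eval_dvd (x := (0 : K)) htd
    rw [h0, zero_dvd_iff] at this
    have e1 : f.natDegree - 1 = (f.natDegree - 2) + 1 := by omega
    rw [e1, Finset.sum_range_succ'] at this
    simp [eval_finsetSum] at this
  have htn : t.natDegree = n := hZm.natDegree_map cc
  obtain ⟨ζ, hζ⟩ := IsAlgClosed.exists_root t (by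
    intro h0
    have : t.natDegree = 0 := by rw [natDegree, h0]; rfl
    omega)
  have hζ' : (derivative t).eval ζ ≠ 0 := by
    have := hsep.eval₂_derivative_ne_zero (RingHom.id K) (x := ζ) (by simpa using hζ)
    simpa using this
  obtain ⟨Δ, hΔ0, hΔd, hΔ⟩ := bertini P hPm hPp (by rw [hPd]; exact hn0) hPT hcoef t ζ hPt hζ hζ'
  have hn4 : 16 * (n + 2) ^ 4 ≤ 2 ^ h := by
    refine le_trans ?_ hq
    exact Nat.mul_le_mul_left _ (Nat.pow_le_pow_left hnd 4)
  obtain ⟨s, hs, hsΔ⟩ := exists_fix_nonroot h hh Δ hΔ0 (by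
    have h1 : n ^ 4 ≤ (n + 2) ^ 4 := Nat.pow_le_pow_left (by omega) 4
    rw [hPd] at hΔd
    have h2 : 0 < (n + 2) ^ 4 := by positivity
    omega)
  set φ : K[X][X] →+* K[X] := mapRingHom (evalRingHom s) with hφ
  set Φ := P.map φ with hΦ
  have hΦirr : Irreducible Φ := hΔ s hsΔ
  have hΦm : Φ.Monic := hPm.map φ
  have hΦd : Φ.natDegree = n := by rw [hΦ, hPm.natDegree_map, hPd]
  have hΦT : TD Φ.natDegree Φ := by
    rw [hΦd, ← hPd]
    intro i j hij
    apply hPT i j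
    intro h0
    apply hij
    rw [hΦ, coeff_map, hφ]
    simp [h0]
  have hΦfr : frob2 h Φ = Φ := by
    have h1 : (mapRingHom (iterateFrobenius K 2 h)).comp (φ.comp gS) =
        (φ.comp gS).comp (mapRingHom (mapRingHom (iterateFrobenius K 2 h))) := by
      ext
      · simp [φ, gS]
      · simp [φ, gS, iterateFrobenius_def, hs]
      · simp [φ, gS]
    rw [frob2, hΦ, hP, map_map, coe_mapRingHom, map_map, h1, ← map_map, hZfr]
  -- evaluation
  have hevZ : ∀ u z : K, evP u z Φ = ev3 (s * u) u z Z := by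
    intro u z
    have h1 : ((evalRingHom u).comp φ).comp gS = evP (s * u) u := by
      ext
      · simp [φ, gS]
      · simp [φ, gS]
      · simp [φ, gS]
    rw [evP_apply, hΦ, hP, map_map, map_map, h1, ← ev3_eq]
  have hev00 : ∀ z : K, evP 0 z Φ = t.eval z := by
    intro z
    rw [hevZ, ev3_eq, ht]
    congr 2
    ext <;> simp [cc]
  -- bad values
  set p1 : K[X] := Φ.eval 1 with hp1
  set p2 : K[X] := Φ.eval (C s * X) with hp2
  have hp1d : p1.natDegree ≤ n := by
    rw [← hΦd]; exact eval_TD_natDegree hΦT _ (by simp)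
  have hp2d : p2.natDegree ≤ n := by
    rw [← hΦd]; exact eval_TD_natDegree hΦT _ ((natDegree_C_mul_le _ _).trans natDegree_X_le)
  have hp10 : p1 ≠ 0 := by
    intro h0
    have h1 := evP_eval 0 1 Φ
    rw [← hp1, h0, eval_zero, eval_one, hev00] at h1
    exact ht1 h1.symm
  have hp20 : p2 ≠ 0 := by
    intro h0
    have h1 := evP_eval 0 (C s * X) Φ
    rw [← hp2, h0, eval_zero, hev00] at h1
    apply ht0
    simpa using h1.symm
  obtain ⟨u, z, hu, huq, hzq, huz⟩ := weil_points hΦm hΦirr (by rw [hΦd]; exact hn0) hΦT h hΦfr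
    (by rw [hΦd]; exact hn4) ({0, s⁻¹} ∪ (p1.roots.toFinset ∪ p2.roots.toFinset)) (by
      have c1 := Finset.card_union_le ({0, s⁻¹} : Finset K) (p1.roots.toFinset ∪ p2.roots.toFinset)
      have c2 := Finset.card_union_le (p1.roots.toFinset) (p2.roots.toFinset)
      have c3 : ({0, s⁻¹} : Finset K).card ≤ 2 := Finset.card_le_two
      have c4 := (Multiset.toFinset_card_le p1.roots).trans (p1.card_roots')
      have c5 := (Multiset.toFinset_card_le p2.roots).trans (p2.card_roots')
      rw [hΦd]
      omega)
  simp only [Finset.mem_union, Finset.mem_insert, Finset.mem_singleton, Multiset.mem_toFinset, not_or,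
    mem_roots hp10, mem_roots hp20, IsRoot.def] at hu
  obtain ⟨⟨hu0, hus⟩, hu1, hu2⟩ := hu
  refine ⟨s * u, u, z, s, hs, huq, hzq, rfl, hu0, ?_, ?_, ?_, ?_⟩
  · intro h1
    apply hus
    exact eq_inv_of_mul_eq_one_right h1
  · intro h1
    apply hu1
    rw [hp1, evP_eval, eval_one, ← h1]; exact huz
  · intro h1
    apply hu2
    rw [hp2, evP_eval]
    simp only [eval_mul, eval_C, eval_X]
    rw [← h1]; exact huz
  · rw [hW, map_mul, ← hevZ, huz, zero_mul]
end

section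
variable {K : Type*} [Field K] [CharP K 2]

lemma even_of_derivative_zero {f : K[X]} (hf : derivative f = 0) {i : ℕ} (hi : f.coeff i ≠ 0) : Even i := by
  by_contra h
  rw [Nat.not_even_iff_odd] at h
  obtain ⟨k, hk⟩ := h
  have := congrArg (fun p => p.coeff (2 * k)) hf
  simp only [coeff_derivative, coeff_zero] at this
  rw [← hk] at this
  push_cast at this
  rw [(CharTwo.two_eq_zero : (2 : K) = 0), zero_mul, zero_add, mul_one] at this
  exact hi this

lemma Theta_coll (f : K[X]) (hd : 2 ≤ f.natDegree) (x y s : K) (hx : x ≠ 0) :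
    x⁻¹ ^ (f.natDegree + 1) * ((f.eval x + f.eval s) * (y + s) + (f.eval y + f.eval s) * (x + s)) =
    (1 - y / x) * (y / x - s / x) * (1 - s / x) * ev3 (s / x) x⁻¹ (y / x) (Theta f) := by
  have hu : x⁻¹ ≠ 0 := inv_ne_zero hx
  have h1 := Theta_identity f hd (s / x) x⁻¹ (y / x)
  rw [← h1, hom1_eq _ _ _ hu, hom1_eq _ _ _ hu, hom1_eq _ _ _ hu]
  have e1 : (1 : K) / x⁻¹ = x := by simp
  have e2 : s / x / x⁻¹ = s := by field_simp
  have e3 : y / x / x⁻¹ = y := by field_simp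
  rw [e1, e2, e3]
  simp only [CharTwo.sub_eq_add]
  rw [pow_succ]
  field_simp

variable [IsAlgClosed K]

theorem transfer1 (f : K[X]) (hf : f.Monic) (hd : 2 ≤ f.natDegree) (hder : derivative f = 0)
    (h : ℕ) (hq : 16 * f.natDegree ^ 4 ≤ 2 ^ h) (hfr : ∀ i, (f.coeff i) ^ (2 ^ h) = f.coeff i)
    (r : ℕ) (hr : r.Prime) (hrd : f.natDegree < r)
    (ho : ∀ x y s : K, x ^ (2 ^ h) = x → y ^ (2 ^ h) = y → s ^ (2 ^ h) = s → x ≠ y → x ≠ s → y ≠ s →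
      (f.eval x + f.eval s) * (y + s) + (f.eval y + f.eval s) * (x + s) ≠ 0)
    (x y s : K) (hx : x ^ (2 ^ (h * r)) = x) (hy : y ^ (2 ^ (h * r)) = y) (hs : s ^ (2 ^ (h * r)) = s)
    (hxy : x ≠ y) (hxs : x ≠ s) (hys : y ≠ s)
    (hc : (f.eval x + f.eval s) * (y + s) + (f.eval y + f.eval s) * (x + s) = 0) :
    f.eval x = f.eval s := by
  -- reduction to x nonzero
  have main : ∀ x y s : K, x ^ (2 ^ (h * r)) = x → y ^ (2 ^ (h * r)) = y → s ^ (2 ^ (h * r)) = s →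
      x ≠ y → x ≠ s → y ≠ s →
      (f.eval x + f.eval s) * (y + s) + (f.eval y + f.eval s) * (x + s) = 0 → x ≠ 0 →
      f.eval x = f.eval s := by
    clear hx hy hs hxy hxs hys hc x y s
    intro x y s hx hy hs hxy hxs hys hc hx0
    by_contra hne
    have hu : x⁻¹ ≠ 0 := inv_ne_zero hx0
    have z1 : 1 - y / x ≠ 0 := by
      rw [sub_ne_zero]; intro h1; apply hxy; field_simp at h1; exact h1
    have z2 : y / x - s / x ≠ 0 := by
      rw [sub_ne_zero]; intro h1; apply hys; field_simp at h1; exact h1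
    have z3 : 1 - s / x ≠ 0 := by
      rw [sub_ne_zero]; intro h1; apply hxs; field_simp at h1; exact h1
    have hΘ : ev3 (s / x) x⁻¹ (y / x) (Theta f) = 0 := by
      have h1 := Theta_coll f hd x y s hx0
      rw [hc, mul_zero] at h1
      have := mul_eq_zero.mp h1.symm
      exact this.resolve_left (mul_ne_zero (mul_ne_zero z1 z2) z3)
    have hΘ' : ev3 (s / x) x⁻¹ (y / x) (derivative (Theta f)) ≠ 0 := by
      intro h0
      have h1 := Theta_deriv f hd hder (s / x) x⁻¹ (y / x) hΘ
      rw [h0, mul_zero, hom1_eq _ _ _ hu, hom1_eq _ _ _ hu, ← mul_sub] at h1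
      have e1 : (1 : K) / x⁻¹ = x := by simp
      have e2 : s / x / x⁻¹ = s := by field_simp
      rw [e1, e2] at h1
      exact hne (sub_eq_zero.mp ((mul_eq_zero.mp h1).resolve_left (pow_ne_zero _ hu)))
    have hev : Even f.natDegree := even_of_derivative_zero hder (by
      rw [coeff_natDegree, hf.leadingCoeff]; exact one_ne_zero)
    have hTm := Theta_monic hf hd
    obtain ⟨Z, hZm, hZirr, hZd, hZfr, -⟩ := component_lemma (phiE K h) (Theta f) hTm.1 (by
        rw [phiE_coe, Theta_map, Theta]
        apply Finset.sum_congr rfl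
        intro m _
        simp [iterateFrobenius_def, hfr]) r hr (by rw [hTm.2]; omega) (ev3 (s / x) x⁻¹ (y / x)) hΘ hΘ' (by
        intro p hp
        rw [frob_iter h r _ (phiE_coe h), ev3_frob, hp, zero_pow (by positivity)]
        · rw [div_pow, hs, hx]
        · rw [inv_pow, hx]
        · rw [div_pow, hy, hx])
    rw [phiE_coe] at hZfr
    obtain ⟨σ, u, z, s1, hs1, huq, hzq, hσ, hu0, hσ1, hz1, hzσ, h0⟩ :=
      surface_points f hf hd hev h hq Z hZm hZirr hZd hZfr
    have hx' : (u⁻¹ : K) ≠ 0 := inv_ne_zero hu0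
    have h2 := Theta_coll f hd u⁻¹ (z / u) s1 hx'
    have e1 : s1 / u⁻¹ = σ := by rw [hσ]; field_simp
    have e2 : z / u / u⁻¹ = z := by field_simp
    rw [e1, e2, inv_inv, h0, mul_zero] at h2
    have h3 := (mul_eq_zero.mp h2).resolve_left (pow_ne_zero _ hu0)
    refine ho u⁻¹ (z / u) s1 (by rw [inv_pow, huq]) (by rw [div_pow, hzq, huq]) hs1 ?_ ?_ ?_ h3
    · intro h4; apply hz1; field_simp at h4; exact h4.symm
    · intro h4; apply hσ1; rw [hσ, ← h4]; field_simp
    · intro h4; apply hzσ; rw [hσ, ← h4]; field_simp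
  by_cases hx0 : x = 0
  · have hy0 : y ≠ 0 := fun h0 => hxy (by rw [hx0, h0])
    have h1 := main y x s hy hx hs hxy.symm hys hxs (by linear_combination hc) hy0
    rw [h1, CharTwo.add_self_eq_zero, zero_mul, add_zero] at hc
    have h2 : y + s ≠ 0 := by
      rw [← CharTwo.sub_eq_add, sub_ne_zero]; exact hys
    have h3 := (mul_eq_zero.mp hc).resolve_right h2
    rw [← CharTwo.sub_eq_add, sub_eq_zero] at h3
    exact h3
  · exact main x y s hx hy hs hxy hxs hys hc hx0
end

section
variable {S : Type*} [CommRing S]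

def G2 (x y : S) : ℕ → S
  | 0 => 1
  | m + 1 => y * G2 x y m + x ^ (m + 1)

lemma G2_identity (x y : S) (m : ℕ) : (y - x) * G2 x y m = y ^ (m + 1) - x ^ (m + 1) := by
  induction m with
  | zero => simp [G2]
  | succ m ih => rw [G2]; linear_combination y * ih

lemma G2_self (x : S) (m : ℕ) : G2 x x m = (m + 1) * x ^ m := by
  induction m with
  | zero => simp [G2]
  | succ m ih => rw [G2, ih]; push_cast; ring

lemma G2_map {T : Type*} [CommRing T] (φ : S →+* T) (x y : S) (m : ℕ) :
    φ (G2 x y m) = G2 (φ x) (φ y) m := by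
  induction m with
  | zero => simp [G2]
  | succ m ih => simp [G2, ih]

lemma G2_monic [Nontrivial S] (c : S) (m : ℕ) :
    (G2 (C c) (X : S[X]) m).Monic ∧ (G2 (C c) (X : S[X]) m).natDegree = m := by
  induction m with
  | zero => simp [G2]
  | succ m ih =>
    have h1 : (X * G2 (C c) (X : S[X]) m).Monic := monic_X.mul ih.1
    have h2 : (X * G2 (C c) (X : S[X]) m).natDegree = m + 1 := by
      rw [monic_X.natDegree_mul ih.1, natDegree_X, ih.2, add_comm]
    rw [G2, ← C_pow]
    constructor
    · apply h1.add_of_left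
      apply lt_of_le_of_lt degree_C_le
      rw [degree_eq_natDegree h1.ne_zero, h2]
      exact_mod_cast Nat.succ_pos m
    · rw [natDegree_add_C, h2]

lemma G2_TD (x y : S[X][X]) (hx : TD 1 x) (hy : TD 1 y) (m : ℕ) : TD m (G2 x y m) := by
  induction m with
  | zero => exact TD_one
  | succ m ih =>
    rw [G2]
    apply TD_add
    · rw [add_comm]; exact TD_mul hy ih
    · exact TD_mono (by omega) (TD_pow hx (m + 1))

/-- the difference curve -/
noncomputable def DC (g : S[X]) : S[X][X] :=
  ∑ m ∈ Finset.range g.natDegree, C (C (g.coeff (m + 1))) * G2 (C X) (X : S[X][X]) m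

lemma DC_monic [Nontrivial S] {g : S[X]} (hg : g.Monic) (hd : 1 ≤ g.natDegree) :
    (DC g).Monic ∧ (DC g).natDegree = g.natDegree - 1 := by
  obtain ⟨n, hn⟩ : ∃ n, g.natDegree = n + 1 := ⟨g.natDegree - 1, by omega⟩
  have hlast : g.coeff (n + 1) = 1 := by rw [← hn]; exact hg
  rw [DC, hn, Finset.sum_range_succ, hlast, Nat.add_sub_cancel]
  have h3 := G2_monic (X : S[X]) n
  simp only [map_one, one_mul]
  have hlt : (∑ m ∈ Finset.range n, C (C (g.coeff (m + 1))) * G2 (C X) (X : S[X][X]) m).degree <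
      (G2 (C X) (X : S[X][X]) n).degree := by
    rw [degree_eq_natDegree h3.1.ne_zero, h3.2]
    apply lt_of_le_of_lt (degree_sum_le _ _)
    rw [Finset.sup_lt_iff (by exact WithBot.bot_lt_coe n)]
    intro m hm
    have hm' : m < n := by simpa using hm
    refine lt_of_le_of_lt (degree_mul_le _ _) ?_
    refine lt_of_le_of_lt (add_le_add degree_C_le le_rfl) ?_
    rw [zero_add, degree_eq_natDegree (G2_monic (X : S[X]) m).1.ne_zero, (G2_monic (X : S[X]) m).2]
    exact_mod_cast hm'
  refine ⟨h3.1.add_of_right hlt, ?_⟩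
  rw [natDegree_add_eq_right_of_degree_lt hlt, h3.2]

lemma DC_hom {T : Type*} [CommRing T] (φ : S[X][X] →+* T) (g : S[X]) :
    φ (DC g) = ∑ m ∈ Finset.range g.natDegree, φ (C (C (g.coeff (m + 1)))) * G2 (φ (C X)) (φ X) m := by
  rw [DC, map_sum]
  apply Finset.sum_congr rfl
  intro m _
  have h1 := G2_map φ (C X) X m
  rw [map_mul, h1]

lemma DC_identity_gen (N : ℕ) (x y : S) (w : ℕ → S) :
    (y - x) * ∑ m ∈ Finset.range N, w (m + 1) * G2 x y m =
    ∑ i ∈ Finset.range (N + 1), w i * y ^ i - ∑ i ∈ Finset.range (N + 1), w i * x ^ i := by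
  rw [Finset.sum_range_succ' _ N, Finset.sum_range_succ' _ N, Finset.mul_sum]
  have h3 : ∀ m, (y - x) * (w (m + 1) * G2 x y m) = w (m + 1) * y ^ (m + 1) - w (m + 1) * x ^ (m + 1) := by
    intro m
    linear_combination (w (m + 1)) * G2_identity x y m
  rw [Finset.sum_congr rfl (fun m _ => h3 m), Finset.sum_sub_distrib]
  ring

lemma DC_TD (g : S[X]) : TD (g.natDegree - 1) (DC g) := by
  apply TD_sum
  intro m hm
  have hm' : m < g.natDegree := by simpa using hm
  apply TD_mono (D := 0 + m) (by omega)
  exact TD_mul (TD_CC _) (G2_TD _ _ TD_CX TD_X m)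

lemma DC_eval (g : S[X]) (x y : S) : (y - x) * evP x y (DC g) = g.eval y - g.eval x := by
  have := DC_identity_gen g.natDegree x y (fun i => g.coeff i)
  rw [DC_hom, eval_eq_sum_range, eval_eq_sum_range, ← this]
  simp

lemma DC_diag (g : S[X]) : (DC g).eval X = derivative g := by
  have h1 := DC_hom (evalRingHom X) g
  rw [coe_evalRingHom] at h1
  rw [h1]
  conv_rhs => rw [g.as_sum_range_C_mul_X_pow]
  rw [derivative_sum, Finset.sum_range_succ']
  simp [G2_self, mul_assoc]

end

section
variable {K : Type*} [Field K]

lemma DC_deriv (g : K[X]) (x y : K) (h0 : evP x y (DC g) = 0) :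
    (y - x) * evP x y (derivative (DC g)) = (derivative g).eval y := by
  have key := DC_identity_gen g.natDegree (C x) (X : K[X]) (fun i => C (g.coeff i))
  have hΘ : (DC g).map (evalRingHom x) = ∑ m ∈ Finset.range g.natDegree,
      C (g.coeff (m + 1)) * G2 (C x) (X : K[X]) m := by
    rw [← coe_mapRingHom, DC_hom]
    simp
  rw [← hΘ] at key
  have h1 := congrArg (fun p => (derivative p).eval y) key
  rw [evP_apply] at h0
  rw [evP_apply, ← derivative_map]
  have e1 : ∑ i ∈ Finset.range (g.natDegree + 1), C (g.coeff i) * X ^ i = g :=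
    g.as_sum_range_C_mul_X_pow.symm
  have e2 : ∑ i ∈ Finset.range (g.natDegree + 1), C (g.coeff i) * C x ^ i = C (g.eval x) := by
    rw [eval_eq_sum_range]; simp
  rw [e1, e2] at h1
  simp only [derivative_mul, derivative_sub, derivative_X, derivative_C, eval_add, eval_mul, eval_sub,
    eval_X, eval_C, eval_one, eval_zero, h0] at h1
  linear_combination h1

variable [CharP K 2]

lemma evP_frob (H : ℕ) (x y : K) (hx : x ^ (2 ^ H) = x) (hy : y ^ (2 ^ H) = y)
    (p : K[X][X]) :
    evP x y (p.map (mapRingHom (iterateFrobenius K 2 H))) = (evP x y p) ^ (2 ^ H) := by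
  have h : (evP x y).comp (mapRingHom (mapRingHom (iterateFrobenius K 2 H))) =
      (iterateFrobenius K 2 H).comp (evP x y) := by
    ext
    · simp
    · simp [iterateFrobenius_def, hx]
    · simp [iterateFrobenius_def, hy]
  have := congrArg (fun φ : K[X][X] →+* K => φ p) h
  simpa [iterateFrobenius_def] using this

lemma frob_iter2 (h r : ℕ) (φ : K[X] →+* K[X])
    (hφ : φ = mapRingHom (iterateFrobenius K 2 h)) (p : K[X][X]) :
    (fun p : K[X][X] => p.map φ)^[r] p =
      p.map (mapRingHom (iterateFrobenius K 2 (h * r))) := by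
  induction r with
  | zero =>
    have : mapRingHom (iterateFrobenius K 2 (h * 0)) = RingHom.id K[X] := by
      ext <;> simp
    rw [this, map_id]; rfl
  | succ r ih =>
    rw [Function.iterate_succ_apply', ih, hφ, map_map]
    congr 1
    ext
    · simp [iterateFrobenius_def, ← pow_mul, ← pow_add, mul_add]
    · simp

theorem transfer2 [IsAlgClosed K] (g : K[X]) (hg : g.Monic) (hd : 1 ≤ g.natDegree) (hder : derivative g ≠ 0)
    (h : ℕ) (hq : 16 * (g.natDegree + 1) ^ 4 ≤ 2 ^ h) (hfr : ∀ i, (g.coeff i) ^ (2 ^ h) = g.coeff i)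
    (r : ℕ) (hr : r.Prime) (hrd : g.natDegree < r)
    (ho : ∀ x y : K, x ^ (2 ^ h) = x → y ^ (2 ^ h) = y → g.eval x = g.eval y → x = y)
    (x y : K) (hx : x ^ (2 ^ (h * r)) = x) (hy : y ^ (2 ^ (h * r)) = y)
    (hxy : x ≠ y) (hc : g.eval x = g.eval y) :
    (derivative g).eval y = 0 := by
  classical
  by_contra hne
  have hyx : y - x ≠ 0 := sub_ne_zero.mpr hxy.symm
  have hΘ : evP x y (DC g) = 0 := by
    have h1 := DC_eval g x y
    rw [hc, sub_self] at h1
    exact (mul_eq_zero.mp h1).resolve_left hyx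
  have hΘ' : evP x y (derivative (DC g)) ≠ 0 := by
    intro h0
    have h1 := DC_deriv g x y hΘ
    rw [h0, mul_zero] at h1
    exact hne h1.symm
  have hTm := DC_monic hg hd
  have hcoe : ((mapEquiv (iterateFrobeniusEquiv K 2 h) : K[X] ≃+* K[X]) : K[X] →+* K[X]) =
      mapRingHom (iterateFrobenius K 2 h) := by
    ext <;> simp
  obtain ⟨Z, hZm, hZirr, hZd, hZfr, hZ0⟩ := component_lemma (mapEquiv (iterateFrobeniusEquiv K 2 h)) (DC g) hTm.1 (by
      rw [hcoe, ← coe_mapRingHom, DC_hom, DC]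
      apply Finset.sum_congr rfl
      intro m _
      simp [iterateFrobenius_def, hfr]) r hr (by rw [hTm.2]; omega) (evP x y) hΘ hΘ' (by
      intro p hp
      rw [frob_iter2 h r _ hcoe, evP_frob (h * r) x y hx hy, hp, zero_pow (by positivity)])
  rw [hcoe] at hZfr
  obtain ⟨W, hW⟩ := hZd
  have hWm : W.Monic := hZm.of_mul_monic_left (by rw [← hW]; exact hTm.1)
  have hn0 : 0 < Z.natDegree := by
    rw [hZm.natDegree_pos]
    intro h0
    rw [h0] at hZirr
    exact not_irreducible_one hZirr
  have hnd : Z.natDegree + 1 ≤ g.natDegree := by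
    have : (DC g).natDegree = Z.natDegree + W.natDegree := by rw [hW, hZm.natDegree_mul hWm]
    rw [hTm.2] at this; omega
  have hZT : TD Z.natDegree Z := by
    apply TD_factor hZm hWm
    rw [← hW, hTm.2]
    exact DC_TD g
  have hdiag : Z.eval X ≠ 0 := by
    intro h0
    apply hder
    rw [← DC_diag, hW, eval_mul, h0, zero_mul]
  have hdd := eval_TD_natDegree hZT X natDegree_X_le
  obtain ⟨x1, y1, hx1, hxq, hyq, h0⟩ := weil_points hZm hZirr hn0 hZT h hZfr
    (le_trans (Nat.mul_le_mul_left _ (Nat.pow_le_pow_left (by omega) 4)) hq) ((Z.eval X).roots.toFinset) (by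
      have c4 := (Multiset.toFinset_card_le (Z.eval X).roots).trans ((Z.eval X).card_roots')
      omega)
  simp only [Multiset.mem_toFinset, mem_roots hdiag, IsRoot.def] at hx1
  have hne1 : x1 ≠ y1 := by
    intro h1
    apply hx1
    rw [evP_eval, eval_X]
    rw [← h1] at h0; exact h0
  apply hne1
  apply ho x1 y1 hxq hyq
  have h2 := DC_eval g x1 y1
  rw [hW, map_mul, h0, zero_mul, mul_zero] at h2
  exact (sub_eq_zero.mp h2.symm).symm
end

def bv (b : Finset ℕ) : ℕ := ∑ i ∈ b, 2 ^ i

lemma bv_inj {b c : Finset ℕ} (h : bv b = bv c) : b = c :=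
  Finset.equivBitIndices.symm.injective h

lemma bv_range (H : ℕ) : bv (Finset.range H) + 1 = 2 ^ H := by
  induction H with
  | zero => simp [bv]
  | succ n ih =>
    rw [bv, Finset.sum_range_succ, pow_succ, ← ih]
    rw [bv] at *; omega

lemma bv_sdiff {b c : Finset ℕ} (h : b ⊆ c) : bv (c \ b) + bv b = bv c :=
  Finset.sum_sdiff h

lemma bv_mono {b c : Finset ℕ} (h : b ⊆ c) : bv b ≤ bv c := by
  have := bv_sdiff h; omega

lemma bv_pos {b : Finset ℕ} (h : b.Nonempty) : 0 < bv b := by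
  apply Finset.sum_pos _ h
  intro i _; positivity

section
variable {E : Type*} [Field E] [CharP E 2]

lemma add_pow_bv (x y : E) (b : Finset ℕ) :
    (x + y) ^ bv b = ∑ t ∈ b.powerset, x ^ bv t * y ^ bv (b \ t) := by
  rw [bv, ← Finset.prod_pow_eq_pow_sum]
  have : ∀ i ∈ b, (x + y) ^ 2 ^ i = x ^ 2 ^ i + y ^ 2 ^ i := fun i _ => add_pow_char_pow x y 2 i
  rw [Finset.prod_congr rfl this, Finset.prod_add]
  apply Finset.sum_congr rfl
  intro t _
  rw [Finset.prod_pow_eq_pow_sum, Finset.prod_pow_eq_pow_sum, bv, bv]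

variable [Fintype E]

lemma sum_pow_E (i : ℕ) : ∑ x : E, x ^ i = if 0 < i ∧ Fintype.card E - 1 ∣ i then 1 else 0 := by
  classical
  rcases Nat.eq_zero_or_pos i with h | h
  · subst h
    simp only [lt_irrefl, false_and, if_false]
    simp
  · have h1 : ∑ x : E, x ^ i = ∑ x : Eˣ, (x : E) ^ i := by
      rw [← Fintype.sum_subtype_add_sum_subtype (fun x : E => x ≠ 0)]
      have h2 : ∑ x : {x : E // ¬ x ≠ 0}, (x : E) ^ i = 0 := by
        apply Finset.sum_eq_zero
        rintro ⟨x, hx⟩ _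
        simp only [ne_eq, not_not] at hx
        simp [hx, h.ne']
      rw [h2, add_zero]
      exact (Fintype.sum_equiv unitsEquivNeZero _ _ (fun x => by simp)).symm
    rw [h1, FiniteField.sum_pow_units]
    simp only [h, true_and]
    congr 1
    exact CharTwo.neg_eq 1

lemma glynn_step {H : ℕ} (hE : Fintype.card E = 2 ^ H) (f : E → E) (Bd : Finset E)
    (hB1 : ∀ s ∉ Bd, ∀ x, x ≠ s → f x ≠ f s)
    (hB2 : ∀ s ∉ Bd, ∀ x y, x ≠ s → y ≠ s → x ≠ y →
      (f x + f s) * (y + s) ≠ (f y + f s) * (x + s))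
    (b : Finset ℕ) (hb : b ⊆ Finset.range H) (hb0 : b.Nonempty) (hb1 : b ≠ Finset.range H)
    (IH : ∀ b', b' ⊂ b → b'.Nonempty → ∀ c, c ⊆ Finset.range H \ b →
      ∑ x : E, f x ^ bv b' * x ^ bv c = 0)
    (hcard : Bd.card ≤ bv b) (c : Finset ℕ) (hc : c ⊆ Finset.range H \ b) :
    ∑ x : E, f x ^ bv b * x ^ bv c = 0 := by
  classical
  set bc := Finset.range H \ b with hbc
  have hsum : bv bc + bv b + 1 = 2 ^ H := by rw [hbc, bv_sdiff hb, bv_range]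
  have hbpos := bv_pos hb0
  have hbcne : bc.Nonempty := by
    rw [hbc, Finset.sdiff_nonempty]
    intro h; exact hb1 (Finset.Subset.antisymm hb h)
  have hbcpos := bv_pos hbcne
  have step1 : ∀ s ∉ Bd, ∑ x : E, (f x + f s) ^ bv b * (x + s) ^ bv bc = 0 := by
    intro s hs
    let φ : E → E := fun x => (f x + f s) / (x + s)
    have hne : ∀ x, x ≠ s → x + s ≠ 0 := by
      intro x hx h0
      exact hx (by rwa [CharTwo.add_eq_zero] at h0)
    have hφs : φ s = 0 := by simp [φ, CharTwo.add_self_eq_zero]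
    have hφ0 : ∀ x, x ≠ s → φ x ≠ 0 := by
      intro x hx
      apply div_ne_zero _ (hne x hx)
      intro h0
      exact hB1 s hs x hx (by rwa [CharTwo.add_eq_zero] at h0)
    have hinj : Function.Injective φ := by
      intro x y hxy
      by_contra hn
      by_cases hx : x = s
      · subst hx
        exact hφ0 y (Ne.symm hn) (by rw [← hxy, hφs])
      · by_cases hy : y = s
        · subst hy
          exact hφ0 x hx (by rw [hxy, hφs])
        · apply hB2 s hs x y hx hy hn
          simp only [φ] at hxy
          rwa [div_eq_div_iff (hne x hx) (hne y hy)] at hxy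
    have hbij : Function.Bijective φ := Finite.injective_iff_bijective.mp hinj
    have h1 : ∑ x : E, φ x ^ bv b = 0 := by
      rw [hbij.sum_comp (fun u => u ^ bv b)]
      apply FiniteField.sum_pow_lt_card_sub_one
      rw [hE]; omega
    rw [← h1]
    apply Finset.sum_congr rfl
    intro x _
    by_cases hx : x = s
    · subst hx; rw [hφs, CharTwo.add_self_eq_zero, CharTwo.add_self_eq_zero,
        zero_pow hbpos.ne', zero_mul]
    · simp only [φ]
      have h2 : (x + s) ^ bv b * (x + s) ^ bv bc = 1 := by
        rw [← pow_add]
        have := FiniteField.pow_card_sub_one_eq_one (x + s) (hne x hx)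
        rw [hE] at this
        rw [← this]; congr 1; omega
      rw [div_pow, eq_div_iff (pow_ne_zero _ (hne x hx)), mul_assoc, mul_comm (_ ^ bv bc), h2, mul_one]
  let M : Finset ℕ → Finset ℕ → E := fun b c => ∑ x : E, f x ^ bv b * x ^ bv c
  have step2 : ∀ s ∉ Bd, ∑ c' ∈ bc.powerset, M b c' * s ^ bv (bc \ c') = 0 := by
    intro s hs
    have h1 := step1 s hs
    have h2 : ∀ x : E, (f x + f s) ^ bv b * (x + s) ^ bv bc =
        ∑ b' ∈ b.powerset, ∑ c' ∈ bc.powerset, (f x ^ bv b' * x ^ bv c') *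
          (f s ^ bv (b \ b') * s ^ bv (bc \ c')) := by
      intro x
      rw [add_pow_bv, add_pow_bv, Finset.sum_mul_sum]
      apply Finset.sum_congr rfl; intro b' _
      apply Finset.sum_congr rfl; intro c' _
      ring
    rw [Finset.sum_congr rfl (fun x _ => h2 x), Finset.sum_comm] at h1
    rw [Finset.sum_eq_single b] at h1
    · rw [Finset.sum_comm] at h1
      rw [← h1]
      apply Finset.sum_congr rfl
      intro c' _
      rw [← Finset.sum_mul]
      simp [M, bv]
    · intro b' hb' hne
      rw [Finset.sum_comm]
      apply Finset.sum_eq_zero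
      intro c' hc'
      rw [← Finset.sum_mul]
      rw [Finset.mem_powerset] at hb' hc'
      have : ∑ x : E, f x ^ bv b' * x ^ bv c' = 0 := by
        rcases Finset.eq_empty_or_nonempty b' with h0 | h0
        · subst h0
          have e : bv ∅ = 0 := by simp [bv]
          simp only [e, pow_zero, one_mul]
          apply FiniteField.sum_pow_lt_card_sub_one
          have := bv_mono hc'
          rw [hE]; omega
        · exact IH b' (Finset.ssubset_iff_subset_ne.mpr ⟨hb', hne⟩) h0 c' hc'
      rw [this, zero_mul]
    · intro h; simp at h
  let P : E[X] := ∑ c' ∈ bc.powerset, C (M b c') * X ^ bv (bc \ c')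
  have hP0 : P = 0 := by
    apply Polynomial.eq_zero_of_natDegree_lt_card_of_eval_eq_zero' P Bdᶜ
    · intro s hs
      rw [Finset.mem_compl] at hs
      simp only [P, eval_finsetSum, eval_mul, eval_C, eval_pow, eval_X]
      exact step2 s hs
    · have hd : P.natDegree ≤ bv bc := by
        apply natDegree_sum_le_of_forall_le
        intro c' _
        apply (natDegree_C_mul_X_pow_le _ _).trans
        exact bv_mono Finset.sdiff_subset
      rw [Finset.card_compl, hE]; omega
  have h3 := congrArg (fun p => p.coeff (bv (bc \ c))) hP0
  simp only [P, finsetSum_coeff, coeff_zero, coeff_C_mul_X_pow] at h3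
  rw [Finset.sum_eq_single c] at h3
  · simpa using h3
  · intro c' hc' hne
    rw [if_neg]
    intro h
    apply hne
    have := bv_inj h
    rw [Finset.mem_powerset] at hc'
    rw [← Finset.sdiff_sdiff_eq_self hc', ← this, Finset.sdiff_sdiff_eq_self hc]
  · intro h; exact absurd (Finset.mem_powerset.mpr hc) h
end

lemma testBit_bv (b : Finset ℕ) (i : ℕ) : (bv b).testBit i = true ↔ i ∈ b := by
  rw [← Nat.mem_bitIndices, ← List.mem_toFinset, bv, Finset.toFinset_bitIndices_sum_two_pow]

def bits (n : ℕ) : Finset ℕ := n.bitIndices.toFinset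

lemma bv_bits (n : ℕ) : bv (bits n) = n := Finset.sum_toFinset_bitIndices_two_pow n

lemma mem_bits (n i : ℕ) : i ∈ bits n ↔ n.testBit i = true := by
  rw [bits, List.mem_toFinset, Nat.mem_bitIndices]

section
variable {E : Type*} [Field E] [CharP E 2]

lemma expand_pow_two_pow (g : E[X]) (v : ℕ) :
    (expand E 2 g) ^ 2 ^ v = expand E (2 ^ (v + 1)) (g.map (iterateFrobenius E 2 v)) := by
  have h := map_iterateFrobenius_expand (p := 2) (f := expand E 2 g) (n := v)
  rw [← h, expand_expand, map_expand, ← pow_succ]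

variable [Fintype E]

lemma sum_eval_E (P : E[X]) : ∑ x : E, P.eval x = ∑ i ∈ Finset.range (P.natDegree + 1),
    P.coeff i * (if 0 < i ∧ Fintype.card E - 1 ∣ i then 1 else 0) := by
  simp only [eval_eq_sum_range]
  rw [Finset.sum_comm]
  apply Finset.sum_congr rfl
  intro i _
  rw [← Finset.mul_sum, sum_pow_E]

lemma glynn_small {H : ℕ} (hE : Fintype.card E = 2 ^ H) (g : E[X]) (b c : Finset ℕ)
    (hb : b ⊆ Finset.range H) (hb0 : b.Nonempty) (hc : c ⊆ Finset.range H \ b)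
    (hd : (expand E 2 g).natDegree * bv b < 2 ^ H - 1) :
    ∑ x : E, (expand E 2 g).eval x ^ bv b * x ^ bv c = 0 := by
  classical
  have h1 : ∀ x : E, (expand E 2 g).eval x ^ bv b * x ^ bv c =
      ((expand E 2 g) ^ bv b * X ^ bv c).eval x := by intro x; simp
  rw [Finset.sum_congr rfl (fun x _ => h1 x), sum_eval_E]
  apply Finset.sum_eq_zero
  intro i _
  split_ifs with hi
  swap
  · simp
  rw [mul_one]
  rw [hE] at hi
  rw [coeff_mul_X_pow']
  split_ifs with hci
  swap
  · rfl
  by_contra hne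
  have hcr : c ⊆ Finset.range H := hc.trans Finset.sdiff_subset
  have hle : i - bv c ≤ (expand E 2 g).natDegree * bv b := by
    have h2 := le_natDegree_of_ne_zero hne
    have h3 := natDegree_pow_le (p := expand E 2 g) (n := bv b)
    rw [mul_comm]; exact h2.trans h3
  have hbc : bv c + bv b ≤ 2 ^ H - 1 := by
    have e1 := bv_mono hc
    have e2 := bv_sdiff hb
    have e3 := bv_range H
    omega
  have hbp := bv_pos hb0
  have hi2 : i = 2 ^ H - 1 := by
    obtain ⟨k, hk⟩ := hi.2
    have hk1 : 1 ≤ k := by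
      rcases Nat.eq_zero_or_pos k with h | h
      · subst h; omega
      · exact h
    have hk2 : k < 2 := by
      by_contra h
      have : (2 ^ H - 1) * 2 ≤ (2 ^ H - 1) * k := Nat.mul_le_mul_left _ (by omega)
      omega
    have : k = 1 := by omega
    subst this; omega
  set v := b.min' hb0 with hv
  have hvb : v ∈ b := Finset.min'_mem b hb0
  have hdvd : 2 ^ v ∣ bv b := by
    apply Finset.dvd_sum
    intro j hj
    exact pow_dvd_pow 2 (Finset.min'_le b j hj)
  obtain ⟨m, hm⟩ := hdvd
  have e4 : bv (Finset.range H \ c) = i - bv c := by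
    have e2 := bv_sdiff hcr
    have e3 := bv_range H
    omega
  have hvc : v ∈ Finset.range H \ c := by
    rw [Finset.mem_sdiff]
    refine ⟨hb hvb, fun h => ?_⟩
    have := hc h
    rw [Finset.mem_sdiff] at this
    exact this.2 hvb
  have hbit := (testBit_bv _ v).mpr hvc
  rw [e4] at hbit
  rw [hm, pow_mul, expand_pow_two_pow, ← map_pow, coeff_expand (by positivity)] at hne
  have hdv : 2 ^ (v + 1) ∣ i - bv c := by
    by_contra h; rw [if_neg h] at hne; exact hne rfl
  obtain ⟨z, hz⟩ := hdv
  rw [hz, Nat.testBit_two_pow_mul] at hbit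
  simp at hbit

theorem glynn {H : ℕ} (hE : Fintype.card E = 2 ^ H) (g : E[X]) (Bd : Finset E)
    (hB1 : ∀ s ∉ Bd, ∀ x, x ≠ s → (expand E 2 g).eval x ≠ (expand E 2 g).eval s)
    (hB2 : ∀ s ∉ Bd, ∀ x y, x ≠ s → y ≠ s → x ≠ y →
      ((expand E 2 g).eval x + (expand E 2 g).eval s) * (y + s) ≠
        ((expand E 2 g).eval y + (expand E 2 g).eval s) * (x + s))
    (hd : (expand E 2 g).natDegree * Bd.card < 2 ^ H - 1)
    (b : Finset ℕ) (hb : b ⊆ Finset.range H) (hb0 : b.Nonempty) (hb1 : b ≠ Finset.range H)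
    (c : Finset ℕ) (hc : c ⊆ Finset.range H \ b) :
    ∑ x : E, (expand E 2 g).eval x ^ bv b * x ^ bv c = 0 := by
  classical
  induction b using Finset.strongInduction generalizing c with
  | H b ih =>
    by_cases hcard : Bd.card ≤ bv b
    · apply glynn_step hE (fun x => (expand E 2 g).eval x) Bd hB1 hB2 b hb hb0 hb1 _ hcard c hc
      intro b' hb' hb0' c' hc'
      apply ih b' hb' (hb'.1.trans hb) hb0'
      · rintro rfl
        exact hb'.2 hb
      · exact hc'.trans (Finset.sdiff_subset_sdiff (le_refl _) hb'.1)
    · apply glynn_small hE g b c hb hb0 hc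
      refine lt_of_le_of_lt (Nat.mul_le_mul_left _ ?_) hd
      omega

lemma even_of_opoly {H : ℕ} (hE : Fintype.card E = 2 ^ H) (hH : 2 ≤ H) (f : E[X])
    (hB1 : ∀ s x : E, x ≠ s → f.eval x ≠ f.eval s)
    (hB2 : ∀ s x y : E, x ≠ s → y ≠ s → x ≠ y →
      (f.eval x + f.eval s) * (y + s) ≠ (f.eval y + f.eval s) * (x + s))
    (hd : f.natDegree < 2 ^ H - 1) : derivative f = 0 := by
  classical
  have h4 : 2 ^ 2 ≤ 2 ^ H := Nat.pow_le_pow_right (by norm_num) hH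
  have key : ∀ c ⊆ Finset.range H \ {0}, ∑ x : E, f.eval x ^ bv {0} * x ^ bv c = 0 := by
    intro c hc
    apply glynn_step hE (fun x => f.eval x) ∅ (fun s _ => hB1 s) (fun s _ => hB2 s) {0} _ _ _ _ _ c hc
    · simp; omega
    · simp
    · intro h
      have := congrArg Finset.card h
      simp at this; omega
    · intro b' hb' hb0'
      rw [Finset.ssubset_singleton_iff] at hb'
      subst hb'; simp at hb0'
    · simp
  ext i
  rw [coeff_derivative, coeff_zero]
  by_cases hi : Odd (i + 1)
  swap
  · have : ((i : E) + 1) = 0 := by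
      rw [Nat.not_odd_iff_even] at hi
      exact_mod_cast (CharP.cast_eq_zero_iff E 2 (i + 1)).mpr hi.two_dvd
    rw [this, mul_zero]
  · suffices h : f.coeff (i + 1) = 0 by rw [h, zero_mul]
    by_cases hile : i + 1 ≤ f.natDegree
    swap
    · exact coeff_eq_zero_of_natDegree_lt (by omega)
    have hk := key (bits (2 ^ H - 1 - (i + 1))) (by
      intro t ht
      rw [mem_bits] at ht
      have h2 := Nat.ge_two_pow_of_testBit ht
      rw [Finset.mem_sdiff, Finset.mem_range, Finset.mem_singleton]
      constructor
      · rw [← Nat.pow_lt_pow_iff_right (a := 2) (by norm_num)]; omega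
      · rintro rfl
        rw [Nat.testBit_zero] at ht
        have h2H : 2 ^ H = 2 * 2 ^ (H - 1) := by
          rw [← pow_succ']; congr 1; omega
        obtain ⟨z, hz⟩ := hi
        simp at ht
        omega)
    rw [bv_bits] at hk
    have h1 : ∀ x : E, f.eval x ^ bv {0} * x ^ (2 ^ H - 1 - (i + 1)) =
      (f * X ^ (2 ^ H - 1 - (i + 1))).eval x := by intro x; simp [bv]
    rw [Finset.sum_congr rfl (fun x _ => h1 x), sum_eval_E] at hk
    rw [Finset.sum_eq_single (2 ^ H - 1)] at hk
    · rw [hE, if_pos ⟨by omega, dvd_rfl⟩, mul_one, coeff_mul_X_pow', if_pos (by omega)] at hk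
      rw [← hk]; congr 1; omega
    · intro j hj hjne
      rw [if_neg, mul_zero]
      rintro ⟨hj0, k, hk⟩
      rw [hE] at hk
      have hjd : j ≤ f.natDegree + (2 ^ H - 1 - (i + 1)) := by
        rw [Finset.mem_range] at hj
        have := natDegree_mul_le (p := f) (q := X ^ (2 ^ H - 1 - (i + 1)))
        rw [natDegree_X_pow] at this
        omega
      have hk1 : k ≠ 0 := by rintro rfl; omega
      have hk2 : k ≠ 1 := by rintro rfl; omega
      have : (2 ^ H - 1) * 2 ≤ (2 ^ H - 1) * k := Nat.mul_le_mul_left _ (by omega)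
      omega
    · intro h
      rw [Finset.mem_range, not_lt] at h
      rw [coeff_eq_zero_of_natDegree_lt (by omega), zero_mul]
end

structure Block {R : Type*} [CommRing R] (g : R[X]) (y N P : ℕ) : Prop where
  odd : y % 2 = 1
  lt : y + 1 < 2 ^ P
  lo : 2 ^ P ≤ 2 * N
  hi : N < 2 ^ P
  sub : ∀ t, y.testBit t = true → (2 * N + 1).testBit t = true
  deg : g.natDegree * y + 1 < N + 2 ^ P
  coe : (g ^ y).coeff N ≠ 0

lemma pow_two_pow_expand {R : Type*} [CommRing R] [CharP R 2] (g : R[X]) (v : ℕ) :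
    g ^ 2 ^ v = expand R (2 ^ v) (g.map (iterateFrobenius R 2 v)) := by
  rw [← map_iterateFrobenius_expand (p := 2) (f := g) (n := v), map_expand]

lemma Block.concat {R : Type*} [CommRing R] [IsDomain R] [CharP R 2] {g : R[X]}
    {y₁ N₁ P₁ y₂ N₂ P₂ : ℕ} (h₁ : Block g y₁ N₁ P₁) (h₂ : Block g y₂ N₂ P₂) :
    Block g (y₁ + 2 ^ P₁ * y₂) (N₁ + 2 ^ P₁ * N₂) (P₁ + P₂) := by
  have hP0 : P₁ ≠ 0 := by
    rintro rfl
    have := h₁.lt; simp at this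
  have hP0' : P₂ ≠ 0 := by
    rintro rfl
    have := h₂.lt; simp at this
  have hp : 2 ^ P₁ = 2 * 2 ^ (P₁ - 1) := by rw [← pow_succ']; congr 1; omega
  have hpp : 0 < 2 ^ P₁ := by positivity
  have hadd : 2 ^ (P₁ + P₂) = 2 ^ P₁ * 2 ^ P₂ := pow_add _ _ _
  have hm2 : 2 ^ P₁ * (N₂ + 1) ≤ 2 ^ P₁ * 2 ^ P₂ := Nat.mul_le_mul_left _ h₂.hi
  constructor
  · have := h₁.odd
    rw [hp, mul_assoc]; omega
  · have : 2 ^ P₁ * (y₂ + 2) ≤ 2 ^ P₁ * 2 ^ P₂ := Nat.mul_le_mul_left _ h₂.lt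
    have := h₁.lt
    rw [hadd]; nlinarith
  · have : 2 ^ P₁ * 2 ^ P₂ ≤ 2 ^ P₁ * (2 * N₂) := Nat.mul_le_mul_left _ h₂.lo
    rw [hadd]; nlinarith
  · have := h₁.hi
    rw [hadd]; nlinarith
  · intro t ht
    have hN : 2 * (N₁ + 2 ^ P₁ * N₂) + 1 = 2 ^ P₁ * (2 * N₂ + 1) + (2 * N₁ + 1 - 2 ^ P₁) := by
      have := h₁.lo
      have e : 2 ^ P₁ * (2 * N₂ + 1) = 2 * (2 ^ P₁ * N₂) + 2 ^ P₁ := by ring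
      omega
    have hlt : 2 * N₁ + 1 - 2 ^ P₁ < 2 ^ P₁ := by
      have := h₁.hi; omega
    rw [hN, Nat.testBit_two_pow_mul_add _ hlt]
    rw [add_comm, Nat.testBit_two_pow_mul_add _ (by have := h₁.lt; omega)] at ht
    split_ifs at ht ⊢ with hlt2
    · have h3 := h₁.sub t ht
      have e : 2 * N₁ + 1 = 2 ^ P₁ * 1 + (2 * N₁ + 1 - 2 ^ P₁) := by
        have := h₁.lo; omega
      rw [e, Nat.testBit_two_pow_mul_add _ hlt, if_pos hlt2] at h3
      exact h3
    · exact h₂.sub _ ht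
  · have : 2 ^ P₁ * (g.natDegree * y₂ + 2) ≤ 2 ^ P₁ * (N₂ + 2 ^ P₂) := Nat.mul_le_mul_left _ h₂.deg
    have := h₁.deg
    rw [hadd]; nlinarith
  · have hd : (g ^ y₁).natDegree ≤ g.natDegree * y₁ := by
      rw [mul_comm]; exact natDegree_pow_le
    rw [pow_add, mul_comm (2 ^ P₁) y₂, pow_mul, pow_two_pow_expand (g ^ y₂) P₁, coeff_mul]
    rw [Finset.sum_eq_single (N₁, 2 ^ P₁ * N₂)]
    · simp only
      rw [coeff_expand hpp, if_pos (dvd_mul_right _ _), Nat.mul_div_cancel_left _ hpp, coeff_map]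
      apply mul_ne_zero h₁.coe
      rw [iterateFrobenius_def]
      exact pow_ne_zero _ h₂.coe
    · rintro ⟨i, j⟩ hij hne
      rw [Finset.HasAntidiagonal.mem_antidiagonal] at hij
      simp only at hij ⊢
      rw [coeff_expand hpp]
      split_ifs with hdv
      swap
      · rw [mul_zero]
      obtain ⟨z, rfl⟩ := hdv
      have hz : z < N₂ := by
        rcases lt_trichotomy z N₂ with h | h | h
        · exact h
        · subst h; exact absurd (by ext <;> simp; omega) hne
        · have : 2 ^ P₁ * (N₂ + 1) ≤ 2 ^ P₁ * z := Nat.mul_le_mul_left _ h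
          have := h₁.hi
          nlinarith
      have : 2 ^ P₁ * (z + 1) ≤ 2 ^ P₁ * N₂ := Nat.mul_le_mul_left _ hz
      have h4 := h₁.deg
      rw [coeff_eq_zero_of_natDegree_lt, zero_mul]
      nlinarith
    · intro h
      exact absurd (by rw [Finset.HasAntidiagonal.mem_antidiagonal]) h

/-- lengths of blocks -/
def BlockLen {R : Type*} [CommRing R] (g : R[X]) : Set ℕ := {P | ∃ y N, Block g y N P}

lemma blockLen_large {R : Type*} [CommRing R] [IsDomain R] [CharP R 2] {g : R[X]}
    (hg : ∀ m, 2 ≤ m → ∃ P ∈ BlockLen g, ¬ m ∣ P) : ∃ n, ∀ P ≥ n, P ∈ BlockLen g := by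
  obtain ⟨n, hn⟩ := Nat.exists_mem_closure_of_ge (BlockLen g)
  have hne : Nat.setGcd (BlockLen g) = 1 := by
    by_contra h1
    rcases Nat.eq_zero_or_pos (Nat.setGcd (BlockLen g)) with h0 | h0
    · obtain ⟨P, hP, hd⟩ := hg (2) (le_refl _)
      have := Nat.setGcd_dvd_of_mem hP
      rw [h0, zero_dvd_iff] at this
      subst this; exact hd (dvd_zero _)
    · obtain ⟨P, hP, hd⟩ := hg _ (show 2 ≤ Nat.setGcd (BlockLen g) by omega)
      exact hd (Nat.setGcd_dvd_of_mem hP)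
  refine ⟨n + 1, fun P hP => ?_⟩
  have h1 := hn P (by omega) (by rw [hne]; exact one_dvd _)
  have h2 : ∀ Q ∈ AddSubmonoid.closure (BlockLen g), Q ∈ BlockLen g ∨ Q = 0 := by
    intro Q hQ
    induction hQ using AddSubmonoid.closure_induction with
    | mem x hx => exact Or.inl hx
    | zero => exact Or.inr rfl
    | add x y _ _ hx hy =>
      rcases hx with hx | hx
      · rcases hy with hy | hy
        · obtain ⟨y1, N1, hb1⟩ := hx
          obtain ⟨y2, N2, hb2⟩ := hy
          exact Or.inl ⟨_, _, hb1.concat hb2⟩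
        · rw [hy, add_zero]; exact Or.inl hx
      · rw [hx, zero_add]; exact hy
  rcases h2 P h1 with h | h
  · exact h
  · omega

lemma block_contra {E : Type*} [Field E] [CharP E 2] [Fintype E]
    {H : ℕ} (hE : Fintype.card E = 2 ^ H) (g : E[X]) (Bd : Finset E)
    (hB1 : ∀ s ∉ Bd, ∀ x, x ≠ s → (expand E 2 g).eval x ≠ (expand E 2 g).eval s)
    (hB2 : ∀ s ∉ Bd, ∀ x y, x ≠ s → y ≠ s → x ≠ y →
      ((expand E 2 g).eval x + (expand E 2 g).eval s) * (y + s) ≠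
        ((expand E 2 g).eval y + (expand E 2 g).eval s) * (x + s))
    (hd : (expand E 2 g).natDegree * Bd.card < 2 ^ H - 1) {y N : ℕ} (hbl : Block g y N H) : False := by
  classical
  have hlt := hbl.lt
  have hlo := hbl.lo
  have hhi := hbl.hi
  have hbr := bv_range H
  have hH0 : H ≠ 0 := by
    rintro rfl
    simp at hlt
  have hp : 2 ^ H = 2 * 2 ^ (H - 1) := by rw [← pow_succ']; congr 1; omega
  have hbr' : ∀ n, n < 2 ^ H → bits n ⊆ Finset.range H := by
    intro n hn t ht
    rw [mem_bits] at ht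
    have h2 := Nat.ge_two_pow_of_testBit ht
    rw [Finset.mem_range]
    rw [← Nat.pow_lt_pow_iff_right (a := 2) (by norm_num)]; omega
  have key := glynn hE g Bd hB1 hB2 hd (bits y) (hbr' y (by omega))
    ⟨0, by rw [mem_bits, Nat.testBit_zero]; simp [hbl.odd]⟩
    (by intro h; have := congrArg bv h; rw [bv_bits] at this; omega)
    (bits (2 * (2 ^ H - 1 - N))) (by
      intro t ht
      rw [Finset.mem_sdiff]
      refine ⟨hbr' _ (by omega) ht, fun ht2 => ?_⟩
      rw [mem_bits] at ht ht2
      have h3 := hbl.sub t ht2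
      have h4 : t ≠ 0 := by
        rintro rfl
        rw [Nat.testBit_zero] at ht; simp at ht
      obtain ⟨u, rfl⟩ := Nat.exists_eq_succ_of_ne_zero h4
      rw [Nat.succ_eq_add_one, Nat.testBit_add_one] at ht h3
      rw [Nat.mul_div_cancel_left _ (by norm_num)] at ht
      have e : (2 * N + 1) / 2 = N := by omega
      rw [e] at h3
      have e2 : 2 ^ H - 1 - N = 2 ^ H - (N + 1) := by omega
      rw [e2, Nat.testBit_two_pow_sub_succ hhi] at ht
      rw [h3] at ht; simp at ht)
  rw [bv_bits, bv_bits] at key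
  have h1 : ∀ x : E, (expand E 2 g).eval x ^ y * x ^ (2 * (2 ^ H - 1 - N)) =
      (expand E 2 (g ^ y * X ^ (2 ^ H - 1 - N))).eval x := by
    intro x; simp [pow_mul]
  rw [Finset.sum_congr rfl (fun x _ => h1 x), sum_eval_E] at key
  have hdeg := hbl.deg
  have hdle : (g ^ y * X ^ (2 ^ H - 1 - N)).natDegree < 2 * (2 ^ H - 1) := by
    have e1 := natDegree_mul_le (p := g ^ y) (q := X ^ (2 ^ H - 1 - N))
    have e2 := natDegree_pow_le (p := g) (n := y)
    rw [natDegree_X_pow] at e1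
    rw [mul_comm] at e2
    omega
  rw [Finset.sum_eq_single (2 * (2 ^ H - 1))] at key
  · rw [hE, if_pos ⟨by omega, Dvd.intro_left 2 rfl⟩, mul_one, coeff_expand (by norm_num),
      if_pos (dvd_mul_right _ _), Nat.mul_div_cancel_left _ (by norm_num),
      coeff_mul_X_pow', if_pos (by omega)] at key
    apply hbl.coe
    rw [← key]; congr 1; omega
  · intro j hj hjne
    split_ifs with hcond
    swap
    · rw [mul_zero]
    obtain ⟨hj0, k, hk⟩ := hcond
    rw [mul_one, coeff_expand (by norm_num)]
    split_ifs with hdv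
    swap
    · rfl
    obtain ⟨z, rfl⟩ := hdv
    rw [hE] at hk
    rw [Nat.mul_div_cancel_left _ (by norm_num)]
    have hkev : 2 ∣ k := by
      have h5 : 2 ∣ (2 ^ H - 1) * k := ⟨z, hk.symm⟩
      rcases (Nat.Prime.dvd_mul Nat.prime_two).mp h5 with h | h
      · omega
      · exact h
    obtain ⟨l, rfl⟩ := hkev
    have hz : z = (2 ^ H - 1) * l := by
      have : 2 * z = 2 * ((2 ^ H - 1) * l) := by rw [hk]; ring
      omega
    have hl0 : l ≠ 0 := by rintro rfl; omega
    have hl1 : l ≠ 1 := by rintro rfl; omega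
    apply coeff_eq_zero_of_natDegree_lt
    have : (2 ^ H - 1) * 2 ≤ (2 ^ H - 1) * l := Nat.mul_le_mul_left _ (by omega)
    omega
  · intro h
    rw [coeff_eq_zero_of_natDegree_lt, zero_mul]
    rw [Finset.mem_range, not_lt] at h
    omega

def Reach (δ τ t : ℕ) : Prop := ∃ y, y % 2 = 1 ∧ y < 2 ^ τ ∧
  (∀ i, y.testBit i = true → (2 * δ * y + 1).testBit i = true) ∧ t = (2 * δ * y + 1) / 2 ^ τ

lemma Reach.start (δ : ℕ) : Reach δ 1 δ := by
  refine ⟨1, rfl, by norm_num, ?_, by omega⟩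
  intro i hi
  have : i = 0 := by
    by_contra h
    rw [Nat.testBit_one_eq_true_iff_self_eq_zero] at hi
    exact h hi
  subst this
  rw [Nat.testBit_zero]
  simp

lemma Reach.half {δ τ t : ℕ} (h : Reach δ τ t) : Reach δ (τ + 1) (t / 2) := by
  obtain ⟨y, h1, h2, h3, h4⟩ := h
  refine ⟨y, h1, ?_, h3, ?_⟩
  · rw [pow_succ]; omega
  · rw [h4, Nat.div_div_eq_div_mul, pow_succ]

lemma Reach.half_iter {δ τ t : ℕ} (h : Reach δ τ t) (j : ℕ) : Reach δ (τ + j) (t / 2 ^ j) := by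
  induction j with
  | zero => simpa using h
  | succ j ih =>
    have := ih.half
    rwa [Nat.div_div_eq_div_mul, ← pow_succ, add_assoc] at this

lemma Reach.add {δ τ t : ℕ} (h : Reach δ τ t) (ht : t % 2 = 1) : Reach δ (τ + 1) (t / 2 + δ) := by
  obtain ⟨y, h1, h2, h3, h4⟩ := h
  have e : 2 * δ * (2 ^ τ * 1 + y) + 1 = (2 * δ * y + 1) + 2 ^ (τ + 1) * δ := by
    rw [pow_succ]; ring
  have hτ : τ ≠ 0 := by rintro rfl; simp at h2; omega
  refine ⟨2 ^ τ * 1 + y, ?_, ?_, ?_, ?_⟩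
  · have : 2 ^ τ = 2 * 2 ^ (τ - 1) := by rw [← pow_succ']; congr 1; omega
    omega
  · rw [pow_succ]; omega
  · intro i hi
    rw [e]
    rw [Nat.testBit_two_pow_mul_add _ h2] at hi
    have key : i < τ + 1 → ((2 * δ * y + 1) + 2 ^ (τ + 1) * δ).testBit i = (2 * δ * y + 1).testBit i := by
      intro hlt
      have a1 := Nat.testBit_mod_two_pow ((2 * δ * y + 1) + 2 ^ (τ + 1) * δ) (τ + 1) i
      have a2 := Nat.testBit_mod_two_pow (2 * δ * y + 1) (τ + 1) i
      rw [Nat.add_mul_mod_self_left] at a1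
      simp only [hlt, decide_true, Bool.true_and] at a1 a2
      rw [← a1, a2]
    split_ifs at hi with hlt
    · rw [key (by omega)]
      exact h3 i hi
    · rw [Nat.testBit_one_eq_true_iff_self_eq_zero] at hi
      have : i = τ := by omega
      subst this
      rw [key (by omega), Nat.testBit_eq_decide_div_mod_eq, ← h4, ht]; rfl
  · rw [e, Nat.add_mul_div_left _ _ (by positivity), h4, Nat.div_div_eq_div_mul, pow_succ]

lemma Reach.lt {δ τ t : ℕ} (h : Reach δ τ t) (hδ : 1 ≤ δ) : t < 2 * δ := by
  obtain ⟨y, h1, h2, h3, h4⟩ := h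
  rw [h4, Nat.div_lt_iff_lt_mul (by positivity)]
  have : 2 * δ * (y + 1) ≤ 2 * δ * 2 ^ τ := Nat.mul_le_mul_left _ h2
  nlinarith

lemma Reach.block {R : Type*} [CommRing R] [IsDomain R] {g : R[X]} {P : ℕ}
    (hd : 2 ≤ g.natDegree) (h : Reach g.natDegree P 1) : P ∈ BlockLen g := by
  obtain ⟨y, h1, h2, h3, h4⟩ := h
  set δ := g.natDegree with hδ
  have hP : P ≠ 0 := by rintro rfl; simp at h2; omega
  have h5 : 2 ^ P ≤ 2 * δ * y + 1 := by
    have := Nat.div_mul_le_self (2 * δ * y + 1) (2 ^ P)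
    rw [← h4] at this; omega
  have h6 : 2 * δ * y + 1 < 2 ^ P * 2 := by
    have := Nat.lt_mul_div_succ (2 * δ * y + 1) (show 0 < 2 ^ P by positivity)
    rw [← h4] at this; omega
  have hp : 2 ^ P = 2 * 2 ^ (P - 1) := by rw [← pow_succ']; congr 1; omega
  have e : 2 * δ * y = 2 * (δ * y) := by ring
  have h7 : 2 * y ≤ δ * y := Nat.mul_le_mul_right _ hd
  rw [e] at h5 h6 h3
  refine ⟨y, δ * y, h1, by omega, by omega, by omega, h3, ?_, ?_⟩
  · rw [← hδ]; omega
  · rw [mul_comm, hδ, ← natDegree_pow]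
    change leadingCoeff (g ^ y) ≠ 0
    rw [leadingCoeff_ne_zero]
    apply pow_ne_zero
    rintro rfl
    simp at hδ; omega

lemma log_exists (t : ℕ) (ht : 0 < t) : ∃ L, 2 ^ L ≤ t ∧ t < 2 ^ (L + 1) :=
  ⟨Nat.log 2 t, Nat.pow_log_le_self 2 ht.ne', Nat.lt_pow_succ_log_self (by norm_num) t⟩

lemma caseA_num (δ m : ℕ) (hm : 2 ≤ m) (h2 : 2 ≤ δ) (h3 : δ ≠ 3) (hpow : ∀ n, δ ≠ 2 ^ n)
    (hall : ∀ P, Reach δ P 1 → m ∣ P) : False := by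
  have hlog : ∀ τ t L, Reach δ τ t → 2 ^ L ≤ t → t < 2 ^ (L + 1) → m ∣ τ + L := by
    intro τ t L h h1 h2
    apply hall
    have := h.half_iter L
    have e : t / 2 ^ L = 1 := by
      rw [pow_succ] at h2
      rw [Nat.div_eq_iff (by positivity)]; omega
    rwa [e] at this
  obtain ⟨n, hn1, hn2⟩ := log_exists δ (by omega)
  have hmn := hlog 1 δ n (Reach.start δ) hn1 hn2
  have rule0 : ∀ τ t L, Reach δ τ t → t % 2 = 1 → t + 2 * δ ≤ 2 ^ (n + 2) → 2 ^ L ≤ t →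
      t < 2 ^ (L + 1) → m ∣ L := by
    intro τ t L h hodd hle hl1 hl2
    have e : 2 ^ (n + 2) = 2 * 2 ^ (n + 1) := pow_succ' _ _
    have a1 := hlog _ _ n (h.add hodd) (by omega) (by omega)
    have a2 := hlog _ _ L h hl1 hl2
    have a3 : m ∣ τ := by
      have e2 : τ + 1 + n = τ + (1 + n) := by ring
      rw [e2] at a1
      exact (Nat.dvd_add_left hmn).mp a1
    exact (Nat.dvd_add_right a3).mp a2
  have hnot1 : ∀ a, m ∣ a → m ∣ a + 1 → False := by
    intro a ha hb
    have := (Nat.dvd_add_right ha).mp hb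
    have := Nat.le_of_dvd one_pos this
    omega
  have hne := hpow n
  obtain ⟨p, hp1, hp2⟩ := log_exists (δ - 2 ^ n) (by omega)
  have hpn : p < n := by
    rw [← Nat.pow_lt_pow_iff_right (a := 2) (by norm_num)]
    rw [pow_succ] at hn2; omega
  obtain ⟨l, rfl⟩ : ∃ l, n = p + l := ⟨n - p, by omega⟩
  obtain ⟨r, hr⟩ : ∃ r, δ = 2 ^ (p + l) + 2 ^ p + r := ⟨δ - (2 ^ (p + l) + 2 ^ p), by omega⟩
  have hrlt : r < 2 ^ p := by rw [pow_succ] at hp2; omega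
  have hpp : 0 < 2 ^ p := by positivity
  have ht : δ / 2 ^ p = 2 ^ l + 1 := by
    have e : δ = r + 2 ^ p * (2 ^ l + 1) := by rw [hr, pow_add]; ring
    rw [e, Nat.add_mul_div_left _ _ hpp, Nat.div_eq_of_lt hrlt, zero_add]
  have hR1 := (Reach.start δ).half_iter p
  rw [ht] at hR1
  rcases (show l = 1 ∨ 2 ≤ l by omega) with hl | hl
  · subst hl
    by_cases hc : 3 + 2 * δ ≤ 2 ^ (p + 1 + 2)
    · have := rule0 _ _ 1 hR1 (by norm_num) (by simpa using hc) (by norm_num) (by norm_num)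
      have := Nat.le_of_dvd one_pos this
      omega
    · have hδ : δ + 1 = 2 ^ (p + 2) := by
        have e : 2 ^ (p + 1 + 2) = 2 * 2 ^ (p + 2) := pow_succ' _ _
        have e' : p + 1 + 1 = p + 2 := rfl
        rw [e'] at hn2
        omega
      have hp0 : p ≠ 0 := by rintro rfl; simp at hδ; omega
      obtain ⟨p', rfl⟩ := Nat.exists_eq_succ_of_ne_zero hp0
      have h7 : δ / 2 ^ p' = 7 := by
        rw [Nat.div_eq_iff (by positivity)]
        have e : 2 ^ (p' + 1 + 2) = 8 * 2 ^ p' := by ring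
        rw [Nat.succ_eq_add_one, e] at hδ
        have : 0 < 2 ^ p' := by positivity
        omega
      have hR7 := (Reach.start δ).half_iter p'
      rw [h7] at hR7
      have b1 := hlog _ _ 2 hR7 (by norm_num) (by norm_num)
      have e : 2 ^ (p' + 1 + 1 + 2) = 2 * 2 ^ (p' + 1 + 2) := by ring
      have e2 : 2 ^ (p' + 1 + 1 + 1) = 2 ^ (p' + 1 + 2) := rfl
      rw [Nat.succ_eq_add_one] at *
      have b2 := hlog _ _ (p' + 1 + 1 + 1) (hR7.add (by norm_num)) (by omega) (by omega)
      have b3 : m ∣ 1 + p' + 1 := by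
        have e3 : 1 + p' + 1 + (p' + 1 + 1 + 1) = (1 + p' + 1) + (1 + (p' + 1 + 1)) := by ring
        rw [e3] at b2
        exact (Nat.dvd_add_left hmn).mp b2
      exact hnot1 _ b3 b1
  · have h4l : 2 ^ 2 ≤ 2 ^ l := Nat.pow_le_pow_right (by norm_num) hl
    obtain ⟨l', rfl⟩ : ∃ l', l = l' + 1 := ⟨l - 1, by omega⟩
    have hpl : 2 ^ (p + (l' + 1)) = 2 * (2 ^ p * 2 ^ l') := by ring
    have hl'2 : 2 ≤ 2 ^ l' := by rw [pow_succ] at h4l; omega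
    have hbig : 2 ^ p * 2 ≤ 2 ^ p * 2 ^ l' := Nat.mul_le_mul_left _ hl'2
    have hbig2 : 1 * 2 ^ l' ≤ 2 ^ p * 2 ^ l' := Nat.mul_le_mul_right _ hpp
    have hpl2 : 2 ^ (p + (l' + 1) + 2) = 8 * (2 ^ p * 2 ^ l') := by ring
    have hll : 2 ^ (l' + 1) = 2 * 2 ^ l' := pow_succ' _ _
    have c1 : m ∣ l' + 1 := by
      apply rule0 _ _ _ hR1 _ _ (by omega) (by rw [pow_succ]; omega)
      · rw [hll]; omega
      · rw [hpl2, hr, hpl, hll]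
        omega
    -- the state v
    have hv : ∃ τ, Reach δ τ (δ / 2 ^ (l' + 1) + δ) := by
      have hR2 := (Reach.start δ).half_iter l'
      have e5 : δ / 2 ^ l' / 2 = δ / 2 ^ (l' + 1) := by
        rw [Nat.div_div_eq_div_mul, ← pow_succ]
      rcases Nat.mod_two_eq_zero_or_one (δ / 2 ^ l') with he | ho
      · have hu := (hR1.add (by rw [hll]; omega)).half_iter l'
        have e6 : ((2 ^ (l' + 1) + 1) / 2 + δ) / 2 ^ l' = δ / 2 ^ l' + 1 := by
          have : (2 ^ (l' + 1) + 1) / 2 = 2 ^ l' := by rw [hll]; omega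
          rw [this, Nat.add_div_left _ (by positivity)]
        rw [e6] at hu
        have hu2 := hu.add (by omega)
        have e7 : (δ / 2 ^ l' + 1) / 2 = δ / 2 ^ (l' + 1) := by rw [← e5]; omega
        rw [e7] at hu2
        exact ⟨_, hu2⟩
      · have hu2 := hR2.add ho
        rw [e5] at hu2
        exact ⟨_, hu2⟩
    obtain ⟨τ, hv⟩ := hv
    have hq1 : δ / 2 ^ (l' + 1) = 2 ^ p + (2 ^ p + r) / 2 ^ (l' + 1) := by
      have : δ = (2 ^ p + r) + 2 ^ (l' + 1) * 2 ^ p := by rw [hr]; ring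
      rw [this, Nat.add_mul_div_left _ _ (by positivity)]; ring
    have hq2 : (2 ^ p + r) / 2 ^ (l' + 1) < 2 ^ p := by
      rw [Nat.div_lt_iff_lt_mul (by positivity)]
      have : 2 ^ p * 4 ≤ 2 ^ p * 2 ^ (l' + 1) := Nat.mul_le_mul_left _ (by omega)
      omega
    have hvv : (δ / 2 ^ (l' + 1) + δ) / 2 ^ (p + 1) = 2 ^ l' + 1 := by
      have : δ / 2 ^ (l' + 1) + δ = (r + (2 ^ p + r) / 2 ^ (l' + 1)) + 2 ^ (p + 1) * (2 ^ l' + 1) := by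
        rw [hq1]
        rw [hr]; ring
      rw [this, Nat.add_mul_div_left _ _ (by positivity), Nat.div_eq_of_lt (by rw [pow_succ 2 p]; omega),
        zero_add]
    have hv2 := hv.half_iter (p + 1)
    rw [hvv] at hv2
    have c2 : m ∣ l' := by
      obtain ⟨l'', rfl⟩ : ∃ l'', l' = l'' + 1 := ⟨l' - 1, by omega⟩
      have e8 : 2 ^ (l'' + 1) = 2 * 2 ^ l'' := pow_succ' _ _
      apply rule0 _ _ _ hv2 _ _ (by omega) (by rw [pow_succ _ (l'' + 1)]; omega)
      · rw [e8]; omega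
      · rw [hpl2, hr, hpl]
        omega
    exact hnot1 _ c2 c1

lemma caseA {R : Type*} [CommRing R] [IsDomain R] [CharP R 2] {g : R[X]}
    (h2 : 2 ≤ g.natDegree) (h3 : g.natDegree ≠ 3) (hpow : ∀ n, g.natDegree ≠ 2 ^ n) :
    ∃ n, ∀ P ≥ n, P ∈ BlockLen g := by
  apply blockLen_large
  intro m hm
  by_contra hcon
  push Not at hcon
  exact caseA_num g.natDegree m hm h2 h3 hpow (fun P hP => hcon P (hP.block h2))

lemma caseB {R : Type*} [CommRing R] [IsDomain R] [CharP R 2] {a c : R} (ha : a ≠ 0) (hc : c ≠ 0) :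
    ∃ n, ∀ P ≥ n, P ∈ BlockLen (C a * (X ^ 3 + C c * X)) := by
  have hd : (C a * (X ^ 3 + C c * X)).natDegree = 3 := by
    rw [natDegree_C_mul ha]; compute_degree!
  have b1 : Block (C a * (X ^ 3 + C c * X)) 1 3 2 := by
    refine ⟨rfl, by norm_num, by norm_num, by norm_num, ?_, by rw [hd]; norm_num, ?_⟩
    · intro t ht
      rw [Nat.testBit_one_eq_true_iff_self_eq_zero] at ht
      subst ht; rfl
    · rw [pow_one, coeff_C_mul, coeff_add, coeff_X_pow, coeff_C_mul, coeff_X]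
      simpa using ha
  have b2 : Block (C a * (X ^ 3 + C c * X)) 3 5 3 := by
    refine ⟨rfl, by norm_num, by norm_num, by norm_num, ?_, by rw [hd]; norm_num, ?_⟩
    · intro t ht
      have := Nat.ge_two_pow_of_testBit ht
      have : t < 2 := by
        by_contra h
        have : 2 ^ 2 ≤ 2 ^ t := Nat.pow_le_pow_right (by norm_num) (by omega)
        omega
      interval_cases t <;> rfl
    · have e : (C a * (X ^ 3 + C c * X)) ^ 3 = C (a ^ 3) * (X ^ 9 + C (3 * c) * X ^ 7 +
          C (3 * c ^ 2) * X ^ 5 + C (c ^ 3) * X ^ 3) := by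
        simp only [map_mul, map_pow]
        have : (C (3 : R)) = 3 := rfl
        rw [this]
        ring
      have h3 : (3 : R) = 1 := by
        have : (2 : R) = 0 := CharTwo.two_eq_zero
        linear_combination this
      rw [e, coeff_C_mul]
      simp only [coeff_add, coeff_C_mul, coeff_X_pow]
      norm_num
      rw [h3]
      exact ⟨ha, one_ne_zero, hc⟩
  apply blockLen_large
  intro m hm
  by_contra hcon
  push Not at hcon
  have h1 := hcon 2 ⟨_, _, b1⟩
  have h2 := hcon 3 ⟨_, _, b2⟩
  have := (Nat.dvd_add_right h1).mp (show m ∣ 2 + 1 from h2)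
  have := Nat.le_of_dvd one_pos this
  omega

lemma monomial_prod_fin {R ι : Type*} [CommRing R] (s : Finset ι) (n : ι → ℕ) (c : ι → R) :
    ∏ i ∈ s, monomial (n i) (c i) = monomial (∑ i ∈ s, n i) (∏ i ∈ s, c i) := by
  classical
  induction s using Finset.induction_on with
  | empty => simp
  | insert a s ha ih => rw [Finset.prod_insert ha, ih, monomial_mul_monomial, Finset.sum_insert ha,
      Finset.prod_insert ha]

lemma coeff_unique {F ι : Type*} [Field F] [CharP F 2] {r : ℕ} (τ : Fin r → ℕ) (S : Finset ι)
    (J I : ι → ℕ) (a : ι → F) (ha : ∀ p ∈ S, a p ≠ 0) (N M : ℕ) (φ₀ : Fin r → ι)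
    (h₀ : ∀ i, φ₀ i ∈ S) (hN : ∑ i, J (φ₀ i) * 2 ^ τ i = N) (hM : ∑ i, I (φ₀ i) * 2 ^ τ i = M)
    (huniq : ∀ φ : Fin r → ι, (∀ i, φ i ∈ S) → ∑ i, J (φ i) * 2 ^ τ i = N →
      ∑ i, I (φ i) * 2 ^ τ i = M → φ = φ₀) :
    ((∑ p ∈ S, monomial (J p) (monomial (I p) (a p)) : F[X][X]) ^ (∑ i, 2 ^ τ i)).coeff N ≠ 0 := by
  classical
  have h1 : (∑ p ∈ S, monomial (J p) (monomial (I p) (a p)) : F[X][X]) ^ (∑ i, 2 ^ τ i) =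
      ∑ φ ∈ Fintype.piFinset (fun _ : Fin r => S),
        monomial (∑ i, J (φ i) * 2 ^ τ i) (monomial (∑ i, I (φ i) * 2 ^ τ i)
          (∏ i, a (φ i) ^ 2 ^ τ i)) := by
    rw [← Finset.prod_pow_eq_pow_sum]
    have h2 : ∀ i ∈ Finset.univ, (∑ p ∈ S, monomial (J p) (monomial (I p) (a p)) : F[X][X]) ^ 2 ^ τ i =
        ∑ p ∈ S, monomial (J p * 2 ^ τ i) (monomial (I p * 2 ^ τ i) (a p ^ 2 ^ τ i)) := by
      intro i _
      rw [sum_pow_char_pow]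
      apply Finset.sum_congr rfl
      intro p _
      rw [monomial_pow, monomial_pow]
    rw [Finset.prod_congr rfl h2, Finset.prod_univ_sum]
    apply Finset.sum_congr rfl
    intro φ _
    rw [monomial_prod_fin, monomial_prod_fin]
  intro h3
  have h4 := congrArg (fun p => p.coeff M) h3
  simp only [h1, finsetSum_coeff, coeff_zero] at h4
  rw [Finset.sum_eq_single φ₀] at h4
  · rw [hN, hM, coeff_monomial, if_pos rfl, coeff_monomial, if_pos rfl, Finset.prod_eq_zero_iff] at h4
    obtain ⟨i, _, hi⟩ := h4
    exact pow_ne_zero _ (ha _ (h₀ i)) hi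
  · intro φ hφ hne
    rw [coeff_monomial]
    split_ifs with c1
    · rw [coeff_monomial, if_neg]
      intro c2
      exact hne (huniq φ (fun i => Fintype.mem_piFinset.mp hφ i) c1 c2)
    · simp
  · intro h
    exact absurd (Fintype.mem_piFinset.mpr h₀) h

/-- `g(x+s)+g(s)` with `s` the inner variable -/
noncomputable def GG {F : Type*} [Field F] (g : F[X]) : F[X][X] := (g.map C).comp (X + C X) + C g

noncomputable def SS {F : Type*} [Field F] (g : F[X]) : Finset (ℕ × ℕ) :=
  (g.support.sigma (fun i => (Finset.range i).filter (fun j => Nat.choose i (j + 1) % 2 = 1))).image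
    (fun p => (p.1, p.2 + 1))

lemma mem_SS {F : Type*} [Field F] (g : F[X]) (i j : ℕ) : (i, j) ∈ SS g ↔
    g.coeff i ≠ 0 ∧ 1 ≤ j ∧ j ≤ i ∧ Nat.choose i j % 2 = 1 := by
  simp only [SS, Finset.mem_image, Finset.mem_sigma, mem_support_iff, Finset.mem_filter,
    Finset.mem_range]
  constructor
  · rintro ⟨⟨u, v⟩, ⟨h1, h2, h3⟩, h4⟩
    simp only [Prod.mk.injEq] at h4
    obtain ⟨rfl, rfl⟩ := h4
    exact ⟨h1, by omega, h2, h3⟩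
  · rintro ⟨h1, h2, h3, h4⟩
    refine ⟨⟨i, j - 1⟩, ⟨h1, by simp only; omega, ?_⟩, ?_⟩
    · simp only; rw [Nat.sub_add_cancel h2]; exact h4
    · simp only; rw [Nat.sub_add_cancel h2]

lemma GG_eq {F : Type*} [Field F] [CharP F 2] (g : F[X]) :
    GG g = ∑ p ∈ SS g, monomial p.2 (monomial (p.1 - p.2) (g.coeff p.1)) := by
  classical
  have hterm : ∀ i, ((X : F[X][X]) + C X) ^ i + C X ^ i = ∑ j ∈ (Finset.range i).filter
      (fun j => Nat.choose i (j + 1) % 2 = 1), monomial (j + 1) (monomial (i - (j + 1)) (1 : F)) := by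
    intro i
    rw [add_pow, Finset.sum_range_succ']
    simp only [pow_zero, Nat.sub_zero, one_mul, Nat.choose_zero_right, Nat.cast_one, mul_one]
    have h0 : (C X : F[X][X]) ^ i + C X ^ i = 0 := CharTwo.add_self_eq_zero _
    rw [add_assoc, h0, add_zero, Finset.sum_filter]
    apply Finset.sum_congr rfl
    intro j _
    split_ifs with h
    · have : ((i.choose (j + 1) : ℕ) : F[X][X]) = 1 := by
        rw [← Nat.mod_add_div (i.choose (j + 1)) 2, h]
        push_cast
        rw [show (2 : F[X][X]) = 0 from CharTwo.two_eq_zero]; simp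
      rw [this, mul_one, ← C_mul_X_pow_eq_monomial, ← C_mul_X_pow_eq_monomial]
      simp only [map_pow, C_1, one_mul]; ring
    · have : ((i.choose (j + 1) : ℕ) : F[X][X]) = 0 := by
        rw [CharP.cast_eq_zero_iff _ 2]; omega
      rw [this, mul_zero]
  have h1 : GG g = ∑ i ∈ g.support, C (C (g.coeff i)) * (((X : F[X][X]) + C X) ^ i + C X ^ i) := by
    rw [GG]
    have e1 : (g.map C).comp ((X : F[X][X]) + C X) = ∑ i ∈ g.support, C (C (g.coeff i)) * ((X : F[X][X]) + C X) ^ i := by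
      rw [comp, eval₂_map, eval₂_eq_sum, sum_def]; rfl
    have e2 : (C g : F[X][X]) = ∑ i ∈ g.support, C (C (g.coeff i)) * C X ^ i := by
      conv_lhs => rw [g.as_sum_support_C_mul_X_pow]
      rw [map_sum]
      apply Finset.sum_congr rfl; intro i _; rw [C_mul, C_pow]
    rw [e1]
    nth_rewrite 1 [e2]
    rw [← Finset.sum_add_distrib]
    apply Finset.sum_congr rfl; intro i _; ring
  rw [h1, SS, Finset.sum_image]
  · rw [Finset.sum_sigma]
    apply Finset.sum_congr rfl
    intro i _
    rw [hterm, Finset.mul_sum]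
    apply Finset.sum_congr rfl
    intro j _
    simp only
    rw [C_mul_monomial, C_mul_monomial, mul_one]
  · rintro ⟨u, v⟩ _ ⟨u', v'⟩ _ h
    simp only [Prod.mk.injEq, Nat.add_right_cancel_iff] at h
    obtain ⟨rfl, rfl⟩ := h
    rfl

lemma choose_odd_iff : ∀ n k : ℕ, Nat.choose n k % 2 = 1 ↔ ∀ t, k.testBit t = true → n.testBit t = true := by
  intro n
  induction n using Nat.strong_induction_on with
  | _ n ih =>
    intro k
    rcases Nat.eq_zero_or_pos n with rfl | hn
    · rcases Nat.eq_zero_or_pos k with rfl | hk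
      · simp
      · rw [Nat.choose_eq_zero_of_lt hk]
        simp only [Nat.zero_mod, zero_ne_one, Nat.zero_testBit, Bool.false_eq_true, imp_false, false_iff, not_forall, not_not]
        by_contra hc
        push Not at hc
        have : k = 0 := Nat.zero_of_testBit_eq_false (fun i => by simpa using hc i)
        omega
    · have h1 : n.choose k % 2 = ((n % 2).choose (k % 2) * (n / 2).choose (k / 2)) % 2 :=
        Choose.choose_modEq_choose_mod_mul_choose_div_nat (p := 2)
      have h2 := ih (n / 2) (by omega) (k / 2)
      have h3 : (∀ t, k.testBit t = true → n.testBit t = true) ↔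
          (k.testBit 0 = true → n.testBit 0 = true) ∧
          ∀ t, (k / 2).testBit t = true → (n / 2).testBit t = true := by
        constructor
        · intro h
          refine ⟨h 0, fun t ht => ?_⟩
          rw [Nat.testBit_div_two] at ht ⊢
          exact h _ ht
        · rintro ⟨h, h'⟩ t ht
          cases t with
          | zero => exact h ht
          | succ t =>
            have := h' t
            rw [Nat.testBit_div_two, Nat.testBit_div_two] at this
            exact this ht
      rw [h3, ← h2, h1]
      have hn2 : n % 2 = 0 ∨ n % 2 = 1 := by omega
      have hk2 : k % 2 = 0 ∨ k % 2 = 1 := by omega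
      simp only [Nat.testBit_zero, decide_eq_true_eq]
      rcases hn2 with e1 | e1 <;> rcases hk2 with e2 | e2 <;> simp [e1, e2]

lemma natDegree_GG {F : Type*} [Field F] (g : F[X]) : (GG g).natDegree = g.natDegree := by
  have h1 : ((g.map C).comp ((X : F[X][X]) + C X)).natDegree = g.natDegree := by
    rw [natDegree_comp, natDegree_X_add_C, mul_one, natDegree_map_eq_of_injective C_injective]
  rcases Nat.eq_zero_or_pos g.natDegree with h0 | h0
  · rw [h0]
    rw [h0] at h1
    rw [GG]
    have := natDegree_add_le ((g.map C).comp ((X : F[X][X]) + C X)) (C g)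
    rw [h1, natDegree_C] at this
    simpa using this
  · rw [GG, natDegree_add_C, h1]

lemma block_of {R : Type*} [CommRing R] (G : R[X]) (y0 P0 N0 κ : ℕ) (hκ : 1 ≤ κ) (hG : G.natDegree = 2 ^ κ)
    (hodd : y0 % 2 = 1) (h2 : 2 * y0 ≤ 2 ^ P0) (hN : 2 * N0 + 1 = y0 + 2 ^ P0)
    (hc : (G ^ (2 ^ P0 + y0)).coeff (2 ^ κ * 2 ^ P0 + N0) ≠ 0) :
    Block G (2 ^ P0 + y0) (2 ^ κ * 2 ^ P0 + N0) (P0 + κ + 1) := by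
  have e : (2:ℕ) ^ (P0 + κ + 1) = 2 * (2 ^ κ * 2 ^ P0) := by ring
  have hk : 2 ≤ 2 ^ κ := by
    calc 2 = 2 ^ 1 := by norm_num
      _ ≤ 2 ^ κ := Nat.pow_le_pow_right (by norm_num) hκ
  have hm : 2 * 2 ^ P0 ≤ 2 ^ κ * 2 ^ P0 := Nat.mul_le_mul_right _ hk
  have heven : 2 ^ P0 % 2 = 0 := by omega
  refine ⟨by omega, by omega, by omega, by omega, ?_, ?_, hc⟩
  · intro t ht
    have e2 : 2 * (2 ^ κ * 2 ^ P0 + N0) + 1 = 2 ^ (P0 + κ + 1) * 1 + (2 ^ P0 + y0) := by omega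
    rw [e2, Nat.testBit_two_pow_mul_add _ (by omega), if_pos]
    · exact ht
    · by_contra hlt
      have := Nat.ge_two_pow_of_testBit ht
      have h3 : 2 ^ (P0 + κ + 1) ≤ 2 ^ t := Nat.pow_le_pow_right (by norm_num) (by omega)
      omega
  · rw [hG, e, mul_add]
    have : 2 ^ κ * (2 * y0) ≤ 2 ^ κ * 2 ^ P0 := Nat.mul_le_mul_left _ h2
    have e3 : 2 ^ κ * (2 * y0) = 2 * (2 ^ κ * y0) := by ring
    omega

/-- data for case c -/
structure CC {F : Type*} [Field F] (g : F[X]) (κ e : ℕ) : Prop where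
  deg : g.natDegree = 2 ^ κ
  lt : e < 2 ^ κ
  pos : 0 < e
  ce : g.coeff e ≠ 0
  big : ∀ i, e < i → g.coeff i ≠ 0 → ∃ v, i = 2 ^ v

lemma CC.mem {F : Type*} [Field F] {g : F[X]} {κ e : ℕ} (h : CC g κ e) {i j : ℕ} (hm : (i, j) ∈ SS g) :
    1 ≤ j ∧ j ≤ i ∧ i ≤ 2 ^ κ ∧ (i ≤ e ∨ ∃ v, i = 2 ^ v ∧ j = 2 ^ v ∧ e < i) := by
  rw [mem_SS] at hm
  obtain ⟨h1, h2, h3, h4⟩ := hm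
  refine ⟨h2, h3, ?_, ?_⟩
  · rw [← h.deg]; exact le_natDegree_of_ne_zero h1
  · rcases le_or_gt i e with hle | hlt
    · exact Or.inl hle
    · right
      obtain ⟨v, rfl⟩ := h.big i hlt h1
      refine ⟨v, rfl, ?_, hlt⟩
      by_contra hne
      have := Nat.prime_two.dvd_choose_pow (n := v) (k := j) (by omega) hne
      omega

lemma CC.block {F : Type*} [Field F] [CharP F 2] {g : F[X]} {κ e : ℕ} (h : CC g κ e) {r : ℕ}
    (τ : Fin r → ℕ) (P0 N0 : ℕ) (j0 : Fin r → ℕ) (hodd : (∑ t, 2 ^ τ t) % 2 = 1)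
    (h2 : 2 * (∑ t, 2 ^ τ t) ≤ 2 ^ P0) (hN : 2 * N0 + 1 = (∑ t, 2 ^ τ t) + 2 ^ P0)
    (hj0 : ∀ t, (e, j0 t) ∈ SS g) (hjN : ∑ t, j0 t * 2 ^ τ t = N0)
    (huniq : ∀ i j : Fin r → ℕ, (∀ t, (i t, j t) ∈ SS g) → ∑ t, j t * 2 ^ τ t = N0 →
      ∑ t, i t * 2 ^ τ t = e * ∑ t, 2 ^ τ t → ∀ t, i t = e ∧ j t = j0 t) :
    P0 + κ + 1 ∈ BlockLen (GG g) := by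
  have hκ : 1 ≤ κ := by
    rcases Nat.eq_zero_or_pos κ with rfl | hk
    · have := h.lt; have := h.pos; simp at *; omega
    · exact hk
  set y0 := ∑ t, 2 ^ τ t with hy0
  have hδS : ((2 ^ κ, 2 ^ κ) : ℕ × ℕ) ∈ SS g := by
    rw [mem_SS]
    refine ⟨?_, Nat.one_le_two_pow, le_refl _, by simp⟩
    rw [← h.deg]
    intro hz
    rw [coeff_natDegree, leadingCoeff_eq_zero] at hz
    exact h.ce (by rw [hz]; simp)
  have hIJ : ∀ p ∈ SS g, p.1 - p.2 + p.2 = p.1 := by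
    rintro ⟨i, j⟩ hp
    have := (h.mem hp).2.1
    simp only; omega
  refine ⟨_, _, block_of (GG g) y0 P0 N0 κ hκ (by rw [natDegree_GG, h.deg]) hodd h2 hN ?_⟩
  rw [GG_eq]
  have key := coeff_unique (F := F) (Fin.cons P0 τ : Fin (r + 1) → ℕ) (SS g) (fun p => p.2) (fun p => p.1 - p.2)
    (fun p => g.coeff p.1) (fun p hp => ((mem_SS _ _ _).mp hp).1)
    (2 ^ κ * 2 ^ P0 + N0) (∑ t, (e - j0 t) * 2 ^ τ t)
    (Fin.cons (2 ^ κ, 2 ^ κ) (fun t => (e, j0 t)))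
  have e1 : ∑ i, 2 ^ (Fin.cons P0 τ : Fin (r + 1) → ℕ) i = 2 ^ P0 + y0 := by
    rw [Fin.sum_univ_succ]; simp [hy0]
  rw [e1] at key
  apply key
  · intro i
    refine Fin.cases ?_ (fun t => ?_) i
    · simpa using hδS
    · simpa using hj0 t
  · rw [Fin.sum_univ_succ]; simp [hjN]
  · rw [Fin.sum_univ_succ]; simp
  · intro φ hφ hJ hI
    rw [Fin.sum_univ_succ] at hJ hI
    simp only [Fin.cons_zero, Fin.cons_succ] at hJ hI
    have hs : (φ 0).1 * 2 ^ P0 + ∑ t : Fin r, (φ t.succ).1 * 2 ^ τ t = 2 ^ κ * 2 ^ P0 + e * y0 := by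
      have s1 : ∑ t : Fin r, (φ t.succ).1 * 2 ^ τ t = ∑ t : Fin r, ((φ t.succ).1 - (φ t.succ).2) * 2 ^ τ t
          + ∑ t : Fin r, (φ t.succ).2 * 2 ^ τ t := by
        rw [← Finset.sum_add_distrib]
        apply Finset.sum_congr rfl
        intro t _
        rw [← add_mul, hIJ _ (hφ _)]
      have s2 : e * y0 = ∑ t, (e - j0 t) * 2 ^ τ t + N0 := by
        rw [← hjN, ← Finset.sum_add_distrib, hy0, Finset.mul_sum]
        apply Finset.sum_congr rfl
        intro t _
        rw [← add_mul, Nat.sub_add_cancel (h.mem (hj0 t)).2.1]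
      have s3 : (φ 0).1 * 2 ^ P0 = ((φ 0).1 - (φ 0).2) * 2 ^ P0 + (φ 0).2 * 2 ^ P0 := by
        rw [← add_mul, hIJ _ (hφ _)]
      omega
    have hle : ∑ t : Fin r, (φ t.succ).1 * 2 ^ τ t ≤ 2 ^ κ * y0 := by
      rw [hy0, Finset.mul_sum]
      apply Finset.sum_le_sum
      intro t _
      exact Nat.mul_le_mul_right _ (h.mem (hφ t.succ)).2.2.1
    have h0 := h.mem (hφ 0)
    have hlt := h.lt
    have hpos := h.pos
    have hfst : (φ 0).1 = 2 ^ κ := by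
      by_contra hne
      obtain ⟨c1, c2, c3, c4⟩ := h0
      set i0 := (φ 0).1
      have c5 : i0 < 2 ^ κ := by omega
      have hy : 1 ≤ y0 := by omega
      rcases c4 with c4 | ⟨v, c6, -, c7⟩
      · obtain ⟨z, hz⟩ := Nat.exists_eq_add_of_lt hlt
        have : i0 * 2 ^ P0 ≤ e * 2 ^ P0 := Nat.mul_le_mul_right _ c4
        rw [hz] at hle hs
        nlinarith
      · have hv : v < κ := by
          rw [c6] at c5
          exact (Nat.pow_lt_pow_iff_right (by norm_num)).mp c5
        have : 2 * i0 ≤ 2 ^ κ := by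
          rw [c6, ← pow_succ']
          exact Nat.pow_le_pow_right (by norm_num) hv
        have t1 : 2 * i0 * 2 ^ P0 ≤ 2 ^ κ * 2 ^ P0 := Nat.mul_le_mul_right _ this
        have t2 : 2 ^ κ * (2 * y0) ≤ 2 ^ κ * 2 ^ P0 := Nat.mul_le_mul_left _ h2
        have t3 : 0 < e * y0 := Nat.mul_pos hpos hy
        nlinarith
    have hsnd : (φ 0).2 = 2 ^ κ := by
      obtain ⟨c1, c2, c3, c4⟩ := h0
      rcases c4 with c4 | ⟨v, c6, c7, -⟩
      · omega
      · rw [c7, ← c6, hfst]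
    rw [hsnd] at hJ
    rw [hfst] at hs
    have hu := huniq (fun t => (φ t.succ).1) (fun t => (φ t.succ).2) (fun t => hφ _) (by omega) (by omega)
    funext t
    refine Fin.cases ?_ (fun t => ?_) t
    · simp only [Fin.cons_zero]
      exact Prod.ext hfst hsnd
    · simp only [Fin.cons_succ]
      exact Prod.ext (hu t).1 (hu t).2

lemma CC.single {F : Type*} [Field F] [CharP F 2] {g : F[X]} {κ e : ℕ} (h : CC g κ e) (p : ℕ)
    (hp : e.testBit p = true) : p + 1 + κ + 1 ∈ BlockLen (GG g) := by
  refine h.block (r := 1) (fun _ => 0) (p + 1) (2 ^ p) (fun _ => 2 ^ p) (by simp) ?_ ?_ ?_ (by simp) ?_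
  · have : 1 ≤ 2 ^ p := Nat.one_le_two_pow
    simp [pow_succ]; omega
  · simp [pow_succ]; ring
  · intro _
    rw [mem_SS]
    refine ⟨h.ce, Nat.one_le_two_pow, Nat.ge_two_pow_of_testBit hp, ?_⟩
    rw [choose_odd_iff]
    intro t ht
    rw [Nat.testBit_two_pow] at ht
    simp at ht
    rw [← ht]; exact hp
  · intro i j _ h2 h3 t
    simp at h2 h3
    have : t = 0 := Subsingleton.elim _ _
    rw [this]
    exact ⟨h3, h2⟩

lemma CC.base {F : Type*} [Field F] [CharP F 2] {g : F[X]} {κ e : ℕ} (h : CC g κ e) :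
    κ + 1 ∈ BlockLen (GG g) := by
  apply Reach.block
  · rw [natDegree_GG, h.deg]
    have := h.lt; have := h.pos; omega
  · rw [natDegree_GG, h.deg]
    have := (Reach.start (2 ^ κ)).half_iter κ
    rwa [Nat.div_self (by positivity), add_comm] at this

lemma div_gap (j s u : ℕ) (hsu : s ≤ u) (h : ∀ t, s ≤ t → t < u → j.testBit t = false) :
    j / 2 ^ s = 2 ^ (u - s) * (j / 2 ^ u) := by
  have h1 : (j / 2 ^ s) % 2 ^ (u - s) = 0 := by
    apply Nat.zero_of_testBit_eq_false
    intro i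
    rw [Nat.testBit_mod_two_pow, Nat.testBit_div_two_pow]
    by_cases hi : i < u - s
    · simp [hi, h (i + s) (by omega) (by omega)]
    · simp [hi]
  have h2 := Nat.div_add_mod (j / 2 ^ s) (2 ^ (u - s))
  rw [h1, add_zero, Nat.div_div_eq_div_mul, ← pow_add, show s + (u - s) = u by omega] at h2
  exact h2.symm

lemma div_digit (j s : ℕ) : ∃ α ≤ 1, j / 2 ^ s = 2 * (j / 2 ^ (s + 1)) + α := by
  refine ⟨j / 2 ^ s % 2, by omega, ?_⟩
  rw [pow_succ, ← Nat.div_div_eq_div_mul]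
  omega

lemma digits_two (j p d : ℕ) (hd : 1 ≤ d) (h0 : ∀ t < p, j.testBit t = false)
    (h1 : ∀ t, p < t → t < p + d → j.testBit t = false) (h2 : j.testBit (p + d + 1) = false) :
    ∃ α ≤ 1, ∃ β ≤ 1, ∃ γ, j = 2 ^ p * (α + 2 ^ d * β + 4 * 2 ^ d * γ) := by
  obtain ⟨α, hα, e1⟩ := div_digit j p
  obtain ⟨β, hβ, e2⟩ := div_digit j (p + d)
  have g0 := div_gap j 0 p (by omega) (fun t _ ht => h0 t ht)
  have g1 := div_gap j (p + 1) (p + d) (by omega) (fun t ht ht' => h1 t (by omega) ht')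
  have g2 := div_gap j (p + d + 1) (p + d + 1 + 1) (by omega) (fun t ht ht' => by
    have : t = p + d + 1 := by omega
    rw [this]; exact h2)
  refine ⟨α, hα, β, hβ, j / 2 ^ (p + d + 1 + 1), ?_⟩
  simp only [pow_zero, Nat.div_one, Nat.sub_zero] at g0
  rw [show p + d + 1 + 1 - (p + d + 1) = 1 by omega, pow_one] at g2
  rw [show p + d - (p + 1) = d - 1 by omega] at g1
  have e3 : (2:ℕ) ^ d = 2 * 2 ^ (d - 1) := by rw [← pow_succ']; congr 1; omega
  calc j = 2 ^ p * (j / 2 ^ p) := g0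
    _ = _ := by rw [e1, g1, e2, g2, e3]; ring

/-- arithmetic uniqueness, main case -/
lemma num_main (A D : ℕ) (hA : 2 ≤ A) (hD : 4 ≤ D) (hD2 : D % 2 = 0)
    (α₀ β₀ γ₀ α₁ β₁ γ₁ α₂ β₂ γ₂ : ℕ) (hα₀ : α₀ ≤ 1) (hβ₀ : β₀ ≤ 1) (hα₁ : α₁ ≤ 1) (hβ₁ : β₁ ≤ 1)
    (hα₂ : α₂ ≤ 1) 
    (h1 : 1 ≤ α₁ + D * β₁ + 4 * D * γ₁) (h2 : 1 ≤ α₂ + D * β₂ + 4 * D * γ₂)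
    (heq : (α₀ + D * β₀ + 4 * D * γ₀) + 2 * A * (α₁ + D * β₁ + 4 * D * γ₁) +
      2 * (A * D) * (α₂ + D * β₂ + 4 * D * γ₂) = 1 + D + 4 * (A * D)) (hne : D ≠ 2 * A)
    (hspec : α₀ = 1 → α₁ = 1 → β₁ = 0 → D * (β₀ + 4 * γ₀) + 2 * A = D + 2 * (A * D) → False) :
    (α₀ = 1 ∧ β₀ = 1 ∧ γ₀ = 0) ∧ (α₁ = 0 ∧ β₁ = 1 ∧ γ₁ = 0) ∧ (α₂ = 1 ∧ β₂ = 0 ∧ γ₂ = 0) := by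
  have hAD : 8 ≤ A * D := by nlinarith
  have hAD2 : 2 * D ≤ A * D := Nat.mul_le_mul_right _ hA
  have hAD4 : A * D * 4 ≤ A * D * D := Nat.mul_le_mul_left _ hD
  have b2 : β₂ = 0 := by
    by_contra hc
    have : 1 ≤ β₂ := by omega
    have : A * D * D * 1 ≤ A * D * D * β₂ := Nat.mul_le_mul_left _ this
    nlinarith [Nat.zero_le (A * D * α₂), Nat.zero_le (A * D * D * γ₂), Nat.zero_le (A * (α₁ + D * β₁ + 4 * D * γ₁)), Nat.zero_le (D * β₀), Nat.zero_le (D * γ₀)]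
  have c2 : γ₂ = 0 := by
    by_contra hc
    have : 1 ≤ γ₂ := by omega
    have : A * D * D * 1 ≤ A * D * D * γ₂ := Nat.mul_le_mul_left _ this
    nlinarith [Nat.zero_le (A * D * α₂), Nat.zero_le (A * D * D * β₂), Nat.zero_le (A * (α₁ + D * β₁ + 4 * D * γ₁)), Nat.zero_le (D * β₀), Nat.zero_le (D * γ₀)]
  subst b2 c2
  have a2 : α₂ = 1 := by simp at h2; omega
  subst a2
  have c1 : γ₁ = 0 := by
    by_contra hc
    have : 1 ≤ γ₁ := by omega
    have : A * D * 1 ≤ A * D * γ₁ := Nat.mul_le_mul_left _ this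
    nlinarith [Nat.zero_le (A * D * β₁), Nat.zero_le (A * α₁), Nat.zero_le (D * β₀), Nat.zero_le (D * γ₀)]
  subst c1
  have a0 : α₀ = 1 := by
    obtain ⟨D', rfl⟩ : ∃ D', D = 2 * D' := ⟨D / 2, by omega⟩
    by_contra hc
    have : α₀ = 0 := by omega
    subst this
    have := congrArg (· % 2) heq
    ring_nf at this
    omega
  subst a0
  refine ⟨?_, ?_, rfl, rfl, rfl⟩ <;>
  · have heq' : D * (β₀ + 4 * γ₀) + 2 * A * α₁ + 2 * (A * D) * β₁ = D + 2 * (A * D) := by nlinarith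
    rcases (show α₁ = 0 ∨ α₁ = 1 by omega) with rfl | rfl
    · rcases (show β₁ = 0 ∨ β₁ = 1 by omega) with rfl | rfl
      · simp at h1
      · have : D * (β₀ + 4 * γ₀) = D * 1 := by omega
        have := Nat.eq_of_mul_eq_mul_left (by omega) this
        refine ⟨by omega, by omega, by omega⟩
    · exfalso
      rcases (show β₁ = 0 ∨ β₁ = 1 by omega) with rfl | rfl
      · exact hspec rfl rfl rfl (by omega)
      · rcases Nat.eq_zero_or_pos (β₀ + 4 * γ₀) with hz | hz
        · rw [hz] at heq'; omega
        · have : D * 1 ≤ D * (β₀ + 4 * γ₀) := Nat.mul_le_mul_left _ hz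
          omega

lemma num_second (A : ℕ) (hA : 2 ≤ A)
    (α₀ β₀ γ₀ α₁ β₁ γ₁ : ℕ) (hα₀ : α₀ ≤ 1) (hβ₀ : β₀ ≤ 1) (hα₁ : α₁ ≤ 1)
    (h1 : 1 ≤ α₁ + 2 * A * β₁ + 4 * (2 * A) * γ₁)
    (heq : (α₀ + 2 * A * β₀ + 4 * (2 * A) * γ₀) + 2 * A * (α₁ + 2 * A * β₁ + 4 * (2 * A) * γ₁) = 1 + 4 * A) :
    (α₀ = 1 ∧ β₀ = 1 ∧ γ₀ = 0) ∧ (α₁ = 1 ∧ β₁ = 0 ∧ γ₁ = 0) := by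
  have hAA : 2 * A ≤ A * A := Nat.mul_le_mul_right _ hA
  have b1 : β₁ = 0 := by
    by_contra hc
    have : A * A * 1 ≤ A * A * β₁ := Nat.mul_le_mul_left _ (by omega)
    nlinarith [Nat.zero_le (A * α₁), Nat.zero_le (A * A * γ₁), Nat.zero_le (A * β₀), Nat.zero_le (A * γ₀)]
  have c1 : γ₁ = 0 := by
    by_contra hc
    have : A * A * 1 ≤ A * A * γ₁ := Nat.mul_le_mul_left _ (by omega)
    nlinarith [Nat.zero_le (A * α₁), Nat.zero_le (A * A * β₁), Nat.zero_le (A * β₀), Nat.zero_le (A * γ₀)]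
  subst b1 c1
  have a1 : α₁ = 1 := by simp at h1; omega
  subst a1
  have c0 : γ₀ = 0 := by
    by_contra hc
    have : A * 1 ≤ A * γ₀ := Nat.mul_le_mul_left _ (by omega)
    nlinarith [Nat.zero_le (A * β₀)]
  subst c0
  rcases (show β₀ = 0 ∨ β₀ = 1 by omega) with rfl | rfl
  · omega
  · refine ⟨⟨by omega, rfl, rfl⟩, rfl, rfl, rfl⟩

lemma dvd_one_of {m a b : ℕ} (hm : 2 ≤ m) (h1 : m ∣ a) (h2 : m ∣ b) (h : b = a + 1) : False := by
  have := (Nat.dvd_add_right h1).mp (h ▸ h2)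
  have := Nat.le_of_dvd (by norm_num) this
  omega

set_option maxHeartbeats 2000000 in
lemma CC.excl {F : Type*} [Field F] [CharP F 2] {g : F[X]} {κ e : ℕ} (h : CC g κ e) 
    (m : ℕ) (hm : 2 ≤ m) (hκ : m ∣ κ + 1) (hb : ∀ t, e.testBit t = true → m ∣ t + 1)
    (p d : ℕ) (hd0 : 1 ≤ d) (hp : e.testBit p = true) (hpd : e.testBit (p + d) = true)
    (hlow : ∀ t < p, e.testBit t = false) (hmid : ∀ t, p < t → t < p + d → e.testBit t = false) :
    ∃ P ∈ BlockLen (GG g), ¬ m ∣ P := by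
  have m1 := hb p hp
  have m2 := hb _ hpd
  have hp1 : 1 ≤ p := by
    have := Nat.le_of_dvd (by omega) m1
    omega
  have hd : 2 ≤ d := by
    rw [show p + d + 1 = (p + 1) + d by ring] at m2
    have := Nat.le_of_dvd (by omega) ((Nat.dvd_add_right m1).mp m2)
    omega
  obtain ⟨A, hAdef⟩ : ∃ A, A = 2 ^ p := ⟨_, rfl⟩
  obtain ⟨D, hDdef⟩ : ∃ D, D = 2 ^ d := ⟨_, rfl⟩
  have hA : 2 ≤ A := by
    rw [hAdef]; calc 2 = 2 ^ 1 := by norm_num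
      _ ≤ 2 ^ p := Nat.pow_le_pow_right (by norm_num) hp1
  have hD : 4 ≤ D := by
    rw [hDdef]; calc 4 = 2 ^ 2 := by norm_num
      _ ≤ 2 ^ d := Nat.pow_le_pow_right (by norm_num) hd
  have hD2 : D % 2 = 0 := by
    rw [hDdef, show d = (d - 1) + 1 by omega, pow_succ]; omega
  have hAD : 8 ≤ A * D := by nlinarith
  have hAD2 : 2 * D ≤ A * D := Nat.mul_le_mul_right _ hA
  have hAD4 : A * 4 ≤ A * D := Nat.mul_le_mul_left _ hD
  have hB : 2 ^ (p + d) = A * D := by rw [pow_add, hAdef, hDdef]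
  have sA : (e, A) ∈ SS g := by
    have : e.choose A % 2 = 1 := by
      rw [choose_odd_iff]
      intro t ht
      rw [hAdef, Nat.testBit_two_pow] at ht
      simp at ht; rw [← ht]; exact hp
    rw [mem_SS]
    refine ⟨h.ce, by omega, ?_, this⟩
    by_contra hlt
    rw [Nat.choose_eq_zero_of_lt (by omega)] at this
    omega
  have sB : (e, A * D) ∈ SS g := by
    have : e.choose (A * D) % 2 = 1 := by
      rw [choose_odd_iff]
      intro t ht
      rw [← hB, Nat.testBit_two_pow] at ht
      simp at ht; rw [← ht]; exact hpd
    rw [mem_SS]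
    refine ⟨h.ce, by omega, ?_, this⟩
    by_contra hlt
    rw [Nat.choose_eq_zero_of_lt (by omega)] at this
    omega
  have sAB : (e, A + A * D) ∈ SS g := by
    have : e.choose (A + A * D) % 2 = 1 := by
      rw [choose_odd_iff]
      intro t ht
      rw [← hB, show A + 2 ^ (p + d) = 2 ^ (p + d) * 1 + A by ring, Nat.testBit_two_pow_mul_add _ (by omega)] at ht
      split_ifs at ht with hlt
      · rw [hAdef, Nat.testBit_two_pow] at ht
        simp at ht; rw [← ht]; exact hp
      · rw [Nat.testBit_one_eq_true_iff_self_eq_zero] at ht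
        rw [show t = p + d by omega]; exact hpd
    rw [mem_SS]
    refine ⟨h.ce, by omega, ?_, this⟩
    by_contra hlt
    rw [Nat.choose_eq_zero_of_lt (by omega)] at this
    omega
  have heAB : A + A * D ≤ e := (h.mem sAB).2.1
  have hbig : ∀ i j, (i, j) ∈ SS g → i ≤ e ∨ ∃ c, 1 ≤ c ∧ j = 2 * (A * D) * c := by
    intro i j hij
    rcases (h.mem hij).2.2.2 with h1 | ⟨v, h1, h2, h3⟩
    · exact Or.inl h1
    · right
      have : 2 ^ (p + d) < 2 ^ v := by omega
      have hv := (Nat.pow_lt_pow_iff_right (by norm_num)).mp this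
      refine ⟨2 ^ (v - (p + d + 1)), Nat.one_le_two_pow, ?_⟩
      rw [h2, ← hB, ← pow_succ', ← pow_add]
      congr 1; omega
  have hdig : ∀ j, (e, j) ∈ SS g → ∃ α ≤ 1, ∃ β ≤ 1, ∃ γ, j = A * (α + D * β + 4 * D * γ) := by
    intro j hj
    have hsub := (choose_odd_iff e j).mp ((mem_SS _ _ _).mp hj).2.2.2
    have hf : ∀ t, e.testBit t = false → j.testBit t = false := by
      intro t ht
      by_contra hc
      rw [hsub t (by simpa using hc)] at ht
      simp at ht
    rw [hAdef, hDdef]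
    apply digits_two j p d hd0
    · intro t ht; exact hf t (hlow t ht)
    · intro t ht ht'; exact hf t (hmid t ht ht')
    · apply hf
      by_contra hc
      exact dvd_one_of hm m2 (hb (p + d + 1) (by simpa using hc)) (by ring)
  have pA : 2 ^ (p + 1) = 2 * A := by rw [pow_succ', hAdef]
  have pB : 2 ^ (p + d + 1) = 2 * (A * D) := by rw [pow_succ', hB]
  by_cases hcase : d = p + 1
  · have hDA : D = 2 * A := by rw [hDdef, hcase, pA]
    have hP : 2 ^ (p + 1 + (p + 1) + 1) = 8 * (A * A) := by rw [pow_succ, pow_add, pA]; ring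
    have hAA : 2 * A ≤ A * A := Nat.mul_le_mul_right _ hA
    refine ⟨p + 1 + (p + 1) + 1 + κ + 1, ?_, ?_⟩
    · apply h.block (r := 2) ![0, p + 1] (p + 1 + (p + 1) + 1) (A + 4 * (A * A)) ![A + A * D, A]
      · simp [Fin.sum_univ_succ, pA]
      · simp [Fin.sum_univ_succ, pA, hP]; omega
      · simp [Fin.sum_univ_succ, pA, hP]; ring
      · intro t; fin_cases t
        · simpa using sAB
        · simpa using sA
      · simp [Fin.sum_univ_succ, pA, hDA]; ring
      · intro i j hij hj hi
        simp [Fin.sum_univ_succ, pA] at hj hi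
        have s0 := hij 0
        have s1 := hij 1
        have key : (i 0 = e ∧ j 0 = A + A * D) ∧ (i 1 = e ∧ j 1 = A) := by
          have t1 := (h.mem s1).1
          have u0 : i 0 ≤ e := by
            rcases hbig _ _ s0 with hh | ⟨c, hc, hh⟩
            · exact hh
            · exfalso
              rw [hh] at hj
              have : A * (2 * (D * c + j 1)) = A * (1 + 4 * A) := by linarith
              have := Nat.eq_of_mul_eq_mul_left (by omega) this
              omega
          have u1 : i 1 ≤ e := by
            rcases hbig _ _ s1 with hh | ⟨c, hc, hh⟩
            · exact hh
            · exfalso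
              rw [hh, hDA] at hj
              have w1 : A * A * 2 ≤ A * A * A := Nat.mul_le_mul_left _ hA
              have w2 : A * A * A * 1 ≤ A * A * A * c := Nat.mul_le_mul_left _ hc
              nlinarith
          have hsum : i 0 + 2 * A * i 1 = e + 2 * A * e := by linarith
          have v1 : i 1 = e := by
            by_contra hne
            have : 2 * A * (i 1) < 2 * A * e := Nat.mul_lt_mul_of_pos_left (by omega) (by omega)
            omega
          have v0 : i 0 = e := by rw [v1] at hsum; omega
          rw [v0] at s0
          rw [v1] at s1
          obtain ⟨α₀, ha0, β₀, hb0, γ₀, e0⟩ := hdig _ s0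
          obtain ⟨α₁, ha1, β₁, hb1, γ₁, e1⟩ := hdig _ s1
          rw [hDA] at e0 e1
          have q1 : 1 ≤ α₁ + 2 * A * β₁ + 4 * (2 * A) * γ₁ := by
            by_contra hc
            rw [show α₁ + 2 * A * β₁ + 4 * (2 * A) * γ₁ = 0 by omega] at e1
            omega
          have q2 : A * ((α₀ + 2 * A * β₀ + 4 * (2 * A) * γ₀) + 2 * A * (α₁ + 2 * A * β₁ + 4 * (2 * A) * γ₁)) =
              A * (1 + 4 * A) := by
            rw [e0, e1] at hj
            linarith
          obtain ⟨⟨r1, r2, r3⟩, r4, r5, r6⟩ := num_second A hA α₀ β₀ γ₀ α₁ β₁ γ₁ ha0 hb0 ha1 q1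
            (Nat.eq_of_mul_eq_mul_left (by omega) q2)
          refine ⟨⟨v0, ?_⟩, v1, ?_⟩
          · rw [e0, r1, r2, r3, hDA]; ring
          · rw [e1, r4, r5, r6]; ring
        intro t
        fin_cases t
        · simpa using key.1
        · simpa using key.2
    · intro hc
      rw [add_assoc _ κ 1] at hc
      exact dvd_one_of hm (dvd_add m1 m1) ((Nat.dvd_add_left hκ).mp hc) rfl
  · have hDA : D ≠ 2 * A := by
      rw [hDdef, ← pA]
      intro hc
      exact hcase (Nat.pow_right_injective (le_refl 2) hc)
    have hP : 2 ^ (p + 1 + (p + d + 1) + 1) = 8 * (A * (A * D)) := by rw [pow_succ, pow_add, pA, pB]; ring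
    have hAAD : 2 * (A * D) ≤ A * (A * D) := Nat.mul_le_mul_right _ hA
    refine ⟨p + 1 + (p + d + 1) + 1 + κ + 1, ?_, ?_⟩
    · apply h.block (r := 3) ![0, p + 1, p + d + 1] (p + 1 + (p + d + 1) + 1) (A + A * D + 4 * (A * (A * D)))
        ![A + A * D, A * D, A]
      · simp [Fin.sum_univ_succ, pA, pB]; omega
      · simp [Fin.sum_univ_succ, pA, pB, hP]; omega
      · simp [Fin.sum_univ_succ, pA, pB, hP]; ring
      · intro t; fin_cases t
        · simpa using sAB
        · simpa using sB
        · simpa using sA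
      · simp [Fin.sum_univ_succ, pA, pB]; ring
      · intro i j hij hj hi
        simp [Fin.sum_univ_succ, pA, pB] at hj hi
        have s0 := hij 0
        have s1 := hij 1
        have s2 := hij 2
        have key : (i 0 = e ∧ j 0 = A + A * D) ∧ (i 1 = e ∧ j 1 = A * D) ∧ (i 2 = e ∧ j 2 = A) := by
          have t1 := (h.mem s1).1
          have t2 := (h.mem s2).1
          have u0 : i 0 ≤ e := by
            rcases hbig _ _ s0 with hh | ⟨c, hc, hh⟩
            · exact hh
            · exfalso
              rw [hh] at hj
              have : A * (2 * (D * c + j 1 + D * j 2)) = A * (1 + D + 4 * (A * D)) := by linarith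
              have := Nat.eq_of_mul_eq_mul_left (by omega) this
              omega
          have u1 : i 1 ≤ e := by
            rcases hbig _ _ s1 with hh | ⟨c, hc, hh⟩
            · exact hh
            · exfalso
              rw [hh] at hj
              have w2 : A * (A * D) * 1 ≤ A * (A * D) * c := Nat.mul_le_mul_left _ hc
              have w3 : A * D * 1 ≤ A * D * j 2 := Nat.mul_le_mul_left _ t2
              nlinarith
          have u2 : i 2 ≤ e := by
            rcases hbig _ _ s2 with hh | ⟨c, hc, hh⟩
            · exact hh
            · exfalso
              rw [hh] at hj
              have w1 : A * (A * D) * 4 ≤ A * (A * D) * D := Nat.mul_le_mul_left _ hD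
              have w2 : A * (A * D) * D * 1 ≤ A * (A * D) * D * c := Nat.mul_le_mul_left _ hc
              linarith [Nat.zero_le (A * j 1), Nat.zero_le (j 0)]
          have hsum : i 0 + 2 * A * i 1 + 2 * (A * D) * i 2 = e + 2 * A * e + 2 * (A * D) * e := by linarith
          have l1 : 2 * A * (i 1) ≤ 2 * A * e := Nat.mul_le_mul_left _ u1
          have l2 : 2 * (A * D) * (i 2) ≤ 2 * (A * D) * e := Nat.mul_le_mul_left _ u2
          have v1 : i 1 = e := by
            by_contra hne
            have : 2 * A * (i 1) < 2 * A * e := Nat.mul_lt_mul_of_pos_left (by omega) (by omega)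
            omega
          have v2 : i 2 = e := by
            by_contra hne
            have : 2 * (A * D) * (i 2) < 2 * (A * D) * e := Nat.mul_lt_mul_of_pos_left (by omega) (by omega)
            omega
          have v0 : i 0 = e := by rw [v1, v2] at hsum; omega
          rw [v0] at s0
          rw [v1] at s1
          rw [v2] at s2
          obtain ⟨α₀, ha0, β₀, hb0, γ₀, e0⟩ := hdig _ s0
          obtain ⟨α₁, ha1, β₁, hb1, γ₁, e1⟩ := hdig _ s1
          obtain ⟨α₂, ha2, β₂, hb2, γ₂, e2⟩ := hdig _ s2
          have q1 : 1 ≤ α₁ + D * β₁ + 4 * D * γ₁ := by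
            by_contra hc
            rw [show α₁ + D * β₁ + 4 * D * γ₁ = 0 by omega] at e1
            omega
          have q2 : 1 ≤ α₂ + D * β₂ + 4 * D * γ₂ := by
            by_contra hc
            rw [show α₂ + D * β₂ + 4 * D * γ₂ = 0 by omega] at e2
            omega
          have q3 : A * ((α₀ + D * β₀ + 4 * D * γ₀) + 2 * A * (α₁ + D * β₁ + 4 * D * γ₁) +
              2 * (A * D) * (α₂ + D * β₂ + 4 * D * γ₂)) = A * (1 + D + 4 * (A * D)) := by
            rw [e0, e1, e2] at hj
            linarith
          have hspec : α₀ = 1 → α₁ = 1 → β₁ = 0 → D * (β₀ + 4 * γ₀) + 2 * A = D + 2 * (A * D) → False := by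
            intro z1 z2 z3 z4
            have hdvd : D ∣ 2 * A := by
              have d1 : D ∣ D + 2 * (A * D) := ⟨1 + 2 * A, by ring⟩
              rw [← z4] at d1
              exact (Nat.dvd_add_right (Dvd.intro _ rfl)).mp d1
            rw [hDdef, ← pA] at hdvd
            have hle := (Nat.pow_dvd_pow_iff_le_right (by norm_num)).mp hdvd
            have hle2 : D ≤ A := by
              rw [hDdef, hAdef]; exact Nat.pow_le_pow_right (by norm_num) (by omega)
            have ej : j 0 = 2 ^ (2 * p + 1) * (2 ^ d - 1) + (A + A * D) := by
              have : 2 ^ (2 * p + 1) = 2 * (A * A) := by rw [hAdef]; ring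
              rw [this, e0, z1, ← hDdef]
              obtain ⟨D', rfl⟩ : ∃ D', D = D' + 1 := ⟨D - 1, by omega⟩
              have : A * ((D' + 1) * (β₀ + 4 * γ₀) + 2 * A) = A * (D' + 1 + 2 * (A * (D' + 1))) := by rw [z4]
              simp only [Nat.add_sub_cancel]
              linarith
            have hlt : A + A * D < 2 ^ (2 * p + 1) := by
              have : 2 ^ (2 * p + 1) = 2 * (A * A) := by rw [hAdef]; ring
              rw [this]
              nlinarith
            have hsub := (choose_odd_iff e (j 0)).mp ((mem_SS _ _ _).mp s0).2.2.2
            have bit1 : (j 0).testBit (2 * p + 1) = true := by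
              rw [ej, Nat.testBit_two_pow_mul_add _ hlt, if_neg (by omega), Nat.testBit_two_pow_sub_one]
              simp; omega
            have bit2 : (j 0).testBit (2 * p + 1 + 1) = true := by
              rw [ej, Nat.testBit_two_pow_mul_add _ hlt, if_neg (by omega), Nat.testBit_two_pow_sub_one]
              simp; omega
            exact dvd_one_of hm (hb _ (hsub _ bit1)) (hb _ (hsub _ bit2)) rfl
          obtain ⟨⟨r1, r2, r3⟩, ⟨r4, r5, r6⟩, r7, r8, r9⟩ := num_main A D hA hD hD2 α₀ β₀ γ₀ α₁ β₁ γ₁ α₂ β₂ γ₂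
            ha0 hb0 ha1 hb1 ha2 q1 q2 (Nat.eq_of_mul_eq_mul_left (by omega) q3) hDA hspec
          refine ⟨⟨v0, ?_⟩, ⟨v1, ?_⟩, v2, ?_⟩
          · rw [e0, r1, r2, r3]; ring
          · rw [e1, r4, r5, r6]; ring
          · rw [e2, r7, r8, r9]; ring
        intro t
        fin_cases t
        · simpa using key.1
        · simpa using key.2.1
        · simpa using key.2.2
    · intro hc
      rw [add_assoc _ κ 1] at hc
      exact dvd_one_of hm (dvd_add m1 m2) ((Nat.dvd_add_left hκ).mp hc) rfl

theorem caseC {F : Type*} [Field F] [CharP F 2] {g : F[X]} {κ e : ℕ} (h : CC g κ e) (he : ∀ v, e ≠ 2 ^ v) :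
    ∃ n, ∀ P ≥ n, P ∈ BlockLen (GG g) := by
  classical
  apply blockLen_large
  intro m hm
  by_contra hall
  push Not at hall
  have hκ := hall _ h.base
  have hb : ∀ t, e.testBit t = true → m ∣ t + 1 := by
    intro t ht
    have := hall _ (h.single t ht)
    rw [add_assoc _ κ 1] at this
    exact (Nat.dvd_add_left hκ).mp this
  have ex1 : ∃ t, e.testBit t = true := by
    by_contra hc
    push Not at hc
    have := Nat.zero_of_testBit_eq_false (fun i => by simpa using hc i)
    have := h.pos
    omega
  have ex2 : ∃ t, Nat.find ex1 < t ∧ e.testBit t = true := by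
    by_contra hc
    push Not at hc
    apply he (Nat.find ex1)
    apply Nat.eq_of_testBit_eq
    intro i
    rw [Nat.testBit_two_pow]
    rcases lt_trichotomy i (Nat.find ex1) with hi | hi | hi
    · have := Nat.find_min ex1 hi
      simp only [Bool.not_eq_true] at this
      rw [this]; symm; simp; omega
    · rw [hi, Nat.find_spec ex1]; simp
    · have := hc i hi
      simp only [Bool.not_eq_true] at this
      rw [this]; symm; simp; omega
  obtain ⟨c1, c2⟩ := Nat.find_spec ex2
  obtain ⟨d, hd⟩ := Nat.exists_eq_add_of_lt c1
  rw [add_assoc] at hd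
  obtain ⟨P, hP, hP'⟩ := h.excl m hm hκ hb (Nat.find ex1) (d + 1) (by omega) (Nat.find_spec ex1) (by rw [← hd]; exact c2)
    (fun t ht => by simpa using Nat.find_min ex1 ht)
    (fun t ht ht' => by
      have := Nat.find_min ex2 (m := t) (by omega)
      push Not at this
      simpa using this ht)
  exact hP' (hall _ hP)

/-- arc condition outside the bad set -/
def GoodOn {E : Type*} [Field E] (f : E[X]) (Bd : Finset E) : Prop :=
  (∀ s ∉ Bd, ∀ x, x ≠ s → f.eval x ≠ f.eval s) ∧
  (∀ s ∉ Bd, ∀ x y, x ≠ s → y ≠ s → x ≠ y →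
      (f.eval x + f.eval s) * (y + s) ≠ (f.eval y + f.eval s) * (x + s))

lemma blockLen_map_contra {F E : Type*} [Field F] [Field E] [CharP E 2] [Fintype E] (ι : F →+* E)
    {H : ℕ} (hE : Fintype.card E = 2 ^ H) (g : F[X]) (Bd : Finset E)
    (hg : GoodOn (expand E 2 (g.map ι)) Bd)
    (hd : (expand E 2 (g.map ι)).natDegree * Bd.card < 2 ^ H - 1) (hbl : H ∈ BlockLen g) : False := by
  obtain ⟨y, N, hb⟩ := hbl
  refine block_contra hE (g.map ι) Bd hg.1 hg.2 hd (y := y) (N := N)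
    ⟨hb.odd, hb.lt, hb.lo, hb.hi, hb.sub, ?_, ?_⟩
  · rw [natDegree_map]; exact hb.deg
  · rw [← Polynomial.map_pow, coeff_map]
    exact (map_ne_zero ι).mpr hb.coe

lemma blockLen_GG_contra {F E : Type*} [Field F] [Field E] [CharP F 2] [CharP E 2] [Fintype E] (ι : F →+* E)
    {H : ℕ} (hE : Fintype.card E = 2 ^ H) (g : F[X]) (Bd : Finset E)
    (hg : GoodOn (expand E 2 (g.map ι)) Bd)
    (hd : (expand E 2 (g.map ι)).natDegree * Bd.card < 2 ^ H - 1) (hbl : H ∈ BlockLen (GG g)) : False := by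
  classical
  obtain ⟨y, N, hb⟩ := hbl
  have hTD : TD g.natDegree (GG g) := by
    rw [GG_eq]
    apply TD_sum
    rintro ⟨i, j⟩ hp
    rw [mem_SS] at hp
    have h1 : i ≤ g.natDegree := le_natDegree_of_ne_zero hp.1
    apply TD_of_coeff
    intro l
    rw [coeff_monomial]
    split_ifs with hl
    · right
      have := natDegree_monomial_le (g.coeff i) (m := i - j)
      simp only at hl ⊢
      omega
    · left; rfl
  have hΔ : (((GG g) ^ y).coeff N).natDegree < 2 ^ H := by
    have h1 := TD_pow hTD y
    have h2 := hb.deg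
    rw [natDegree_GG, mul_comm] at h2
    have h3 := (TD_coeff h1 N).resolve_left hb.coe
    omega
  obtain ⟨s, hs⟩ : ∃ s : E, ((((GG g) ^ y).coeff N).map ι).eval s ≠ 0 := by
    by_contra hc
    push Not at hc
    apply hb.coe
    rw [← Polynomial.map_eq_zero ι]
    apply eq_zero_of_natDegree_lt_card_of_eval_eq_zero' _ (Finset.univ : Finset E)
    · intro s _; exact hc s
    · rw [Finset.card_univ, hE, natDegree_map]; exact hΔ
  obtain ⟨u, hu⟩ : ∃ u : E, u ^ 2 = s := by
    have := (frobenius_inj E 2)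
    obtain ⟨u, hu⟩ := (Finite.injective_iff_surjective.mp this) s
    exact ⟨u, hu⟩
  set ev : F[X] →+* E := eval₂RingHom ι s with hev
  set Gs := (GG g).map ev with hGs
  have hGse : ∀ x, Gs.eval x = (g.map ι).eval (x + s) + (g.map ι).eval s := by
    intro x
    have hcomp : ev.comp C = ι := by ext a; simp [hev]
    rw [hGs, GG, Polynomial.map_add, map_comp, Polynomial.map_map, hcomp]
    simp [hev, eval₂_eq_eval_map]
  set f := expand E 2 (g.map ι) with hf
  have hex : ∀ x, (expand E 2 Gs).eval x = f.eval (x + u) + f.eval u := by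
    intro x
    rw [hf, expand_eval, expand_eval, expand_eval, hGse, ← hu, add_pow_char]
  have hGd : Gs.natDegree ≤ g.natDegree := by
    rw [← natDegree_GG g]; exact natDegree_map_le
  refine block_contra hE Gs (Bd.image (fun t => t + u)) ?_ ?_ ?_ (y := y) (N := N)
    ⟨hb.odd, hb.lt, hb.lo, hb.hi, hb.sub, ?_, ?_⟩
  · intro t ht x hx
    have ht' : t + u ∉ Bd := by
      intro hc; apply ht
      rw [Finset.mem_image]
      exact ⟨_, hc, by rw [add_assoc, CharTwo.add_self_eq_zero, add_zero]⟩
    rw [hex, hex]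
    intro hc
    exact hg.1 _ ht' (x + u) (by simpa using hx) (add_right_cancel hc)
  · intro t ht x z hx hz hxz
    have ht' : t + u ∉ Bd := by
      intro hc; apply ht
      rw [Finset.mem_image]
      exact ⟨_, hc, by rw [add_assoc, CharTwo.add_self_eq_zero, add_zero]⟩
    have h1 := hg.2 _ ht' (x + u) (z + u) (by simpa using hx) (by simpa using hz) (by simpa using hxz)
    rw [hex, hex, hex]
    have e1 : ∀ a b : E, a + u + (b + u) = a + b := fun a b => by
      rw [add_add_add_comm, CharTwo.add_self_eq_zero, add_zero]
    have e2 : ∀ a b c : E, a + c + (b + c) = a + b := fun a b c => by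
      rw [add_add_add_comm, CharTwo.add_self_eq_zero, add_zero]
    rw [e1, e1] at h1
    rw [e2, e2]
    exact h1
  · have h1 : (Bd.image (fun t => t + u)).card ≤ Bd.card := Finset.card_image_le
    have h2 : (expand E 2 Gs).natDegree ≤ f.natDegree := by
      rw [hf, natDegree_expand, natDegree_expand, natDegree_map_eq_of_injective ι.injective]
      exact Nat.mul_le_mul_right _ hGd
    exact lt_of_le_of_lt (Nat.mul_le_mul h2 h1) hd
  · have h2 := hb.deg
    rw [natDegree_GG] at h2
    have := Nat.mul_le_mul_right y hGd
    omega
  · rw [hGs, ← Polynomial.map_pow, coeff_map, hev, coe_eval₂RingHom, eval₂_eq_eval_map]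
    exact hs

lemma two_pow_modEq (h n : ℕ) : 2 ^ n ≡ 2 ^ (n % h) [MOD 2 ^ h - 1] := by
  have h1 : 2 ^ h ≡ 1 [MOD 2 ^ h - 1] := by
    have : 1 ≤ 2 ^ h := Nat.one_le_two_pow
    exact ((Nat.modEq_iff_dvd' this).mpr (dvd_refl _)).symm
  have h2 : 2 ^ n = (2 ^ h) ^ (n / h) * 2 ^ (n % h) := by
    rw [← pow_mul, ← pow_add, Nat.div_add_mod]
  rw [h2]
  calc (2 ^ h) ^ (n / h) * 2 ^ (n % h) ≡ 1 ^ (n / h) * 2 ^ (n % h) [MOD 2 ^ h - 1] :=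
        (h1.pow _).mul_right _
    _ = 2 ^ (n % h) := by rw [one_pow, one_mul]

lemma multiset_bits (h : ℕ) (b : Finset ℕ) (hb : b ⊆ Finset.range h) (hne : b.Nonempty)
    (hpr : b ≠ Finset.range h) : ∀ (n : ℕ) (U : Multiset ℕ), U.card = n → n ≤ b.card → (∀ u ∈ U, u < h) →
    (U.map (fun u => 2 ^ u)).sum ≡ bv b [MOD 2 ^ h - 1] → U = b.val := by
  classical
  have hpos : 0 < bv b := bv_pos hne
  have hlt : bv b + 1 < 2 ^ h := by
    rw [← bv_range h]
    have h1 : bv b ≤ bv (Finset.range h) := bv_mono hb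
    have h2 : bv b ≠ bv (Finset.range h) := fun hc => hpr (bv_inj hc)
    omega
  intro n
  induction n with
  | zero =>
    intro U hU _ _ hs
    rw [Multiset.card_eq_zero] at hU
    subst hU
    simp only [Multiset.map_zero, Multiset.sum_zero] at hs
    have := (Nat.modEq_zero_iff_dvd.mp hs.symm)
    have := Nat.le_of_dvd hpos this
    omega
  | succ n ih =>
    intro U hU hn hU' hs
    by_cases hnd : U.Nodup
    · set b' : Finset ℕ := ⟨U, hnd⟩ with hb'
      have e1 : (U.map (fun u => 2 ^ u)).sum = bv b' := rfl
      have hsub : b' ⊆ Finset.range h := fun u hu => Finset.mem_range.mpr (hU' u hu)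
      have hle : bv b' + 1 ≤ 2 ^ h := by
        rw [← bv_range h]; have := bv_mono hsub; omega
      rw [e1] at hs
      have hpos' : 0 < bv b' := by
        apply bv_pos
        rw [← Finset.card_pos]
        change 0 < U.card
        omega
      have : bv b' = bv b := by
        have h3 : bv b % (2 ^ h - 1) = bv b := Nat.mod_eq_of_lt (by omega)
        have h4 : bv b' % (2 ^ h - 1) = bv b := by rw [← h3]; exact hs
        rcases Nat.lt_or_ge (bv b') (2 ^ h - 1) with h5 | h5
        · rwa [Nat.mod_eq_of_lt h5] at h4
        · rw [show bv b' = 2 ^ h - 1 by omega, Nat.mod_self] at h4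
          omega
      have := bv_inj this
      rw [← this]
    · rw [Multiset.nodup_iff_le] at hnd
      push Not at hnd
      obtain ⟨u, hu⟩ := hnd
      obtain ⟨V, hV⟩ := Multiset.le_iff_exists_add.mp hu
      subst hV
      simp only [Multiset.cons_add, zero_add, Multiset.card_cons] at hU
      have huh : u < h := hU' u (by simp)
      exfalso
      have := ih ((u + 1) % h ::ₘ V) (by simp; omega) (by omega) (by
        intro v hv
        rw [Multiset.mem_cons] at hv
        rcases hv with rfl | hv
        · exact Nat.mod_lt _ (by omega)
        · exact hU' v (by simp [hv])) (by
        refine Nat.ModEq.trans ?_ hs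
        simp only [Multiset.cons_add, zero_add, Multiset.map_cons, Multiset.sum_cons]
        rw [← add_assoc, ← two_mul, ← pow_succ']
        exact (two_pow_modEq h (u + 1)).symm.add_right _)
      have h2 := congrArg Multiset.card this
      simp only [Multiset.card_cons] at h2
      change V.card + 1 = b.card at h2
      omega

lemma multiset_fun (I : Finset ℕ) (hI : I.Nonempty) (M : Multiset ℕ) (hM : ∀ i ∈ M, i ∈ I) :
    ∃ w : ℕ → ℕ, (∀ j, w j ∈ I) ∧ ∑ j ∈ Finset.range M.card, w j = M.sum := by
  induction M using Multiset.induction_on with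
  | empty =>
    obtain ⟨i, hi⟩ := hI
    exact ⟨fun _ => i, fun _ => hi, by simp⟩
  | cons a M ih =>
    obtain ⟨w, h1, h2⟩ := ih (fun i hi => hM i (by simp [hi]))
    refine ⟨fun j => if j = M.card then a else w j, fun j => ?_, ?_⟩
    · simp only; split_ifs
      · exact hM a (by simp)
      · exact h1 j
    · rw [Multiset.card_cons, Finset.sum_range_succ, if_pos rfl, Multiset.sum_cons, add_comm, ← h2]
      congr 1
      apply Finset.sum_congr rfl
      intro j hj
      rw [if_neg (Finset.mem_range.mp hj).ne]

lemma exists_short (h : ℕ) (I : Finset ℕ) (hI : ∀ i ∈ I, 1 ≤ i ∧ i < h) (h2 : 2 ≤ I.card) :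
    ∃ M : Multiset ℕ, M ≠ 0 ∧ (∀ i ∈ M, i ∈ I) ∧ h ∣ M.sum ∧ M.card < h := by
  classical
  obtain ⟨i, hi, i', hi', hne⟩ := Finset.one_lt_card.mp h2
  have b1 := hI i hi
  have b2 := hI i' hi'
  by_cases hk : ∃ k, 1 ≤ k ∧ k < h ∧ h ∣ k * i
  · obtain ⟨k, k1, k2, k3⟩ := hk
    refine ⟨Multiset.replicate k i, ?_, ?_, ?_, ?_⟩
    · intro hc
      have := congrArg Multiset.card hc
      simp at this; omega
    · intro j hj; rw [Multiset.eq_of_mem_replicate hj]; exact hi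
    · simpa using k3
    · simpa using k2
  · push Not at hk
    have hinj : Set.InjOn (fun k => k * i % h) (Finset.range h) := by
      have aux : ∀ k l, k < l → l < h → k * i % h = l * i % h → False := by
        intro k l hkl hlh he
        apply hk (l - k) (by omega) (by omega)
        rw [Nat.sub_mul]
        exact (Nat.modEq_iff_dvd' (Nat.mul_le_mul_right _ hkl.le)).mp he
      intro k hk' l hl' he
      simp only [Finset.coe_range, Set.mem_Iio] at hk' hl'
      rcases lt_trichotomy k l with hlt | heq | hgt
      · exact (aux k l hlt hl' he).elim
      · exact heq
      · exact (aux l k hgt hk' he.symm).elim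
    have himg : (Finset.range h).image (fun k => k * i % h) = Finset.range h := by
      apply Finset.eq_of_subset_of_card_le
      · intro x hx
        rw [Finset.mem_image] at hx
        obtain ⟨k, _, rfl⟩ := hx
        exact Finset.mem_range.mpr (Nat.mod_lt _ (by omega))
      · rw [Finset.card_image_of_injOn hinj]
    have hmem : i' ∈ (Finset.range h).image (fun k => k * i % h) := by
      rw [himg]; exact Finset.mem_range.mpr b2.2
    rw [Finset.mem_image] at hmem
    obtain ⟨k, hkr, hke⟩ := hmem
    rw [Finset.mem_range] at hkr
    have k0 : k ≠ 0 := by rintro rfl; simp at hke; omega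
    have k1 : k ≠ 1 := by
      rintro rfl
      rw [one_mul, Nat.mod_eq_of_lt b1.2] at hke
      exact hne hke
    refine ⟨i' ::ₘ Multiset.replicate (h - k) i, by simp, ?_, ?_, ?_⟩
    · intro j hj
      rw [Multiset.mem_cons] at hj
      rcases hj with rfl | hj
      · exact hi'
      · rw [Multiset.eq_of_mem_replicate hj]; exact hi
    · rw [Multiset.sum_cons, Multiset.sum_replicate, smul_eq_mul]
      have e1 : k * i + (h - k) * i = h * i := by rw [← add_mul]; congr 1; omega
      have e2 := Nat.div_add_mod (k * i) h
      rw [hke] at e2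
      have : h ∣ h * (k * i / h) + (i' + (h - k) * i) := ⟨i, by omega⟩
      exact (Nat.dvd_add_right (Dvd.intro _ rfl)).mp this
    · simp; omega

lemma zero_sum (h : ℕ) (I : Finset ℕ) (hI : ∀ i ∈ I, 1 ≤ i ∧ i < h) (h2 : 2 ≤ I.card) :
    ∃ (L : ℕ) (w : ℕ → ℕ), 1 ≤ L ∧ L < h ∧ (∀ j, w j ∈ I) ∧ h ∣ ∑ j ∈ Finset.range L, w j ∧
      ∀ M : Multiset ℕ, M ≠ 0 → (∀ i ∈ M, i ∈ I) → h ∣ M.sum → L ≤ M.card := by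
  classical
  have hne : I.Nonempty := by rw [← Finset.card_pos]; omega
  obtain ⟨M, m1, m2, m3, m4⟩ := exists_short h I hI h2
  have hex : ∃ L, ∃ M : Multiset ℕ, M ≠ 0 ∧ (∀ i ∈ M, i ∈ I) ∧ h ∣ M.sum ∧ M.card = L :=
    ⟨_, M, m1, m2, m3, rfl⟩
  obtain ⟨M₀, n1, n2, n3, n4⟩ := Nat.find_spec hex
  obtain ⟨w, w1, w2⟩ := multiset_fun I hne M₀ n2
  refine ⟨Nat.find hex, w, ?_, ?_, w1, ?_, ?_⟩
  · rw [← n4]; exact Multiset.card_pos.mpr n1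
  · exact lt_of_le_of_lt (Nat.find_min' hex ⟨M, m1, m2, m3, rfl⟩) m4
  · rw [← n4, w2]; exact n3
  · intro M' c1 c2 c3
    exact Nat.find_min' hex ⟨M', c1, c2, c3, rfl⟩

/-- chord-freeness of a shortest closed walk -/
lemma chord (h : ℕ) (I : Finset ℕ) (hI : ∀ i ∈ I, 1 ≤ i ∧ i < h) (L : ℕ) (w : ℕ → ℕ)
    (hw : ∀ j, w j ∈ I) (hs : h ∣ ∑ j ∈ Finset.range L, w j)
    (hmin : ∀ M : Multiset ℕ, M ≠ 0 → (∀ i ∈ M, i ∈ I) → h ∣ M.sum → L ≤ M.card)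
    (S : ℕ → ℕ) (hS : ∀ k, S k = (∑ j ∈ Finset.range k, w j) % h) :
    (∀ k l, k < l → l < L → S k ≠ S l) ∧
    (∀ k l, k < L → l < L → ∀ i ∈ I, (S k + i) % h = S l → i = w k) := by
  classical
  have hsum : ∀ s : Finset ℕ, s.Nonempty → h ∣ ∑ j ∈ s, w j → L ≤ s.card := by
    intro s hsn hd
    have := hmin (s.val.map w) (by
      intro hc
      have := congrArg Multiset.card hc
      simp at this
      exact hsn.ne_empty this) (by
      intro i hi
      rw [Multiset.mem_map] at hi
      obtain ⟨j, _, rfl⟩ := hi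
      exact hw j) hd
    simpa using this
  have hsum' : ∀ (s : Finset ℕ) (i : ℕ), i ∈ I → h ∣ i + ∑ j ∈ s, w j → L ≤ s.card + 1 := by
    intro s i hi hd
    have := hmin (i ::ₘ s.val.map w) (by simp) (by
      intro i' hi'
      rw [Multiset.mem_cons] at hi'
      rcases hi' with rfl | hi'
      · exact hi
      · rw [Multiset.mem_map] at hi'
        obtain ⟨j, _, rfl⟩ := hi'
        exact hw j) (by rw [Multiset.sum_cons]; exact hd)
    simpa using this
  have hIco : ∀ k l, k ≤ l → ∑ j ∈ Finset.range k, w j + ∑ j ∈ Finset.Ico k l, w j = ∑ j ∈ Finset.range l, w j := by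
    intro k l hkl
    exact Finset.sum_range_add_sum_Ico w hkl
  refine ⟨?_, ?_⟩
  · intro k l hkl hlL he
    rw [hS, hS] at he
    have h1 := hIco k l hkl.le
    have h2 := (Nat.modEq_iff_dvd' (by omega)).mp he
    rw [show ∑ j ∈ Finset.range l, w j - ∑ j ∈ Finset.range k, w j = ∑ j ∈ Finset.Ico k l, w j by omega] at h2
    have := hsum _ (by simpa using hkl) h2
    simp at this
    omega
  · intro k l hkL hlL i hi he
    have he' : (∑ j ∈ Finset.range k, w j + i) ≡ ∑ j ∈ Finset.range l, w j [MOD h] := by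
      rw [hS, hS] at he
      rw [Nat.mod_add_mod] at he
      exact he
    have fin : (∑ j ∈ Finset.range k, w j + i) ≡ ∑ j ∈ Finset.range (k + 1), w j [MOD h] → i = w k := by
      intro hh
      rw [Finset.sum_range_succ] at hh
      have := Nat.ModEq.add_left_cancel' _ hh
      rwa [Nat.ModEq, Nat.mod_eq_of_lt (hI i hi).2, Nat.mod_eq_of_lt (hI _ (hw k)).2] at this
    rcases le_or_gt l k with hlk | hkl
    · have h1 := hIco l k hlk
      have h2 : h ∣ i + ∑ j ∈ Finset.Ico l k, w j := by
        rw [← h1, add_assoc] at he'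
        have := Nat.ModEq.add_left_cancel' (a := ∑ j ∈ Finset.Ico l k, w j + i) (b := 0)
          (∑ j ∈ Finset.range l, w j) (by rw [add_zero]; exact he')
        rw [add_comm]
        exact (Nat.modEq_zero_iff_dvd).mp this
      have := hsum' _ i hi h2
      simp at this
      have e1 : k + 1 = L := by omega
      have e2 : l = 0 := by omega
      apply fin
      rw [e1]
      refine he'.trans ?_
      rw [e2]
      simp only [Finset.range_zero, Finset.sum_empty]
      exact (Nat.modEq_zero_iff_dvd.mpr hs).symm
    · have h1 := hIco k l hkl.le
      have h3 : h ∣ i + ∑ j ∈ Finset.range L \ Finset.Ico k l, w j := by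
        have hsub : Finset.Ico k l ⊆ Finset.range L := by
          intro x hx; simp at hx ⊢; omega
        have h4 := Finset.sum_sdiff (f := w) hsub
        have h5 : i ≡ ∑ j ∈ Finset.Ico k l, w j [MOD h] := by
          rw [← h1] at he'
          exact Nat.ModEq.add_left_cancel' _ he'
        have h6 := h5.add_right (∑ j ∈ Finset.range L \ Finset.Ico k l, w j)
        rw [add_comm (∑ j ∈ Finset.Ico k l, w j), h4] at h6
        exact Nat.modEq_zero_iff_dvd.mp (h6.trans (Nat.modEq_zero_iff_dvd.mpr hs))
      have := hsum' _ i hi h3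
      rw [Finset.card_sdiff_of_subset (by intro x hx; simp at hx ⊢; omega)] at this
      simp at this
      have : l = k + 1 := by omega
      rw [this] at he'
      exact fin he'

theorem payne {F : Type*} [Field F] [CharP F 2] [Fintype F] {h : ℕ} (hF : Fintype.card F = 2 ^ h)
    (I : Finset ℕ) (a : ℕ → F) (ha : ∀ i ∈ I, a i ≠ 0) (hI : ∀ i ∈ I, 1 ≤ i ∧ i < h)
    (hnz : ∀ x : F, x ≠ 0 → ∑ i ∈ I, a i * x ^ 2 ^ i ≠ 0)
    (hinj : ∀ x y : F, x ≠ 0 → y ≠ 0 → x ≠ y →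
      (∑ i ∈ I, a i * x ^ 2 ^ i) * y ≠ (∑ i ∈ I, a i * y ^ 2 ^ i) * x) : I.card ≤ 1 := by
  classical
  by_contra hcard
  obtain ⟨L, w, hL1, hLh, hw, hs, hmin⟩ := zero_sum h I hI (by omega)
  obtain ⟨S, hS⟩ : ∃ S : ℕ → ℕ, ∀ k, S k = (∑ j ∈ Finset.range k, w j) % h := ⟨_, fun _ => rfl⟩
  obtain ⟨hc1, hc2⟩ := chord h I hI L w hw hs hmin S hS
  have hh : 0 < h := by omega
  have hSlt : ∀ k, S k < h := fun k => by rw [hS]; exact Nat.mod_lt _ hh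
  have hSinj : Set.InjOn S (Finset.range L) := by
    intro k hk l hl he
    simp only [Finset.coe_range, Set.mem_Iio] at hk hl
    rcases lt_trichotomy k l with h1 | h1 | h1
    · exact (hc1 k l h1 hl he).elim
    · exact h1
    · exact (hc1 l k h1 hk he.symm).elim
  set b := (Finset.range L).image S with hb
  have hbcard : b.card = L := by rw [hb, Finset.card_image_of_injOn hSinj, Finset.card_range]
  have hbsub : b ⊆ Finset.range h := by
    intro x hx
    rw [hb, Finset.mem_image] at hx
    obtain ⟨k, _, rfl⟩ := hx
    exact Finset.mem_range.mpr (hSlt k)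
  have hbne : b.Nonempty := by rw [← Finset.card_pos]; omega
  have hbpr : b ≠ Finset.range h := by
    intro hc
    rw [hc, Finset.card_range] at hbcard
    omega
  have hbv : bv b = ∑ k : Fin L, 2 ^ S k := by
    rw [bv, hb, Finset.sum_image hSinj, Finset.sum_range]
  have hbv0 : 0 < bv b := bv_pos hbne
  have hbvlt : bv b < 2 ^ h - 1 := by
    have e1 := bv_range h
    have h1 : bv b ≤ bv (Finset.range h) := bv_mono hbsub
    have h2 : bv b ≠ bv (Finset.range h) := fun hc => hbpr (bv_inj hc)
    omega
  set p : F → F := fun x => ∑ i ∈ I, a i * x ^ (2 ^ i - 1) with hp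
  have hpf : ∀ x, ∑ i ∈ I, a i * x ^ 2 ^ i = p x * x := by
    intro x
    simp only [hp]
    rw [Finset.sum_mul]
    apply Finset.sum_congr rfl
    intro i _
    rw [mul_assoc, ← pow_succ, Nat.sub_add_cancel Nat.one_le_two_pow]
  have hp0 : p 0 = 0 := by
    simp only [hp]
    apply Finset.sum_eq_zero
    intro i hi
    have : 1 < 2 ^ i := Nat.one_lt_two_pow (by have := (hI i hi).1; omega)
    rw [zero_pow (by omega), mul_zero]
  have hpnz : ∀ x, x ≠ 0 → p x ≠ 0 := by
    intro x hx hc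
    apply hnz x hx
    rw [hpf, hc, zero_mul]
  have hpinj : Function.Injective p := by
    intro x y hxy
    by_contra hne
    rcases eq_or_ne x 0 with rfl | hx
    · rw [hp0] at hxy
      exact hpnz y (Ne.symm hne) hxy.symm
    · rcases eq_or_ne y 0 with rfl | hy
      · rw [hp0] at hxy
        exact hpnz x hx hxy
      · apply hinj x y hx hy hne
        rw [hpf, hpf, hxy]; ring
  have hpbij : Function.Bijective p := Finite.injective_iff_bijective.mp hpinj
  have hsum0 : ∑ x : F, p x ^ bv b = 0 := by
    rw [hpbij.sum_comp (fun x => x ^ bv b), sum_pow_E, if_neg]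
    rintro ⟨_, h2⟩
    rw [hF] at h2
    have := Nat.le_of_dvd hbv0 h2
    omega
  have hexp : ∀ x, p x ^ bv b = ∑ φ ∈ Fintype.piFinset (fun _ : Fin L => I),
      (∏ k, a (φ k) ^ 2 ^ S k) * x ^ (∑ k, (2 ^ φ k - 1) * 2 ^ S k) := by
    intro x
    rw [hbv, ← Finset.prod_pow_eq_pow_sum]
    have h2 : ∀ k ∈ (Finset.univ : Finset (Fin L)), p x ^ 2 ^ S k =
        ∑ i ∈ I, a i ^ 2 ^ S k * x ^ ((2 ^ i - 1) * 2 ^ S k) := by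
      intro k _
      simp only [hp]
      rw [sum_pow_char_pow]
      apply Finset.sum_congr rfl
      intro i _
      rw [mul_pow, pow_mul]
    rw [Finset.prod_congr rfl h2, Finset.prod_univ_sum]
    apply Finset.sum_congr rfl
    intro φ _
    rw [Finset.prod_mul_distrib, Finset.prod_pow_eq_pow_sum]
  have hn : ∀ φ : Fin L → ℕ, ∑ k : Fin L, (2 ^ φ k - 1) * 2 ^ S k + bv b = ∑ k : Fin L, 2 ^ (S k + φ k) := by
    intro φ
    rw [hbv, ← Finset.sum_add_distrib]
    apply Finset.sum_congr rfl
    intro k _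
    have : 1 ≤ 2 ^ φ k := Nat.one_le_two_pow
    rw [pow_add, Nat.sub_mul, mul_comm (2 ^ S k)]
    have : 1 * 2 ^ S k ≤ 2 ^ φ k * 2 ^ S k := Nat.mul_le_mul_right _ this
    omega
  simp_rw [hexp] at hsum0
  rw [Finset.sum_comm] at hsum0
  simp_rw [← Finset.mul_sum, sum_pow_E] at hsum0
  rw [Finset.sum_eq_single (fun k : Fin L => w k)] at hsum0
  · rw [if_pos, mul_one, Finset.prod_eq_zero_iff] at hsum0
    · obtain ⟨k, _, hk⟩ := hsum0
      exact pow_ne_zero _ (ha _ (hw _)) hk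
    · have h1 := hn (fun k : Fin L => w k)
      constructor
      · apply Finset.sum_pos
        · intro k _
          have : 1 < 2 ^ w k := Nat.one_lt_two_pow (by have := (hI _ (hw k)).1; omega)
          exact Nat.mul_pos (Nat.sub_pos_of_lt this) (by positivity)
        · exact ⟨⟨0, by omega⟩, Finset.mem_univ _⟩
      · rw [hF]
        have h3 : ∑ k : Fin L, 2 ^ (S k + w k) ≡ bv b [MOD 2 ^ h - 1] := by
          have h4 : ∑ k : Fin L, 2 ^ (S k + w k) ≡ ∑ k : Fin L, 2 ^ S (k + 1) [MOD 2 ^ h - 1] := by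
            apply Nat.ModEq.sum
            intro k _
            refine (two_pow_modEq h _).trans ?_
            rw [hS k, Nat.mod_add_mod, ← Finset.sum_range_succ, ← hS]
          refine h4.trans ?_
          rw [hbv, ← Finset.sum_range (fun k => 2 ^ S (k + 1)), ← Finset.sum_range (fun k => 2 ^ S k)]
          have h5 := Finset.sum_range_succ (fun k => 2 ^ S k) L
          have h6 := Finset.sum_range_succ' (fun k => 2 ^ S k) L
          have h7 : S L = S 0 := by
            rw [hS, hS, Nat.mod_eq_zero_of_dvd hs]; simp
          have h8 : ∑ k ∈ Finset.range L, 2 ^ S (k + 1) = ∑ k ∈ Finset.range L, 2 ^ S k := by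
            rw [h7] at h5; omega
          rw [h8]
        rw [← h1] at h3
        apply Nat.modEq_zero_iff_dvd.mp
        apply Nat.ModEq.add_right_cancel' (bv b)
        rw [zero_add]
        exact h3
  · intro φ hφ hne
    rw [if_neg, mul_zero]
    rintro ⟨_, hd⟩
    apply hne
    rw [hF] at hd
    rw [Fintype.mem_piFinset] at hφ
    have h1 := hn φ
    have h2 : ∑ k : Fin L, 2 ^ (S k + φ k) ≡ bv b [MOD 2 ^ h - 1] := by
      rw [← h1]
      have := (Nat.modEq_zero_iff_dvd.mpr hd).add_right (bv b)
      rwa [zero_add] at this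
    set U : Multiset ℕ := (Finset.univ : Finset (Fin L)).val.map (fun k : Fin L => (S k + φ k) % h) with hU
    have hUb : U = b.val := by
      apply multiset_bits h b hbsub hbne hbpr L U
      · simp [hU]
      · rw [hbcard]
      · intro u hu
        rw [hU, Multiset.mem_map] at hu
        obtain ⟨k, _, rfl⟩ := hu
        exact Nat.mod_lt _ hh
      · refine Nat.ModEq.trans ?_ h2
        rw [hU, Multiset.map_map]
        change ∑ k : Fin L, 2 ^ ((S k + φ k) % h) ≡ _ [MOD _]
        apply Nat.ModEq.sum
        intro k _
        exact (two_pow_modEq h _).symm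
    funext k
    have hmem : (S k + φ k) % h ∈ b := by
      rw [← Finset.mem_val, ← hUb, hU, Multiset.mem_map]
      exact ⟨k, Finset.mem_val.mpr (Finset.mem_univ k), rfl⟩
    rw [hb, Finset.mem_image] at hmem
    obtain ⟨l, hl, hle⟩ := hmem
    exact hc2 k l k.2 (Finset.mem_range.mp hl) (φ k) (hφ k) hle.symm
  · intro hc
    exact absurd (Fintype.mem_piFinset.mpr (fun k : Fin L => hw k)) hc

/-- The affine o-polynomial conditions (injectivity and no three collinear points). -/
def OP {E : Type*} [Field E] (f : E[X]) : Prop := GoodOn f ∅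

lemma fix_of {F K : Type*} [Field F] [Fintype F] [Field K] [CharP K 2] [IsAlgClosed K] {h : ℕ} (hh : 0 < h)
    (hF : Fintype.card F = 2 ^ h) (φ : F →+* K) (x : K) (hx : x ^ 2 ^ h = x) : ∃ a, φ a = x := by
  classical
  have h1 : Finset.univ.image φ ⊆ fixF K h := by
    intro y hy
    obtain ⟨a, -, rfl⟩ := Finset.mem_image.mp hy
    rw [mem_fixF hh, ← map_pow, ← hF, FiniteField.pow_card]
  have h2 : Finset.univ.image φ = fixF K h := by
    apply Finset.eq_of_subset_of_card_le h1
    rw [card_fixF hh, Finset.card_image_of_injective _ φ.injective, Finset.card_univ, hF]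
  have h3 := (mem_fixF hh x).mpr hx
  rw [← h2] at h3
  obtain ⟨a, -, ha⟩ := Finset.mem_image.mp h3
  exact ⟨a, ha⟩

lemma exists_expand_sep {F : Type*} [Field F] [CharP F 2] (n : ℕ) : ∀ f : F[X], f.natDegree = n → 0 < n →
    ∃ (j : ℕ) (g : F[X]), f = expand F (2 ^ j) g ∧ derivative g ≠ 0 := by
  induction n using Nat.strong_induction_on with
  | _ n ih =>
    intro f hf hn
    by_cases hd : derivative f = 0
    · have h1 : expand F 2 (contract 2 f) = f := expand_contract 2 hd two_ne_zero
      have h2 : (contract 2 f).natDegree * 2 = n := by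
        rw [← hf]; conv_rhs => rw [← h1]
        rw [natDegree_expand]
      obtain ⟨j, g, hg, hg'⟩ := ih _ (by omega) (contract 2 f) rfl (by omega)
      refine ⟨j + 1, g, ?_, hg'⟩
      rw [← h1, hg, expand_expand, pow_succ']
    · exact ⟨0, f, by simp, hd⟩

lemma eval_expand' {F : Type*} [Field F] (n : ℕ) (g : F[X]) (x : F) :
    (expand F n g).eval x = g.eval (x ^ n) := expand_eval n g x

theorem good_ext_monic {F E : Type*} [Field F] [Fintype F] [CharP F 2] [Field E] [Fintype E] [CharP E 2]
    (ι : F →+* E) {h r : ℕ} (hF : Fintype.card F = 2 ^ h) (hE : Fintype.card E = 2 ^ (h * r))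
    (f : F[X]) (hf : f.Monic) (hd : 2 ≤ f.natDegree) (hder : derivative f = 0)
    (hq : 16 * f.natDegree ^ 4 ≤ 2 ^ h) (hr : r.Prime) (hrd : f.natDegree < r) (hop : OP f) :
    ∃ Bd : Finset E, Bd.card ≤ f.natDegree ∧ GoodOn (f.map ι) Bd := by
  classical
  have hh : 0 < h := by
    rcases Nat.eq_zero_or_pos h with rfl | h0
    · have : 1 ≤ f.natDegree ^ 4 := Nat.one_le_pow _ _ (by omega)
      simp at hq; omega
    · exact h0
  obtain ⟨j, g, hfg, hg⟩ := exists_expand_sep _ f rfl (by omega)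
  have hj : j ≠ 0 := by
    rintro rfl
    apply hg; rw [← hder, hfg]; simp
  have h2j : 2 ≤ 2 ^ j := by
    calc 2 = 2 ^ 1 := by norm_num
      _ ≤ _ := Nat.pow_le_pow_right (by norm_num) (by omega)
  have hdg : f.natDegree = g.natDegree * 2 ^ j := by rw [hfg, natDegree_expand]
  have hg1 : 1 ≤ g.natDegree := by
    by_contra hc
    have : g.natDegree = 0 := by omega
    rw [this] at hdg; omega
  have hgd : g.natDegree + 1 ≤ f.natDegree := by rw [hdg]; nlinarith
  have hgm : g.Monic := by
    rw [hfg, Polynomial.Monic, leadingCoeff_expand (by positivity)] at hf; exact hf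
  let K := AlgebraicClosure E
  haveI : CharP K 2 := charP_of_injective_algebraMap (algebraMap E K).injective 2
  obtain ⟨ψ, hψ⟩ : ∃ ψ : E →+* K, ψ = algebraMap E K := ⟨_, rfl⟩
  obtain ⟨φ, hφ⟩ : ∃ φ : F →+* K, φ = ψ.comp ι := ⟨_, rfl⟩
  have hcoe : ∀ (p : F[X]) i, ((p.map φ).coeff i) ^ (2 ^ h) = (p.map φ).coeff i := by
    intro p i
    rw [coeff_map, ← map_pow, ← hF, FiniteField.pow_card]
  have hψE : ∀ x : E, (ψ x) ^ (2 ^ (h * r)) = ψ x := by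
    intro x
    rw [← map_pow, ← hE, FiniteField.pow_card]
  have hmm : ∀ (p : F[X]) (x : E), (p.map φ).eval (ψ x) = ψ ((p.map ι).eval x) := by
    intro p x
    rw [hφ, ← Polynomial.map_map, eval_map_apply]
  have hFev : ∀ (p : F[X]) (x : F), (p.map φ).eval (φ x) = φ (p.eval x) := by
    intro p x
    rw [eval_map_apply]
  have hfrobF : ∀ x : F, ∃ y, y ^ 2 ^ j = x := by
    intro x
    have hinj : Function.Injective (iterateFrobenius F 2 j) := (iterateFrobenius F 2 j).injective
    obtain ⟨y, hy⟩ := Finite.injective_iff_surjective.mp hinj x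
    exact ⟨y, by rw [← hy, iterateFrobenius_def]⟩
  have hfrobE : ∀ x y : E, x ^ 2 ^ j = y ^ 2 ^ j → x = y := by
    intro x y hxy
    apply (iterateFrobenius E 2 j).injective
    rw [iterateFrobenius_def, iterateFrobenius_def, hxy]
  have hg' : derivative (g.map φ) ≠ 0 := by
    rw [derivative_map]
    exact (Polynomial.map_ne_zero_iff φ.injective).mpr hg
  have T2 : ∀ x y : E, x ≠ y → (g.map ι).eval x = (g.map ι).eval y → ((derivative g).map ι).eval y = 0 := by
    intro x y hxy hc
    have := transfer2 (g.map φ) (hgm.map φ) (by rwa [natDegree_map]) hg' h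
      (by
        rw [natDegree_map]
        refine le_trans ?_ hq
        gcongr) (hcoe g) r hr (by rw [natDegree_map]; omega)
      (by
        intro a b ha hb hab
        obtain ⟨a, rfl⟩ := fix_of hh hF φ a ha
        obtain ⟨b, rfl⟩ := fix_of hh hF φ b hb
        rw [hFev, hFev] at hab
        have hab := φ.injective hab
        obtain ⟨a, rfl⟩ := hfrobF a
        obtain ⟨b, rfl⟩ := hfrobF b
        by_contra hne
        refine hop.1 b (by simp) a ?_ ?_
        · rintro rfl; exact hne rfl
        · rw [hfg, expand_eval, expand_eval, hab]) (ψ x) (ψ y) (hψE x) (hψE y)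
      (fun e => hxy (ψ.injective e)) (by rw [hmm, hmm, hc])
    rw [derivative_map, hmm] at this
    exact ψ.injective (by rw [this, map_zero])
  have hdm : ((expand F (2 ^ j) (derivative g)).map ι) ≠ 0 := by
    rw [Polynomial.map_ne_zero_iff ι.injective]
    exact (expand_ne_zero (by positivity)).mpr hg
  refine ⟨((expand F (2 ^ j) (derivative g)).map ι).roots.toFinset, ?_, ?_⟩
  · refine (Multiset.toFinset_card_le _).trans ((card_roots' _).trans ?_)
    rw [natDegree_map, natDegree_expand, hdg]
    exact Nat.mul_le_mul_right _ ((natDegree_derivative_le g).trans (by omega))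
  · have key : ∀ s ∉ ((expand F (2 ^ j) (derivative g)).map ι).roots.toFinset, ∀ x, x ≠ s →
        (f.map ι).eval x ≠ (f.map ι).eval s := by
      intro s hs x hxs he
      apply hs
      rw [Multiset.mem_toFinset, mem_roots hdm, IsRoot.def, map_expand, expand_eval]
      rw [hfg, map_expand, expand_eval, expand_eval] at he
      exact T2 _ _ (fun e => hxs (hfrobE _ _ e)) he
    refine ⟨key, ?_⟩
    intro s hs x y hxs hys hxy hc
    refine key s hs x hxs ?_
    have := transfer1 (f.map φ) (hf.map φ) (by rwa [natDegree_map])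
      (by rw [derivative_map, hder, Polynomial.map_zero]) h (by rwa [natDegree_map]) (hcoe f) r hr
      (by rwa [natDegree_map])
      (by
        intro a b c ha hb hc hab hac hbc
        obtain ⟨a, rfl⟩ := fix_of hh hF φ a ha
        obtain ⟨b, rfl⟩ := fix_of hh hF φ b hb
        obtain ⟨c, rfl⟩ := fix_of hh hF φ c hc
        have h1 := hop.2 c (by simp) a b (fun e => hac (by rw [e])) (fun e => hbc (by rw [e]))
          (fun e => hab (by rw [e]))
        rw [hFev, hFev, hFev]
        intro h2
        apply h1
        rw [← CharTwo.add_eq_zero]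
        apply φ.injective
        rw [map_zero, ← h2]
        simp only [map_add, map_mul])
      (ψ x) (ψ y) (ψ s) (hψE x) (hψE y) (hψE s)
      (fun e => hxy (ψ.injective e)) (fun e => hxs (ψ.injective e)) (fun e => hys (ψ.injective e))
      (by
        rw [hmm, hmm, hmm, ← map_add, ← map_add, ← map_add, ← map_add, ← map_mul, ← map_mul, ← map_add, hc,
          CharTwo.add_self_eq_zero, map_zero])
    rw [hmm, hmm] at this
    exact ψ.injective this

lemma GoodOn.smul {E : Type*} [Field E] {f : E[X]} {Bd : Finset E} (hf : GoodOn f Bd) {c : E} (hc : c ≠ 0) :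
    GoodOn (C c * f) Bd := by
  refine ⟨fun s hs x hx he => ?_, fun s hs x y h1 h2 h3 he => ?_⟩
  · simp only [eval_mul, eval_C] at he
    exact hf.1 s hs x hx (mul_left_cancel₀ hc he)
  · simp only [eval_mul, eval_C] at he
    refine hf.2 s hs x y h1 h2 h3 (mul_left_cancel₀ hc ?_)
    linear_combination he

theorem good_ext {F E : Type*} [Field F] [Fintype F] [CharP F 2] [Field E] [Fintype E] [CharP E 2]
    (ι : F →+* E) {h r : ℕ} (hF : Fintype.card F = 2 ^ h) (hE : Fintype.card E = 2 ^ (h * r))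
    (f : F[X]) (hd : 2 ≤ f.natDegree) (hder : derivative f = 0)
    (hq : 16 * f.natDegree ^ 4 ≤ 2 ^ h) (hr : r.Prime) (hrd : f.natDegree < r) (hop : OP f) :
    ∃ Bd : Finset E, Bd.card ≤ f.natDegree ∧ GoodOn (f.map ι) Bd := by
  have h0 : f ≠ 0 := by rintro rfl; simp at hd
  have hl : f.leadingCoeff ≠ 0 := leadingCoeff_ne_zero.mpr h0
  have hl' : f.leadingCoeff⁻¹ ≠ 0 := inv_ne_zero hl
  have hdeg : (C f.leadingCoeff⁻¹ * f).natDegree = f.natDegree := natDegree_C_mul hl'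
  obtain ⟨Bd, h1, h2⟩ := good_ext_monic ι hF hE (C f.leadingCoeff⁻¹ * f)
    (by rw [Polynomial.Monic, leadingCoeff_mul, leadingCoeff_C, inv_mul_cancel₀ hl])
    (by rwa [hdeg]) (by rw [derivative_C_mul, hder, mul_zero]) (by rwa [hdeg]) hr (by rwa [hdeg]) (GoodOn.smul hop hl')
  refine ⟨Bd, by rwa [hdeg] at h1, ?_⟩
  have h3 := h2.smul (c := ι f.leadingCoeff) ((map_ne_zero ι).mpr hl)
  rw [Polynomial.map_mul, map_C, ← mul_assoc, ← C_mul, ← map_mul, mul_inv_cancel₀ hl, map_one, C_1, one_mul] at h3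
  exact h3

/-- everything we need from the extension fields -/
theorem ext_exists {F : Type*} [Field F] [Fintype F] [CharP F 2] {h : ℕ} (hF : Fintype.card F = 2 ^ h)
    (g : F[X]) (hd : 1 ≤ g.natDegree)
    (hq : 16 * (expand F 2 g).natDegree ^ 4 ≤ 2 ^ h) (hop : OP (expand F 2 g)) (n : ℕ) :
    ∃ H, n ≤ H ∧ H ∉ BlockLen g ∧ H ∉ BlockLen (GG g) := by
  have hdd : (expand F 2 g).natDegree = g.natDegree * 2 := natDegree_expand 2 g
  have hder : derivative (expand F 2 g) = 0 := by
    rw [derivative_expand]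
    have : ((2 : ℕ) : F[X]) = 0 := by
      rw [Nat.cast_ofNat]; exact CharTwo.two_eq_zero
    rw [this]; simp
  have hh : 0 < h := by
    rcases Nat.eq_zero_or_pos h with rfl | h0
    · have : 1 ≤ (expand F 2 g).natDegree ^ 4 := Nat.one_le_pow _ _ (by omega)
      simp only [pow_zero] at hq; omega
    · exact h0
  obtain ⟨D, hD⟩ : ∃ D, D = (expand F 2 g).natDegree := ⟨_, rfl⟩
  obtain ⟨r, hr1, hr⟩ := Nat.exists_infinite_primes (n + D * D + D + 2)
  haveI : NeZero r := ⟨hr.ne_zero⟩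
  haveI : Fact (Nat.Prime 2) := ⟨Nat.prime_two⟩
  let E := FiniteField.Extension F 2 r
  let ι : F →+* E := algebraMap F E
  haveI : CharP E 2 := charP_of_injective_ringHom ι.injective 2
  letI : Fintype E := Fintype.ofFinite E
  have hE : Fintype.card E = 2 ^ (h * r) := by
    rw [Fintype.card_eq_nat_card, FiniteField.natCard_extension, ← Fintype.card_eq_nat_card, hF, pow_mul]
  obtain ⟨Bd, hB1, hB2⟩ := good_ext ι hF hE (expand F 2 g) (by omega) hder hq hr (by omega) hop
  have hrr : r ≤ h * r := Nat.le_mul_of_pos_left r hh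
  rw [map_expand] at hB2
  have hlt : (expand E 2 (g.map ι)).natDegree * Bd.card < 2 ^ (h * r) - 1 := by
    rw [← map_expand, natDegree_map, ← hD]
    rw [← hD] at hB1
    have h1 : D * Bd.card ≤ D * D := Nat.mul_le_mul_left _ hB1
    have h2 : h * r < 2 ^ (h * r) := Nat.lt_two_pow_self
    omega
  exact ⟨h * r, by omega, fun hb => blockLen_map_contra ι hE g Bd hB2 hlt hb,
    fun hb => blockLen_GG_contra ι hE g Bd hB2 hlt hb⟩

theorem final_linear {F : Type*} [Field F] [Fintype F] [CharP F 2] {h : ℕ} (hF : Fintype.card F = 2 ^ h)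
    (f : F[X]) (hder : derivative f = 0) (hop : OP f) (h0 : f.eval 0 = 0) (h1 : f.eval 1 = 1)
    (hd : f.natDegree < 2 ^ h) (hlin : ∀ i, f.coeff i ≠ 0 → ∃ v, i = 2 ^ v) :
    ∃ k : ℕ, 0 < k ∧ OEquiv F f (X ^ (2 ^ k)) := by
  classical
  obtain ⟨I, hI⟩ : ∃ I, I = (Finset.range h).filter (fun v => f.coeff (2 ^ v) ≠ 0) := ⟨_, rfl⟩
  have mI : ∀ v, f.coeff (2 ^ v) ≠ 0 → v ∈ I := by
    intro v hv
    rw [hI, Finset.mem_filter, Finset.mem_range]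
    refine ⟨?_, hv⟩
    have h2 : 2 ^ v ≤ f.natDegree := le_natDegree_of_ne_zero hv
    exact (Nat.pow_lt_pow_iff_right (by norm_num)).mp (lt_of_le_of_lt h2 hd)
  have hI1 : ∀ v ∈ I, f.coeff (2 ^ v) ≠ 0 := fun v hv => by
    rw [hI, Finset.mem_filter] at hv; exact hv.2
  have hI2 : ∀ v ∈ I, 1 ≤ v ∧ v < h := by
    intro v hv
    have h3 := hI1 v hv
    rw [hI, Finset.mem_filter, Finset.mem_range] at hv
    refine ⟨?_, hv.1⟩
    rcases Nat.eq_zero_or_pos v with rfl | h4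
    · exact absurd (even_of_derivative_zero hder h3) (by decide)
    · exact h4
  have hsum : f = ∑ i ∈ I, C (f.coeff (2 ^ i)) * X ^ 2 ^ i := by
    ext n
    rw [finsetSum_coeff]
    simp only [coeff_C_mul_X_pow]
    by_cases hn : f.coeff n = 0
    · rw [hn]; symm
      apply Finset.sum_eq_zero
      intro i _
      split_ifs with e
      · rw [← e, hn]
      · rfl
    · obtain ⟨v, rfl⟩ := hlin n hn
      rw [Finset.sum_eq_single v]
      · simp
      · intro b _ hb
        rw [if_neg]
        intro e
        exact hb (Nat.pow_right_injective (le_refl 2) e).symm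
      · intro hv; exact absurd (mI v hn) hv
  have hev : ∀ x, f.eval x = ∑ i ∈ I, f.coeff (2 ^ i) * x ^ 2 ^ i := by
    intro x
    conv_lhs => rw [hsum]
    rw [eval_finsetSum]
    simp
  have hc := payne hF I (fun i => f.coeff (2 ^ i)) hI1 hI2
    (by
      intro x hx
      rw [← hev, ← h0]
      exact hop.1 0 (by simp) x hx)
    (by
      intro x y hx hy hxy
      have := hop.2 0 (by simp) x y hx hy hxy
      rw [h0, add_zero, add_zero, add_zero, add_zero, hev, hev] at this
      exact this)
  have hne : I.card ≠ 0 := by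
    intro h3
    rw [Finset.card_eq_zero] at h3
    rw [hev, h3, Finset.sum_empty] at h1
    exact zero_ne_one h1
  obtain ⟨k, hk⟩ := Finset.card_eq_one.mp (show I.card = 1 by omega)
  have hk1 : f.coeff (2 ^ k) = 1 := by
    rw [hev, hk, Finset.sum_singleton] at h1
    simpa using h1
  have hfX : f = X ^ 2 ^ k := by
    rw [hk, Finset.sum_singleton, hk1, C_1, one_mul] at hsum
    exact hsum
  refine ⟨k, (hI2 k (by rw [hk]; simp)).1, 0, ?_⟩
  rw [add_zero, h1, h0, C_0, add_zero, add_zero, add_zero, comp_X, inv_one, C_1, one_mul]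
  exact hfX.symm

lemma OP.translate {F : Type*} [Field F] [CharP F 2] {f f2 : F[X]} (hop : OP f) (s : F)
    (he : ∀ x, f2.eval x = f.eval (x + s) + f.eval s) : OP f2 := by
  refine ⟨fun t _ x hx h => ?_, fun t _ x y h1 h2 h3 h => ?_⟩
  · rw [he, he] at h
    exact hop.1 (t + s) (by simp) (x + s) (fun e => hx (add_right_cancel e)) (add_right_cancel h)
  · rw [he, he, he] at h
    refine hop.2 (t + s) (by simp) (x + s) (y + s) (fun e => h1 (add_right_cancel e))
      (fun e => h2 (add_right_cancel e)) (fun e => h3 (add_right_cancel e)) ?_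
    have e1 : ∀ a b c : F, (a + c) + (b + c) = a + b := by
      intro a b c
      linear_combination c * (CharTwo.two_eq_zero : (2 : F) = 0)
    rw [e1, e1] at h
    rw [e1, e1]
    exact h

theorem final_six {F : Type*} [Field F] [Fintype F] [CharP F 2] {h : ℕ} (hF : Fintype.card F = 2 ^ h)
    (g : F[X]) (hop : OP (expand F 2 g)) (h0 : g.eval 0 = 0) (h3 : g.natDegree = 3)
    (hq : 16 * (expand F 2 g).natDegree ^ 4 ≤ 2 ^ h) :
    OEquiv F (expand F 2 g) (X ^ 6) := by
  obtain ⟨a, ha⟩ : ∃ a, a = g.coeff 3 := ⟨_, rfl⟩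
  obtain ⟨b, hb⟩ : ∃ a, a = g.coeff 2 := ⟨_, rfl⟩
  obtain ⟨c, hc⟩ : ∃ a, a = g.coeff 1 := ⟨_, rfl⟩
  have two : (2 : F) = 0 := CharTwo.two_eq_zero
  have two' : (2 : F[X]) = 0 := CharTwo.two_eq_zero
  have ha0 : a ≠ 0 := by
    have : g ≠ 0 := by rintro rfl; simp at h3
    rw [ha, ← h3]; exact leadingCoeff_ne_zero.mpr this
  have hg : g = C a * X ^ 3 + C b * X ^ 2 + C c * X := by
    have := g.as_sum_range_C_mul_X_pow
    rw [h3] at this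
    simp only [Finset.sum_range_succ, Finset.sum_range_zero, coeff_zero_eq_eval_zero, h0, ← ha, ← hb, ← hc] at this
    rw [this]
    simp; ring
  have hf : expand F 2 g = C a * X ^ 6 + C b * X ^ 4 + C c * X ^ 2 := by
    rw [hg]; simp only [map_add, map_mul, map_pow, expand_C, expand_X]; ring
  obtain ⟨s, hs⟩ : ∃ s : F, s ^ 2 = b / a := by
    have hinj : Function.Injective (frobenius F 2) := frobenius_inj F 2
    obtain ⟨y, hy⟩ := Finite.injective_iff_surjective.mp hinj (b / a)
    exact ⟨y, by rw [← hy, frobenius_def]⟩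
  have hbs : b = a * s ^ 2 := by rw [hs]; field_simp
  obtain ⟨c', hc'⟩ : ∃ c', c' = s ^ 4 + c / a := ⟨_, rfl⟩
  have hcc : c = a * (c' - s ^ 4) := by rw [hc']; field_simp; ring
  have hcomp : (expand F 2 g).comp (X + C s) + C ((expand F 2 g).eval s) = expand F 2 (C a * (X ^ 3 + C c' * X)) := by
    rw [hf, hbs, hcc]
    simp only [map_add, map_mul, map_pow, map_sub, expand_C, expand_X, add_comp, mul_comp, pow_comp, C_comp, X_comp,
      eval_add, eval_mul, eval_pow, eval_C, eval_X, sub_comp, eval_sub]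
    linear_combination (C a * (X * C s * C c' + 4 * X * C s ^ 5 + 10 * X ^ 2 * C s ^ 4 + 12 * X ^ 3 * C s ^ 3 +
      8 * X ^ 4 * C s ^ 2 + 3 * X ^ 5 * C s + C s ^ 2 * C c' + C s ^ 6)) * two'
  have hev : ∀ x, (expand F 2 (C a * (X ^ 3 + C c' * X))).eval x = (expand F 2 g).eval (x + s) + (expand F 2 g).eval s := by
    intro x
    rw [← hcomp]; simp [eval_comp]
  have hdeg : (C a * (X ^ 3 + C c' * X)).natDegree = 3 := by
    rw [natDegree_C_mul ha0]; compute_degree!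
  by_cases hz : c' = 0
  · refine ⟨s, ?_⟩
    rw [hcomp, ← hev 1, hz]
    simp only [map_add, map_mul, map_pow, expand_C, expand_X, C_0, zero_mul, add_zero, eval_mul, eval_pow, eval_C, eval_X, one_pow, mul_one]
    rw [← mul_assoc, ← C_mul, inv_mul_cancel₀ ha0, C_1, one_mul, ← pow_mul]
  · exfalso
    obtain ⟨n, hn⟩ := caseB (R := F) ha0 hz
    obtain ⟨H, h1, h2, -⟩ := ext_exists hF _ (by rw [hdeg]; norm_num)
      (by rw [natDegree_expand, hdeg]; rw [natDegree_expand, h3] at hq; exact hq) (hop.translate s hev) n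
    exact h2 (hn H h1)

/-- If `f` is an o-polynomial of `F_q` of degree less than `(1/2) q^(1/4)`,
then `f` is equivalent to `x^6` or to `x^(2^k)` for some positive integer `k`. -/
theorem opoly_classification (F : Type*) [Field F] [Finite F] (h : ℕ) (hh : 0 < h)
    (hq : Nat.card F = 2 ^ h) (f : F[X]) (hf : IsOPoly F f)
    (hdeg : (f.natDegree : ℝ) < (1 / 2) * (Nat.card F : ℝ) ^ ((1 : ℝ) / 4)) :
    OEquiv F f (X ^ 6) ∨ ∃ k : ℕ, 0 < k ∧ OEquiv F f (X ^ (2 ^ k)) := by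
  classical
  obtain ⟨-, hbij, h0, h1, hdet⟩ := hf
  let _ : Fintype F := Fintype.ofFinite F
  have hF : Fintype.card F = 2 ^ h := by rw [Fintype.card_eq_nat_card, hq]
  have hch : CharP F 2 := by
    obtain ⟨p, hp⟩ := CharP.exists F
    obtain ⟨n, hpp, hn⟩ := FiniteField.card F p
    have h2 : p ∣ 2 ^ h := by
      rw [← hF, hn]; exact dvd_pow_self p n.ne_zero
    have h3 : p = 2 := (Nat.prime_dvd_prime_iff_eq hpp Nat.prime_two).mp (hpp.dvd_of_dvd_pow h2)
    rw [h3] at hp; exact hp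
  have hd4 : 16 * f.natDegree ^ 4 < 2 ^ h := by
    have h2 : ((f.natDegree : ℝ)) ^ 4 < ((1 / 2) * (Nat.card F : ℝ) ^ ((1 : ℝ) / 4)) ^ 4 :=
      pow_lt_pow_left₀ hdeg (by positivity) (by norm_num)
    rw [mul_pow, ← Real.rpow_natCast ((Nat.card F : ℝ) ^ ((1 : ℝ) / 4)), ← Real.rpow_mul (by positivity), hq] at h2
    norm_num at h2
    have h3 : (16 : ℝ) * (f.natDegree : ℝ) ^ 4 < 2 ^ h := by linarith
    exact_mod_cast h3
  have hop : OP f := by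
    refine ⟨fun s _ x hx he => hx (hbij.1 he), fun s _ x y hxs hys hxy he => ?_⟩
    apply hdet x y s hxy hxs hys
    rw [Matrix.det_fin_three]
    simp only [Matrix.of_apply, Matrix.cons_val', Matrix.cons_val_zero, Matrix.cons_val_one, Matrix.cons_val]
    have two : (2 : F) = 0 := CharTwo.two_eq_zero
    linear_combination he + (f.eval y * x - y * f.eval x) * two
  have hd1 : 1 ≤ f.natDegree := by
    by_contra hc
    have h2 : f.natDegree = 0 := by omega
    rw [eq_C_of_natDegree_eq_zero h2, eval_C] at h0 h1
    rw [h0] at h1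
    exact zero_ne_one h1
  have hh2 : 2 ≤ h := by
    have h2 : 1 ≤ f.natDegree ^ 4 := Nat.one_le_pow _ _ hd1
    by_contra hc
    have h3 : h = 1 := by omega
    rw [h3] at hd4; omega
  have hdlt : f.natDegree < 2 ^ h - 1 := by
    have h2 : f.natDegree ≤ f.natDegree ^ 4 := Nat.le_self_pow (by norm_num) _
    omega
  have hder : derivative f = 0 := even_of_opoly hF hh2 f (fun s x => hop.1 s (by simp) x)
    (fun s x y => hop.2 s (by simp) x y) hdlt
  obtain ⟨g, hg⟩ : ∃ g, expand F 2 g = f := ⟨contract 2 f, expand_contract 2 hder two_ne_zero⟩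
  have hdg : f.natDegree = g.natDegree * 2 := by rw [← hg, natDegree_expand]
  have hg0 : g.eval 0 = 0 := by
    rw [← hg, expand_eval] at h0; simpa using h0
  have hq' : 16 * (expand F 2 g).natDegree ^ 4 ≤ 2 ^ h := by rw [hg]; exact hd4.le
  have hop' : OP (expand F 2 g) := by rw [hg]; exact hop
  have hext := ext_exists hF g (by omega) hq' hop'
  by_cases h3 : g.natDegree = 3
  · left; rw [← hg]; exact final_six hF g hop' hg0 h3 hq'
  right
  by_cases hpow : ∀ n, g.natDegree ≠ 2 ^ n
  · exfalso
    have h4 : g.natDegree ≠ 1 := by simpa using hpow 0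
    obtain ⟨n, hn⟩ := caseA (g := g) (by omega) h3 hpow
    obtain ⟨H, e1, e2, -⟩ := hext n
    exact e2 (hn H e1)
  push Not at hpow
  obtain ⟨κ, hκ⟩ := hpow
  by_cases hlin : ∀ i, g.coeff i ≠ 0 → ∃ v, i = 2 ^ v
  · refine final_linear hF f hder hop h0 h1 (by omega) ?_
    intro i hi
    obtain ⟨m, hm⟩ := even_of_derivative_zero hder hi
    rw [← hg, hm, ← two_mul, coeff_expand_mul' (by norm_num)] at hi
    obtain ⟨v, hv⟩ := hlin m hi
    exact ⟨v + 1, by rw [hm, hv, pow_succ]; ring⟩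
  · exfalso
    push Not at hlin
    obtain ⟨i0, hi0, hi1⟩ := hlin
    obtain ⟨S, hS⟩ : ∃ S, S = g.support.filter (fun i => ∀ v, i ≠ 2 ^ v) := ⟨_, rfl⟩
    have mS : ∀ i, i ∈ S ↔ g.coeff i ≠ 0 ∧ ∀ v, i ≠ 2 ^ v := by
      intro i; rw [hS, Finset.mem_filter, mem_support_iff]
    have hne : S.Nonempty := ⟨i0, (mS i0).mpr ⟨hi0, hi1⟩⟩
    obtain ⟨e, he, hmax⟩ : ∃ e ∈ S, ∀ i ∈ S, i ≤ e := ⟨S.max' hne, S.max'_mem hne, fun i hi => S.le_max' i hi⟩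
    obtain ⟨he1, he2⟩ := (mS e).mp he
    have hcc : CC g κ e := by
      refine ⟨hκ, ?_, ?_, he1, ?_⟩
      · have h4 : e ≤ g.natDegree := le_natDegree_of_ne_zero he1
        have h5 := he2 κ
        omega
      · rcases Nat.eq_zero_or_pos e with rfl | h4
        · exact absurd (by rw [coeff_zero_eq_eval_zero, hg0]) he1
        · exact h4
      · intro i hi hi2
        by_contra hc
        push Not at hc
        have := hmax i ((mS i).mpr ⟨hi2, hc⟩)
        omega
    obtain ⟨n, hn⟩ := caseC hcc he2
    obtain ⟨H, e1, -, e2⟩ := hext n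
    exact e2 (hn H e1)
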